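/- Let d = 2. Let q, r, q̄, r̄ ≥ 2 satisfy 1/q ≤ (3/4)(1/2 − 1/r) and 1/q̄ ≤ (3/4)(1/2 − 1/r̄). Then there is a constant C = C(q,r,q̄,r̄) such that for all f, g ∈ ℓ²(ℤ²) and all F ∈ L^{q̄'}_t ℓ^{r̄'}_x, the function u(t) = cos(t√(1−Δ))f + (sin(t√(1−Δ))/√(1−Δ))g + ∫₀^t (sin((t−s)√(1−Δ))/√(1−Δ))F(s) ds satisfies ‖u‖_{L^q_t ℓ^r_x} ≤ C(‖f‖_{ℓ²} + ‖g‖_{ℓ²} + ‖F‖_{L^{q̄'}_t ℓ^{r̄'}_x}). -/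

import Mathlib

open MeasureTheory Real
open scoped ENNReal

noncomputable section

/-- Dispersion relation of the discrete Klein--Gordon equation on `ℤ^d`. -/
def omegaKG (d : ℕ) (ξ : Fin d → ℝ) : ℝ :=
  Real.sqrt (1 + ∑ j : Fin d, 2 * (1 - Real.cos (ξ j)))

/-- The fundamental domain `[0, 2π]^d` of the torus. -/
def cube (d : ℕ) : Set (Fin d → ℝ) := Set.Icc 0 (fun _ => 2 * Real.pi)

/-- The convolution kernel of the Fourier multiplier on `ℤ^d` with symbol `m(ξ)`. -/
def multKernel (d : ℕ) (m : (Fin d → ℝ) → ℝ) (x : Fin d → ℤ) : ℂ :=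
  ((((2 * Real.pi) ^ d)⁻¹ : ℝ) : ℂ) *
    ∫ ξ in cube d,
      Complex.exp (Complex.I * ((∑ j : Fin d, (x j : ℝ) * ξ j : ℝ) : ℂ)) * ((m ξ : ℝ) : ℂ)

/-- The propagator `cos(t√(1−Δ))`, realized as the Fourier multiplier with symbol
`cos(t ω(ξ))`. -/
def cosProp (d : ℕ) (t : ℝ) (f : (Fin d → ℤ) → ℂ) (x : Fin d → ℤ) : ℂ :=
  ∑' y : Fin d → ℤ, multKernel d (fun ξ => Real.cos (t * omegaKG d ξ)) (x - y) * f y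

/-- The propagator `sin(t√(1−Δ))/√(1−Δ)`, realized as the Fourier multiplier with symbol
`sin(t ω(ξ))/ω(ξ)`. -/
def sinProp (d : ℕ) (t : ℝ) (f : (Fin d → ℤ) → ℂ) (x : Fin d → ℤ) : ℂ :=
  ∑' y : Fin d → ℤ, multKernel d (fun ξ => Real.sin (t * omegaKG d ξ) / omegaKG d ξ) (x - y) * f y

/-- The operator `√(1−Δ)`, realized as the Fourier multiplier with symbol `ω(ξ)`. -/
def sqrtOneSubLap (d : ℕ) (f : (Fin d → ℤ) → ℂ) (x : Fin d → ℤ) : ℂ :=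
  ∑' y : Fin d → ℤ, multKernel d (omegaKG d) (x - y) * f y

/-- The solution of the inhomogeneous discrete Klein--Gordon equation with data `(f,g)`
and forcing term `F`, given by Duhamel's formula. -/
def duhamel (d : ℕ) (t : ℝ) (f g : (Fin d → ℤ) → ℂ) (F : ℝ → (Fin d → ℤ) → ℂ)
    (x : Fin d → ℤ) : ℂ :=
  cosProp d t f x + sinProp d t g x + ∫ s in (0:ℝ)..t, sinProp d (t - s) (F s) x

/-- The `L^q` norm in time of an `ℝ≥0∞`-valued function. -/
def lqNorm (q : ℝ≥0∞) (g : ℝ → ℝ≥0∞) : ℝ≥0∞ :=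
  if q = ∞ then essSup g volume else (∫⁻ t, g t ^ q.toReal) ^ (1 / q.toReal)

/-- The mixed space-time norm `‖F‖_{L^q_t ℓ^r_x}`. -/
def mixedNorm (d : ℕ) (q r : ℝ≥0∞) (F : ℝ → (Fin d → ℤ) → ℂ) : ℝ≥0∞ :=
  lqNorm q fun t => eLpNorm (F t) r Measure.count

section

/-- The oscillating factor `e^{iθ}`. -/
def cis (θ : ℝ) : ℂ := Complex.exp (Complex.I * (θ : ℂ))

lemma norm_cis (θ : ℝ) : ‖cis θ‖ = 1 := by
  unfold cis; rw [mul_comm]; exact Complex.norm_exp_ofReal_mul_I θ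

lemma cis_add (a b : ℝ) : cis (a + b) = cis a * cis b := by
  unfold cis; rw [← Complex.exp_add]; push_cast; ring_nf

lemma cis_zero : cis 0 = 1 := by simp [cis]

lemma conj_cis (θ : ℝ) : (starRingEnd ℂ) (cis θ) = cis (-θ) := by
  unfold cis; rw [← Complex.exp_conj]; simp

@[fun_prop]
lemma continuous_cis : Continuous cis := by unfold cis; fun_prop

@[fun_prop]
lemma measurable_cis : Measurable cis := continuous_cis.measurable

lemma hasDerivAt_cis {g : ℝ → ℝ} {g' x : ℝ} (h : HasDerivAt g g' x) :
    HasDerivAt (fun x => cis (g x)) (Complex.I * g' * cis (g x)) x := by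
  unfold cis
  have := (h.ofReal_comp.const_mul Complex.I).cexp
  convert this using 1; ring

lemma norm_integral_cis_neg (g : ℝ → ℝ) (a b : ℝ) :
    ‖∫ x in a..b, cis (-g x)‖ = ‖∫ x in a..b, cis (g x)‖ := by
  have : ∀ x, cis (-g x) = (starRingEnd ℂ) (cis (g x)) := fun x => (conj_cis _).symm
  simp_rw [this, intervalIntegral.intervalIntegral_eq_integral_uIoc, integral_conj]
  split_ifs <;> simp

/-- Van der Corput's estimate for a monotone derivative bounded below. -/
lemma vdc_first {g g1 g2 : ℝ → ℝ} (h0 : ∀ x, HasDerivAt g (g1 x) x)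
    (h1 : ∀ x, HasDerivAt g1 (g2 x) x) (hc : Continuous g2) {a b Λ : ℝ} (hab : a ≤ b)
    (hΛ : 0 < Λ) (hg1 : ∀ x ∈ Set.Icc a b, Λ ≤ g1 x)
    (hg2 : (∀ x ∈ Set.Icc a b, 0 ≤ g2 x) ∨ (∀ x ∈ Set.Icc a b, g2 x ≤ 0)) :
    ‖∫ x in a..b, cis (g x)‖ ≤ 3 / Λ := by
  have hcg : Continuous g := continuous_iff_continuousAt.2 fun x => (h0 x).continuousAt
  have hcg1 : Continuous g1 := continuous_iff_continuousAt.2 fun x => (h1 x).continuousAt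
  have hpos : ∀ x ∈ Set.uIcc a b, g1 x ≠ 0 := fun x hx => by
    rw [Set.uIcc_of_le hab] at hx; linarith [hg1 x hx]
  have hne : ∀ x ∈ Set.uIcc a b, (g1 x : ℂ) ≠ 0 := fun x hx => by exact_mod_cast hpos x hx
  -- derivative of the reciprocal
  have hinv : ∀ x ∈ Set.uIcc a b, HasDerivAt (fun x => (g1 x)⁻¹) (-g2 x / g1 x ^ 2) x :=
    fun x hx => (h1 x).inv (hpos x hx)
  have hcq : ContinuousOn (fun x => -g2 x / g1 x ^ 2) (Set.uIcc a b) :=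
    (hc.neg.continuousOn).div (hcg1.pow 2).continuousOn fun x hx => pow_ne_zero _ (hpos x hx)
  have hparts : ∀ x ∈ Set.uIcc a b, HasDerivAt
      (fun x => -Complex.I * (((g1 x)⁻¹ : ℝ) : ℂ) * cis (g x))
      (cis (g x) + -Complex.I * ((-g2 x / g1 x ^ 2 : ℝ) : ℂ) * cis (g x)) x := by
    intro x hx
    have := ((hinv x hx).ofReal_comp.const_mul (-Complex.I)).mul (hasDerivAt_cis (h0 x))
    refine HasDerivAt.congr_deriv this ?_
    have h := hne x hx
    have : (((g1 x)⁻¹ : ℝ) : ℂ) * (g1 x : ℂ) = 1 := by push_cast; field_simp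
    linear_combination -Complex.I ^ 2 * cis (g x) * this - cis (g x) * Complex.I_sq
  have hi1 : IntervalIntegrable (fun x => cis (g x)) volume a b :=
    (by fun_prop : Continuous fun x => cis (g x)).intervalIntegrable _ _
  have hi2 : IntervalIntegrable
      (fun x => -Complex.I * ((-g2 x / g1 x ^ 2 : ℝ) : ℂ) * cis (g x)) volume a b := by
    apply ContinuousOn.intervalIntegrable
    refine ((continuousOn_const).mul ?_).mul (by fun_prop : Continuous fun x => cis (g x)).continuousOn
    exact Complex.continuous_ofReal.comp_continuousOn hcq
  have hft := intervalIntegral.integral_eq_sub_of_hasDerivAt hparts (hi1.add hi2)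
  rw [intervalIntegral.integral_add hi1 hi2] at hft
  have ha : a ∈ Set.Icc a b := ⟨le_rfl, hab⟩
  have hb : b ∈ Set.Icc a b := ⟨hab, le_rfl⟩
  have hbd : ∀ x ∈ Set.Icc a b, 0 < (g1 x)⁻¹ ∧ (g1 x)⁻¹ ≤ 1 / Λ := fun x hx => by
    have := hg1 x hx
    refine ⟨inv_pos.2 (by linarith), ?_⟩
    rw [one_div]; exact inv_anti₀ hΛ this
  have hn : ∀ x ∈ Set.Icc a b, ‖-Complex.I * (((g1 x)⁻¹ : ℝ) : ℂ) * cis (g x)‖ = (g1 x)⁻¹ :=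
    fun x hx => by
      rw [norm_mul, norm_mul, norm_cis, norm_neg, Complex.norm_I, Complex.norm_real,
        Real.norm_of_nonneg (hbd x hx).1.le]; ring
  have hmain2 : ‖∫ x in a..b, -Complex.I * ((-g2 x / g1 x ^ 2 : ℝ) : ℂ) * cis (g x)‖ ≤ 1 / Λ := by
    have e1 : ‖∫ x in a..b, -Complex.I * ((-g2 x / g1 x ^ 2 : ℝ) : ℂ) * cis (g x)‖
        ≤ ∫ x in a..b, |(-g2 x / g1 x ^ 2)| := by
      refine (intervalIntegral.norm_integral_le_integral_norm hab).trans (le_of_eq ?_)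
      congr 1; ext x
      rw [norm_mul, norm_mul, norm_cis, norm_neg, Complex.norm_I, Complex.norm_real,
        Real.norm_eq_abs]; ring
    have e2 := intervalIntegral.integral_eq_sub_of_hasDerivAt hinv (hcq.intervalIntegrable)
    refine e1.trans ?_
    rcases hg2 with hg2 | hg2
    · have : ∫ x in a..b, |(-g2 x / g1 x ^ 2)| = ∫ x in a..b, -(-g2 x / g1 x ^ 2) := by
        apply intervalIntegral.integral_congr
        intro x hx
        rw [Set.uIcc_of_le hab] at hx
        apply abs_of_nonpos
        have := hg2 x hx
        exact div_nonpos_of_nonpos_of_nonneg (by linarith) (by positivity)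
      rw [this, intervalIntegral.integral_neg, e2]
      linarith [(hbd a ha).2, (hbd b hb).1]
    · have : ∫ x in a..b, |(-g2 x / g1 x ^ 2)| = ∫ x in a..b, (-g2 x / g1 x ^ 2) := by
        apply intervalIntegral.integral_congr
        intro x hx
        rw [Set.uIcc_of_le hab] at hx
        apply abs_of_nonneg
        have := hg2 x hx
        exact div_nonneg (by linarith) (by positivity)
      rw [this, e2]
      linarith [(hbd b hb).2, (hbd a ha).1]
  have hfin : ∫ x in a..b, cis (g x) = (-Complex.I * (((g1 b)⁻¹ : ℝ) : ℂ) * cis (g b)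
      - -Complex.I * (((g1 a)⁻¹ : ℝ) : ℂ) * cis (g a))
      - ∫ x in a..b, -Complex.I * ((-g2 x / g1 x ^ 2 : ℝ) : ℂ) * cis (g x) := by
    rw [← hft]; ring
  rw [hfin]
  refine (norm_sub_le _ _).trans ?_
  have := norm_sub_le (-Complex.I * (((g1 b)⁻¹ : ℝ) : ℂ) * cis (g b))
      (-Complex.I * (((g1 a)⁻¹ : ℝ) : ℂ) * cis (g a))
  rw [hn a ha, hn b hb] at this
  have e3 : 3 / Λ = 1 / Λ + 1 / Λ + 1 / Λ := by ring
  linarith [(hbd b hb).2, (hbd a ha).2]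

/-- The splitting step in van der Corput's induction: remove the part of the interval where a
function with derivative at least `Λ` is smaller than `Λ δ`. -/
lemma vdc_split {h h' : ℝ → ℝ} (hd : ∀ x, HasDerivAt h (h' x) x) {F : ℝ → ℂ} (hF : Continuous F)
    (hF1 : ∀ x, ‖F x‖ ≤ 1) {a b Λ δ K : ℝ} (hab : a ≤ b) (hδ : 0 < δ) (hΛ : 0 < Λ)
    (hK : 0 ≤ K) (hh : ∀ x ∈ Set.Icc a b, Λ ≤ h' x)
    (hsub : ∀ a' b', a ≤ a' → a' ≤ b' → b' ≤ b →
      ((∀ x ∈ Set.Icc a' b', Λ * δ ≤ h x) ∨ (∀ x ∈ Set.Icc a' b', h x ≤ -(Λ * δ))) →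
      ‖∫ x in a'..b', F x‖ ≤ K) :
    ‖∫ x in a..b, F x‖ ≤ 2 * K + 2 * δ := by
  have hch : Continuous h := continuous_iff_continuousAt.2 fun x => (hd x).continuousAt
  have hmv : ∀ x y, a ≤ x → x ≤ y → y ≤ b → Λ * (y - x) ≤ h y - h x := by
    intro x y hx hxy hy
    refine (convex_Icc a b).mul_sub_le_image_sub_of_le_deriv hch.continuousOn
      (fun z _ => (hd z).differentiableAt.differentiableWithinAt) (fun z hz => ?_) x ⟨hx, hxy.trans hy⟩
      y ⟨hx.trans hxy, hy⟩ hxy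
    rw [(hd z).deriv]; exact hh z (interior_subset hz)
  obtain ⟨c, hc, hc1, hc2⟩ : ∃ c ∈ Set.Icc a b, (∀ x, c < x → x ≤ b → Λ * (x - c) ≤ h x) ∧
      (∀ x, a ≤ x → x < c → h x ≤ -(Λ * (c - x))) := by
    by_cases h1 : 0 ≤ h a
    · refine ⟨a, ⟨le_rfl, hab⟩, fun x hx hxb => ?_, fun x hx hxa => absurd hxa (not_lt.2 hx)⟩
      linarith [hmv a x le_rfl hx.le hxb]
    by_cases h2 : h b ≤ 0
    · refine ⟨b, ⟨hab, le_rfl⟩, fun x hx hxb => absurd hxb (not_le.2 hx), fun x hx hxb => ?_⟩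
      linarith [hmv x b hx hxb.le le_rfl]
    obtain ⟨c, hc, hc0⟩ := intermediate_value_Icc hab hch.continuousOn
      (show (0:ℝ) ∈ Set.Icc (h a) (h b) from ⟨by linarith, by linarith⟩)
    refine ⟨c, hc, fun x hx hxb => ?_, fun x hx hxc => ?_⟩
    · linarith [hmv c x hc.1 hx.le hxb]
    · linarith [hmv x c hx hxc.le hc.2]
  have hInt : ∀ u v, IntervalIntegrable F volume u v := fun u v => hF.intervalIntegrable _ _
  set p := max a (c - δ) with hp
  set r := min b (c + δ) with hr
  have hap : a ≤ p := le_max_left _ _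
  have hpc : p ≤ c := max_le hc.1 (by linarith)
  have hcr : c ≤ r := le_min hc.2 (by linarith)
  have hrb : r ≤ b := min_le_left _ _
  have k1 : ‖∫ x in a..p, F x‖ ≤ K := by
    rcases eq_or_lt_of_le hap with he | hl
    · rw [← he]; simpa using hK
    · have hpe : p = c - δ := by
        rcases max_choice a (c - δ) with h | h
        · exact absurd (hp.trans h) hl.ne'
        · exact hp.trans h
      refine hsub a p le_rfl hap (hpc.trans hc.2) (Or.inr fun x hx => ?_)
      have := hc2 x hx.1 (by linarith [hx.2])
      have : Λ * δ ≤ Λ * (c - x) := mul_le_mul_of_nonneg_left (by linarith [hx.2]) hΛ.le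
      linarith
  have k3 : ‖∫ x in r..b, F x‖ ≤ K := by
    rcases eq_or_lt_of_le hrb with he | hl
    · rw [he]; simpa using hK
    · have hre : r = c + δ := by
        rcases min_choice b (c + δ) with h | h
        · exact absurd (hr.trans h) hl.ne
        · exact hr.trans h
      refine hsub r b (hc.1.trans hcr) hrb le_rfl (Or.inl fun x hx => ?_)
      have := hc1 x (by linarith [hx.1]) hx.2
      have : Λ * δ ≤ Λ * (x - c) := mul_le_mul_of_nonneg_left (by linarith [hx.1]) hΛ.le
      linarith
  have k2 : ‖∫ x in p..r, F x‖ ≤ 2 * δ := by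
    refine (intervalIntegral.norm_integral_le_of_norm_le_const (C := 1) fun x _ => hF1 x).trans ?_
    rw [one_mul, abs_of_nonneg (by linarith)]
    linarith [le_max_right a (c - δ), min_le_right b (c + δ)]
  rw [← intervalIntegral.integral_add_adjacent_intervals (hInt a p) (hInt p b),
    ← intervalIntegral.integral_add_adjacent_intervals (hInt p r) (hInt r b)]
  refine (norm_add_le _ _).trans ?_
  have := norm_add_le (∫ x in p..r, F x) (∫ x in r..b, F x)
  linarith

/-- Van der Corput's lemma for derivatives of order at least two. -/
lemma vdc_higher (k : ℕ) : ∃ C : ℝ, 0 < C ∧ ∀ (f : ℕ → ℝ → ℝ)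
    (_ : ∀ j x, HasDerivAt (f j) (f (j + 1) x) x) (a b Λ : ℝ), a ≤ b → 0 < Λ →
    ((∀ x ∈ Set.Icc a b, Λ ≤ f (k + 2) x) ∨ (∀ x ∈ Set.Icc a b, f (k + 2) x ≤ -Λ)) →
    ‖∫ x in a..b, cis (f 0 x)‖ ≤ C * Λ ^ (-(1 / ((k : ℝ) + 2))) := by
  -- reduce to the positive sign
  suffices H : ∃ C : ℝ, 0 < C ∧ ∀ (f : ℕ → ℝ → ℝ)
      (_ : ∀ j x, HasDerivAt (f j) (f (j + 1) x) x) (a b Λ : ℝ), a ≤ b → 0 < Λ →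
      (∀ x ∈ Set.Icc a b, Λ ≤ f (k + 2) x) →
      ‖∫ x in a..b, cis (f 0 x)‖ ≤ C * Λ ^ (-(1 / ((k : ℝ) + 2))) by
    obtain ⟨C, hC, H⟩ := H
    refine ⟨C, hC, fun f hf a b Λ hab hΛ h => ?_⟩
    rcases h with h | h
    · exact H f hf a b Λ hab hΛ h
    · have := H (fun j x => -f j x) (fun j x => (hf j x).neg) a b Λ hab hΛ
        (fun x hx => by linarith [h x hx])
      rwa [norm_integral_cis_neg] at this
  induction k with
  | zero =>
    refine ⟨8, by norm_num, fun f hf a b Λ hab hΛ h => ?_⟩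
    have hcont : ∀ j, Continuous (f j) := fun j =>
      continuous_iff_continuousAt.2 fun x => (hf j x).continuousAt
    set δ := Λ ^ (-(1 / 2 : ℝ)) with hδ
    have hδ0 : 0 < δ := rpow_pos_of_pos hΛ _
    have hΛδ : Λ * δ = δ⁻¹ := by
      rw [hδ, ← rpow_neg hΛ.le]
      nth_rewrite 1 [← rpow_one Λ]
      rw [← rpow_add hΛ]; norm_num
    have := vdc_split (hf 1) (F := fun x => cis (f 0 x)) (by have := hcont 0; fun_prop)
      (fun x => (norm_cis _).le) hab hδ0 hΛ (K := 3 / (Λ * δ)) (by positivity) h ?_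
    · refine this.trans (le_of_eq ?_)
      rw [hΛδ]
      simp only [Nat.cast_zero, zero_add]
      rw [← hδ]; field_simp; ring
    · intro a' b' ha' hab' hb' hs
      rcases hs with hs | hs
      · exact vdc_first (hf 0) (hf 1) (hcont 2) hab' (by positivity) hs
          (Or.inl fun x hx => hΛ.le.trans (h x ⟨ha'.trans hx.1, hx.2.trans hb'⟩))
      · have := vdc_first (g := fun x => -f 0 x) (g1 := fun x => -f 1 x) (g2 := fun x => -f 2 x)
          (fun x => (hf 0 x).neg) (fun x => (hf 1 x).neg)
          (hcont 2).neg hab' (Λ := Λ * δ) (by positivity)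
          (fun x hx => by linarith [hs x hx])
          (Or.inr fun x hx => by linarith [h x ⟨ha'.trans hx.1, hx.2.trans hb'⟩])
        rwa [norm_integral_cis_neg] at this
  | succ k ih =>
    obtain ⟨C, hC, ih⟩ := ih
    refine ⟨2 * C + 2, by positivity, fun f hf a b Λ hab hΛ h => ?_⟩
    have hcont : ∀ j, Continuous (f j) := fun j =>
      continuous_iff_continuousAt.2 fun x => (hf j x).continuousAt
    set δ := Λ ^ (-(1 / ((k : ℝ) + 3))) with hδ
    have hδ0 : 0 < δ := rpow_pos_of_pos hΛ _
    have hkey : (Λ * δ) ^ (-(1 / ((k : ℝ) + 2))) = δ := by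
      rw [hδ]
      nth_rewrite 1 [← rpow_one Λ]
      rw [← rpow_add hΛ, ← rpow_mul hΛ.le]
      congr 1
      have : (k : ℝ) + 2 ≠ 0 := by positivity
      have : (k : ℝ) + 3 ≠ 0 := by positivity
      field_simp; ring
    have := vdc_split (hf (k + 2)) (F := fun x => cis (f 0 x)) (by have := hcont 0; fun_prop)
      (fun x => (norm_cis _).le) hab hδ0 hΛ (K := C * δ) (by positivity) h ?_
    · refine this.trans (le_of_eq ?_)
      have : (((k + 1 : ℕ) : ℝ) + 2) = (k : ℝ) + 3 := by push_cast; ring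
      rw [this, ← hδ]; ring
    · intro a' b' ha' hab' hb' hs
      rcases hs with hs | hs
      · have := ih f hf a' b' (Λ * δ) hab' (by positivity) hs
        rwa [hkey] at this
      · have := ih (fun j x => -f j x) (fun j x => (hf j x).neg) a' b' (Λ * δ) hab'
          (by positivity) (fun x hx => by linarith [hs x hx])
        rwa [hkey, norm_integral_cis_neg] at this

/-- Insertion of a `C¹` amplitude in an oscillatory integral. -/
lemma norm_integral_amplitude_le {F : ℝ → ℂ} (hF : Continuous F) {β β' : ℝ → ℝ}
    (hβ : ∀ x, HasDerivAt β (β' x) x) (hβ' : Continuous β') {a b K B : ℝ} (hab : a ≤ b)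
    (hK : ∀ x ∈ Set.Icc a b, ‖∫ y in a..x, F y‖ ≤ K)
    (hB : ∀ x ∈ Set.Icc a b, |β x| ≤ B) (hB' : ∀ x ∈ Set.Icc a b, |β' x| ≤ B) :
    ‖∫ x in a..b, (β x : ℂ) * F x‖ ≤ B * (1 + (b - a)) * K := by
  have ha : a ∈ Set.Icc a b := ⟨le_rfl, hab⟩
  have hb : b ∈ Set.Icc a b := ⟨hab, le_rfl⟩
  have hK0 : 0 ≤ K := (norm_nonneg _).trans (hK a ha)
  have hB0 : 0 ≤ B := (abs_nonneg _).trans (hB a ha)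
  have hE : ∀ x, HasDerivAt (fun x => ∫ y in a..x, F y) (F x) x := fun x =>
    intervalIntegral.integral_hasDerivAt_right (hF.intervalIntegrable _ _)
      hF.aestronglyMeasurable.stronglyMeasurableAtFilter hF.continuousAt
  have hEc : Continuous (fun x => ∫ y in a..x, F y) :=
    continuous_iff_continuousAt.2 fun x => (hE x).continuousAt
  have hip := intervalIntegral.integral_mul_deriv_eq_deriv_mul (a := a) (b := b)
    (u := fun x => (β x : ℂ)) (v := fun x => ∫ y in a..x, F y) (u' := fun x => (β' x : ℂ)) (v' := F)
    (fun x _ => (hβ x).ofReal_comp) (fun x _ => hE x)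
    ((Complex.continuous_ofReal.comp hβ').intervalIntegrable _ _) (hF.intervalIntegrable _ _)
  rw [hip]
  simp only [intervalIntegral.integral_same, mul_zero, sub_zero]
  refine (norm_sub_le _ _).trans ?_
  have e1 : ‖(β b : ℂ) * ∫ y in a..b, F y‖ ≤ B * K := by
    rw [norm_mul, Complex.norm_real]
    exact mul_le_mul (hB b hb) (hK b hb) (norm_nonneg _) hB0
  have e2 : ‖∫ x in a..b, (β' x : ℂ) * ∫ y in a..x, F y‖ ≤ B * K * |b - a| := by
    refine intervalIntegral.norm_integral_le_of_norm_le_const fun x hx => ?_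
    rw [Set.uIoc_of_le hab] at hx
    have hx' : x ∈ Set.Icc a b := ⟨hx.1.le, hx.2⟩
    rw [norm_mul, Complex.norm_real]
    exact mul_le_mul (hB' x hx') (hK x hx') (norm_nonneg _) hB0
  rw [abs_of_nonneg (by linarith)] at e2
  nlinarith

end

section

lemma hasDerivAt_intervalIntegral_param {F F' : ℝ → ℝ → ℂ}
    (hF : Continuous (Function.uncurry F)) (hF' : Continuous (Function.uncurry F'))
    (h : ∀ y x, HasDerivAt (fun y => F y x) (F' y x) y) (a b y0 : ℝ) :
    HasDerivAt (fun y => ∫ x in a..b, F y x) (∫ x in a..b, F' y0 x) y0 := by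
  have hc : ∀ y, Continuous (F y) := fun y => by
    have : F y = Function.uncurry F ∘ fun x => (y, x) := rfl
    rw [this]; fun_prop
  have hc' : ∀ y, Continuous (F' y) := fun y => by
    have : F' y = Function.uncurry F' ∘ fun x => (y, x) := rfl
    rw [this]; fun_prop
  obtain ⟨M, hM⟩ := ((isCompact_Icc (a := y0 - 1) (b := y0 + 1)).prod
    (isCompact_uIcc (a := a) (b := b))).exists_bound_of_continuousOn hF'.continuousOn
  refine (intervalIntegral.hasDerivAt_integral_of_dominated_loc_of_deriv_le (F := F) (F' := F')
    (bound := fun _ => M) (Icc_mem_nhds (a := y0 - 1) (b := y0 + 1) (by linarith) (by linarith))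
    (.of_forall fun y => (hc y).aestronglyMeasurable) ((hc y0).intervalIntegrable _ _)
    (hc' y0).aestronglyMeasurable ?_ intervalIntegrable_const (.of_forall fun x _ y _ => h y x)).2
  exact .of_forall fun x hx y hy => hM (y, x) ⟨hy, Set.uIoc_subset_uIcc hx⟩

/-- Integration by parts away from the stationary point `z`. -/
lemma norm_integral_le_of_away {N M R : ℝ → ℂ} (hN : Continuous N) (hR : Continuous R) {z t B δ : ℝ}
    (ht : 0 < t) (hδ : 0 < δ)
    (hM : ∀ y, HasDerivAt M (R y + Complex.I * t * (z - y : ℝ) * N y) y) {p r : ℝ} (hpr : p ≤ r)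
    (hMB : ∀ y ∈ Set.Icc p r, ‖M y‖ ≤ B) (hRB : ∀ y ∈ Set.Icc p r, ‖R y‖ ≤ B)
    (hz : r + δ ≤ z ∨ z ≤ p - δ) :
    ‖∫ y in p..r, N y‖ ≤ B / (t * δ) * (3 + (r - p)) := by
  have hp : p ∈ Set.Icc p r := ⟨le_rfl, hpr⟩
  have hr : r ∈ Set.Icc p r := ⟨hpr, le_rfl⟩
  have hB : 0 ≤ B := (norm_nonneg _).trans (hMB p hp)
  have hMc : Continuous M := continuous_iff_continuousAt.2 fun x => (hM x).continuousAt
  have hab : ∀ y ∈ Set.uIcc p r, δ ≤ |z - y| := by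
    intro y hy
    rw [Set.uIcc_of_le hpr] at hy
    rcases hz with hz | hz
    · exact le_trans (by linarith [hy.2]) (le_abs_self _)
    · exact le_trans (by linarith [hy.1]) (neg_le_abs _)
  have hne : ∀ y ∈ Set.uIcc p r, z - y ≠ 0 := fun y hy h => by
    have := hab y hy; rw [h, abs_zero] at this; linarith
  have hneC : ∀ y ∈ Set.uIcc p r, ((z - y : ℝ) : ℂ) ≠ 0 := fun y hy => by
    exact_mod_cast hne y hy
  have hsubd : ∀ y, HasDerivAt (fun y => z - y) (-1) y := fun y => by
    simpa using (hasDerivAt_id y).const_sub z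
  have hinv : ∀ y ∈ Set.uIcc p r, HasDerivAt (fun y => (z - y)⁻¹) (1 / (z - y) ^ 2) y :=
    fun y hy => ((hsubd y).inv (hne y hy)).congr_deriv (by ring)
  have hcinv : ContinuousOn (fun y : ℝ => (((z - y)⁻¹ : ℝ) : ℂ)) (Set.uIcc p r) :=
    Complex.continuous_ofReal.comp_continuousOn
      ((continuousOn_const.sub continuousOn_id).inv₀ hne)
  have hcinv2 : ContinuousOn (fun y : ℝ => 1 / (z - y) ^ 2) (Set.uIcc p r) :=
    (continuousOn_const).div ((continuousOn_const.sub continuousOn_id).pow 2)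
      fun y hy => pow_ne_zero _ (hne y hy)
  have hcinv2C : ContinuousOn (fun y : ℝ => ((1 / (z - y) ^ 2 : ℝ) : ℂ)) (Set.uIcc p r) :=
    Complex.continuous_ofReal.comp_continuousOn hcinv2
  have hd : ∀ y ∈ Set.uIcc p r, HasDerivAt (fun y => (((z - y)⁻¹ : ℝ) : ℂ) * M y)
      (Complex.I * t * N y + ((((z - y)⁻¹ : ℝ) : ℂ) * R y + ((1 / (z - y) ^ 2 : ℝ) : ℂ) * M y)) y := by
    intro y hy
    refine HasDerivAt.congr_deriv ((hinv y hy).ofReal_comp.mul (hM y)) ?_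
    have h : (((z - y)⁻¹ : ℝ) : ℂ) * ((z - y : ℝ) : ℂ) = 1 := by
      have := hneC y hy
      rw [Complex.ofReal_inv]; field_simp
    linear_combination Complex.I * t * N y * h
  have i1 : IntervalIntegrable (fun y => Complex.I * t * N y) volume p r :=
    (by fun_prop : Continuous fun y => Complex.I * t * N y).intervalIntegrable _ _
  have i2 : IntervalIntegrable (fun y => (((z - y)⁻¹ : ℝ) : ℂ) * R y) volume p r :=
    (hcinv.mul hR.continuousOn).intervalIntegrable
  have i3 : IntervalIntegrable (fun y => ((1 / (z - y) ^ 2 : ℝ) : ℂ) * M y) volume p r :=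
    (hcinv2C.mul hMc.continuousOn).intervalIntegrable
  have hft := intervalIntegral.integral_eq_sub_of_hasDerivAt hd (i1.add (i2.add i3))
  rw [intervalIntegral.integral_add i1 (i2.add i3), intervalIntegral.integral_add i2 i3,
    intervalIntegral.integral_const_mul] at hft
  have hib : ∀ y ∈ Set.uIcc p r, ‖(((z - y)⁻¹ : ℝ) : ℂ)‖ ≤ δ⁻¹ := fun y hy => by
    rw [Complex.norm_real, norm_inv, Real.norm_eq_abs]; exact inv_anti₀ hδ (hab y hy)
  have n1 : ∀ y ∈ Set.Icc p r, ‖(((z - y)⁻¹ : ℝ) : ℂ) * M y‖ ≤ δ⁻¹ * B := fun y hy => by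
    rw [norm_mul]
    exact mul_le_mul (hib y (Set.uIcc_of_le hpr ▸ hy)) (hMB y hy) (norm_nonneg _) (by positivity)
  have n2 : ‖∫ y in p..r, (((z - y)⁻¹ : ℝ) : ℂ) * R y‖ ≤ δ⁻¹ * B * |r - p| := by
    refine intervalIntegral.norm_integral_le_of_norm_le_const fun y hy => ?_
    have hy' := Set.uIoc_subset_uIcc hy
    rw [norm_mul]
    exact mul_le_mul (hib y hy') (hRB y (Set.uIcc_of_le hpr ▸ hy')) (norm_nonneg _) (by positivity)
  have n3 : ‖∫ y in p..r, ((1 / (z - y) ^ 2 : ℝ) : ℂ) * M y‖ ≤ δ⁻¹ * B := by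
    have e1 : ‖∫ y in p..r, ((1 / (z - y) ^ 2 : ℝ) : ℂ) * M y‖ ≤ ∫ y in p..r, 1 / (z - y) ^ 2 * B := by
      refine intervalIntegral.norm_integral_le_of_norm_le hpr (.of_forall fun y hy => ?_)
        (hcinv2.intervalIntegrable.mul_const B)
      rw [norm_mul, Complex.norm_real, Real.norm_of_nonneg (by positivity)]
      exact mul_le_mul_of_nonneg_left (hMB y ⟨hy.1.le, hy.2⟩) (by positivity)
    refine e1.trans ?_
    rw [intervalIntegral.integral_mul_const,
      intervalIntegral.integral_eq_sub_of_hasDerivAt hinv hcinv2.intervalIntegrable]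
    refine mul_le_mul_of_nonneg_right ?_ hB
    rcases hz with hz | hz
    · have h1 : (z - r)⁻¹ ≤ δ⁻¹ := inv_anti₀ hδ (by linarith)
      have h2 : 0 ≤ (z - p)⁻¹ := inv_nonneg.2 (by linarith)
      linarith
    · have h1 : (p - z)⁻¹ ≤ δ⁻¹ := inv_anti₀ hδ (by linarith)
      have h2 : 0 ≤ (r - z)⁻¹ := inv_nonneg.2 (by linarith)
      rw [← neg_sub z p, inv_neg] at h1
      rw [← neg_sub z r, inv_neg] at h2
      linarith
  have hfin : Complex.I * t * ∫ y in p..r, N y = (((z - r)⁻¹ : ℝ) : ℂ) * M r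
      - (((z - p)⁻¹ : ℝ) : ℂ) * M p - ((∫ y in p..r, (((z - y)⁻¹ : ℝ) : ℂ) * R y)
        + ∫ y in p..r, ((1 / (z - y) ^ 2 : ℝ) : ℂ) * M y) := by
    rw [← hft]; ring
  have hnorm : t * ‖∫ y in p..r, N y‖ ≤ δ⁻¹ * B + δ⁻¹ * B + (δ⁻¹ * B * |r - p| + δ⁻¹ * B) := by
    have : t * ‖∫ y in p..r, N y‖ = ‖Complex.I * t * ∫ y in p..r, N y‖ := by
      rw [norm_mul, norm_mul, Complex.norm_I, Complex.norm_real, Real.norm_of_nonneg ht.le, one_mul]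
    rw [this, hfin]
    refine (norm_sub_le _ _).trans (add_le_add ((norm_sub_le _ _).trans
      (add_le_add (n1 r hr) (n1 p hp))) ((norm_add_le _ _).trans (add_le_add n2 n3)))
  rw [abs_of_nonneg (by linarith)] at hnorm
  rw [← mul_le_mul_iff_right₀ ht]
  refine hnorm.trans (le_of_eq ?_)
  field_simp; ring

/-- Integrals of functions satisfying a first-order relation with a nondegenerate stationary
point are of size `t^{-1/2}`. -/
lemma norm_integral_le_stationary {N M R : ℝ → ℂ} (hN : Continuous N) (hR : Continuous R)
    {z t B : ℝ} (ht : 0 < t)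
    (hM : ∀ y, HasDerivAt M (R y + Complex.I * t * (z - y : ℝ) * N y) y) {a b : ℝ} (hab : a ≤ b)
    (hNB : ∀ y ∈ Set.Icc a b, ‖N y‖ ≤ B)
    (hMB : ∀ y ∈ Set.Icc a b, ‖M y‖ ≤ B) (hRB : ∀ y ∈ Set.Icc a b, ‖R y‖ ≤ B) :
    ‖∫ y in a..b, N y‖ ≤ B * (8 + 2 * (b - a)) * t ^ (-(1 / 2 : ℝ)) := by
  set δ := t ^ (-(1 / 2 : ℝ)) with hδ
  have hδ0 : 0 < δ := rpow_pos_of_pos ht _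
  have hB : 0 ≤ B := (norm_nonneg _).trans (hNB a ⟨le_rfl, hab⟩)
  have htδ : t * δ = δ⁻¹ := by
    rw [hδ, ← rpow_neg ht.le]
    nth_rewrite 1 [← rpow_one t]
    rw [← rpow_add ht]; norm_num
  have hBd : B / (t * δ) = B * δ := by rw [htδ]; field_simp
  set p := max a (min b (z - δ)) with hp
  set r := max a (min b (z + δ)) with hr
  have hap : a ≤ p := le_max_left _ _
  have hpr : p ≤ r := max_le_max le_rfl (min_le_min le_rfl (by linarith))
  have hrb : r ≤ b := max_le hab (min_le_left _ _)
  have hInt : ∀ u v, IntervalIntegrable N volume u v := fun u v => hN.intervalIntegrable _ _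
  have k1 : ‖∫ y in a..p, N y‖ ≤ B * δ * (3 + (b - a)) := by
    rcases eq_or_lt_of_le hap with he | hl
    · rw [← he]; simp only [intervalIntegral.integral_same, norm_zero]
      have : 0 ≤ b - a := by linarith
      positivity
    · have hpz : p ≤ z - δ := by
        rcases max_choice a (min b (z - δ)) with h | h
        · exact absurd (hp.trans h) hl.ne'
        · exact (hp.trans h).le.trans (min_le_right _ _)
      have := norm_integral_le_of_away hN hR ht hδ0 hM hap
        (fun y hy => hMB y ⟨hy.1, by linarith [hy.2]⟩)
        (fun y hy => hRB y ⟨hy.1, by linarith [hy.2]⟩) (Or.inl (by linarith))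
      rw [hBd] at this
      refine this.trans (mul_le_mul_of_nonneg_left (by linarith) (by positivity))
  have k3 : ‖∫ y in r..b, N y‖ ≤ B * δ * (3 + (b - a)) := by
    rcases eq_or_lt_of_le hrb with he | hl
    · rw [he]; simp only [intervalIntegral.integral_same, norm_zero]
      have : 0 ≤ b - a := by linarith
      positivity
    · have hrz : z + δ ≤ r := by
        by_contra hcon
        push Not at hcon
        have h1 : min b (z + δ) < z + δ := lt_of_le_of_lt (le_max_right _ _) hcon
        have h2 : min b (z + δ) = b := by
          rcases min_choice b (z + δ) with h | h
          · exact h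
          · exact absurd h h1.ne
        have : b ≤ r := h2 ▸ le_max_right a (min b (z + δ))
        linarith
      have := norm_integral_le_of_away hN hR ht hδ0 hM hrb
        (fun y hy => hMB y ⟨by linarith [hy.1], hy.2⟩)
        (fun y hy => hRB y ⟨by linarith [hy.1], hy.2⟩) (Or.inr (by linarith))
      rw [hBd] at this
      refine this.trans (mul_le_mul_of_nonneg_left (by linarith) (by positivity))
  have k2 : ‖∫ y in p..r, N y‖ ≤ B * (2 * δ) := by
    have hlen : r - p ≤ 2 * δ := by
      have h1 : min b (z + δ) ≤ min b (z - δ) + 2 * δ := by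
        rcases min_choice b (z - δ) with h | h <;> rw [h]
        · linarith [min_le_left b (z + δ)]
        · linarith [min_le_right b (z + δ)]
      have : r ≤ p + 2 * δ := max_le (by linarith) (h1.trans (by linarith [le_max_right a (min b (z - δ))]))
      linarith
    refine (intervalIntegral.norm_integral_le_of_norm_le_const (C := B) fun y hy => ?_).trans ?_
    · rw [Set.uIoc_of_le hpr] at hy
      exact hNB y ⟨by linarith [hy.1], by linarith [hy.2]⟩
    · rw [abs_of_nonneg (by linarith)]; exact mul_le_mul_of_nonneg_left hlen hB
  rw [← intervalIntegral.integral_add_adjacent_intervals (hInt a p) (hInt p b),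
    ← intervalIntegral.integral_add_adjacent_intervals (hInt p r) (hInt r b)]
  refine (norm_add_le _ _).trans ?_
  have := norm_add_le (∫ x in p..r, N x) (∫ x in r..b, N x)
  nlinarith

end

section

/-- First partial derivative of a function on the plane. -/
def pd1 (f : ℝ × ℝ → ℝ) (p : ℝ × ℝ) : ℝ := fderiv ℝ f p (1, 0)

/-- Second partial derivative of a function on the plane. -/
def pd2 (f : ℝ × ℝ → ℝ) (p : ℝ × ℝ) : ℝ := fderiv ℝ f p (0, 1)

open scoped ContDiff

lemma contDiff_pd1 {f : ℝ × ℝ → ℝ} (hf : ContDiff ℝ ∞ f) : ContDiff ℝ ∞ (pd1 f) :=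
  (hf.fderiv_right (m := ∞) (by simp)).clm_apply contDiff_const

lemma contDiff_pd2 {f : ℝ × ℝ → ℝ} (hf : ContDiff ℝ ∞ f) : ContDiff ℝ ∞ (pd2 f) :=
  (hf.fderiv_right (m := ∞) (by simp)).clm_apply contDiff_const

lemma contDiff_iterate_pd1 {f : ℝ × ℝ → ℝ} (hf : ContDiff ℝ ∞ f) (j : ℕ) :
    ContDiff ℝ ∞ (pd1^[j] f) := by
  induction j with
  | zero => exact hf
  | succ j ih => rw [Function.iterate_succ_apply']; exact contDiff_pd1 ih

lemma hasDerivAt_pd1_of_differentiableAt {f : ℝ × ℝ → ℝ} {x y : ℝ}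
    (hf : DifferentiableAt ℝ f (x, y)) : HasDerivAt (fun x => f (x, y)) (pd1 f (x, y)) x := by
  have h2 : HasDerivAt (fun x : ℝ => (x, y)) (1, 0) x :=
    (hasDerivAt_id x).prodMk (hasDerivAt_const x y)
  exact hf.hasFDerivAt.comp_hasDerivAt x h2

lemma hasDerivAt_pd2_of_differentiableAt {f : ℝ × ℝ → ℝ} {x y : ℝ}
    (hf : DifferentiableAt ℝ f (x, y)) : HasDerivAt (fun y => f (x, y)) (pd2 f (x, y)) y := by
  have h2 : HasDerivAt (fun y : ℝ => (x, y)) (0, 1) y :=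
    (hasDerivAt_const y x).prodMk (hasDerivAt_id y)
  exact hf.hasFDerivAt.comp_hasDerivAt y h2

lemma hasDerivAt_pd1 {f : ℝ × ℝ → ℝ} (hf : ContDiff ℝ ∞ f) (x y : ℝ) :
    HasDerivAt (fun x => f (x, y)) (pd1 f (x, y)) x :=
  hasDerivAt_pd1_of_differentiableAt (hf.differentiable (by simp) _)

lemma hasDerivAt_pd2 {f : ℝ × ℝ → ℝ} (hf : ContDiff ℝ ∞ f) (x y : ℝ) :
    HasDerivAt (fun y => f (x, y)) (pd2 f (x, y)) y :=
  hasDerivAt_pd2_of_differentiableAt (hf.differentiable (by simp) _)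

/-- The closed square of half-side `ε` around `P`. -/
def box (P : ℝ × ℝ) (ε : ℝ) : Set (ℝ × ℝ) :=
  Set.Icc (P.1 - ε) (P.1 + ε) ×ˢ Set.Icc (P.2 - ε) (P.2 + ε)

lemma isCompact_box (P : ℝ × ℝ) (ε : ℝ) : IsCompact (box P ε) := isCompact_Icc.prod isCompact_Icc

lemma box_subset {P : ℝ × ℝ} {ε ε' : ℝ} (h : ε ≤ ε') : box P ε ⊆ box P ε' :=
  Set.prod_mono (Set.Icc_subset_Icc (by linarith) (by linarith))
    (Set.Icc_subset_Icc (by linarith) (by linarith))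

lemma box_eq_closedBall (P : ℝ × ℝ) (ε : ℝ) : box P ε = Metric.closedBall P ε := by
  rw [← closedBall_prod_same, Real.closedBall_eq_Icc, Real.closedBall_eq_Icc]; rfl

lemma exists_box_subset {P : ℝ × ℝ} {s : Set (ℝ × ℝ)} (h : s ∈ nhds P) :
    ∃ ε, 0 < ε ∧ box P ε ⊆ s := by
  obtain ⟨ε, hε, h⟩ := Metric.nhds_basis_closedBall.mem_iff.1 h
  exact ⟨ε, hε, box_eq_closedBall P ε ▸ h⟩

lemma exists_bound_box {f : ℝ × ℝ → ℝ} (hf : Continuous f) (P : ℝ × ℝ) (ε : ℝ) :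
    ∃ M, 0 < M ∧ ∀ p ∈ box P ε, |f p| ≤ M := by
  obtain ⟨M, hM⟩ := (isCompact_box P ε).exists_bound_of_continuousOn hf.continuousOn
  exact ⟨max M 1, by positivity, fun p hp => (hM p hp).trans (le_max_left _ _)⟩

lemma slice_bound {T : ℝ × ℝ → ℝ} (hT : ContDiff ℝ ∞ T) (P : ℝ × ℝ) {k : ℕ} (hk2 : k ≤ 2)
    (hk : pd1^[k + 2] T P ≠ 0) :
    ∃ ε0, 0 < ε0 ∧ ∀ ε, 0 < ε → ε ≤ ε0 → ∀ b : ℝ × ℝ → ℝ, ContDiff ℝ ∞ b →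
      ∃ C, 0 < C ∧ ∀ cn cm t y : ℝ, 1 ≤ t → |cm - P.2| ≤ 2 * ε →
        y ∈ Set.Icc (P.2 - ε) (P.2 + ε) →
        ‖∫ n in (P.1 - ε)..(P.1 + ε), (b (n, y) : ℂ) *
          cis (t * (cn * n + T (n, y) + (cm - y) * pd2 T (n, y)))‖ ≤ C * t ^ (-(1 / 4 : ℝ)) := by
  set D := pd1^[k + 2] T with hD
  have hDc : Continuous D := (contDiff_iterate_pd1 hT _).continuous
  have hSc : Continuous (pd1^[k + 2] (pd2 T)) := (contDiff_iterate_pd1 (contDiff_pd2 hT) _).continuous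
  obtain ⟨M, hM0, hM⟩ := exists_bound_box hSc P 1
  set lam := |D P| with hlam
  have hl0 : 0 < lam := abs_pos.2 hk
  have hnh : {p | |D p - D P| < lam / 2} ∈ nhds P := by
    have : Continuous fun p => |D p - D P| := by fun_prop
    exact (this.tendsto P).eventually_lt_const (by simpa using hl0)
  obtain ⟨ε1, hε1, hsub⟩ := exists_box_subset hnh
  refine ⟨min (min 1 ε1) (lam / (12 * M)), by positivity, fun ε hε hε0 b hb => ?_⟩
  have hεle1 : ε ≤ 1 := hε0.trans ((min_le_left _ _).trans (min_le_left _ _))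
  have hεle2 : ε ≤ ε1 := hε0.trans ((min_le_left _ _).trans (min_le_right _ _))
  have hεle3 : 3 * ε * M ≤ lam / 4 := by
    have := hε0.trans (min_le_right _ _)
    rw [le_div_iff₀ (by positivity)] at this
    linarith
  obtain ⟨B1, hB10, hB1⟩ := exists_bound_box hb.continuous P ε
  obtain ⟨B2, hB20, hB2⟩ := exists_bound_box (contDiff_pd1 hb).continuous P ε
  obtain ⟨Cv, hCv, hv⟩ := vdc_higher k
  set κ := -(1 / ((k : ℝ) + 2)) with hκ
  refine ⟨(B1 + B2) * (1 + 2 * ε) * (Cv * (lam / 4) ^ κ), by positivity,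
    fun cn cm t y ht hcm hy => ?_⟩
  have ht0 : 0 < t := by linarith
  set f : ℕ → ℝ → ℝ := fun j n =>
    t * ((if j = 0 then cn * n else if j = 1 then cn else 0) + (pd1^[j] T) (n, y)
      + (cm - y) * (pd1^[j] (pd2 T)) (n, y)) with hf
  have hfd : ∀ j x, HasDerivAt (f j) (f (j + 1) x) x := by
    intro j x
    have h1 : HasDerivAt (fun n => (pd1^[j] T) (n, y)) ((pd1^[j + 1] T) (x, y)) x := by
      rw [Function.iterate_succ_apply']; exact hasDerivAt_pd1 (contDiff_iterate_pd1 hT j) x y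
    have h2 : HasDerivAt (fun n => (pd1^[j] (pd2 T)) (n, y)) ((pd1^[j + 1] (pd2 T)) (x, y)) x := by
      rw [Function.iterate_succ_apply']
      exact hasDerivAt_pd1 (contDiff_iterate_pd1 (contDiff_pd2 hT) j) x y
    have h3 : HasDerivAt (fun n : ℝ => if j = 0 then cn * n else if j = 1 then cn else 0)
        (if j + 1 = 0 then cn * x else if j + 1 = 1 then cn else 0) x := by
      rcases j with _ | _ | j
      · simpa using (hasDerivAt_id x).const_mul cn
      · simpa using hasDerivAt_const x cn
      · simpa using hasDerivAt_const x (0 : ℝ)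
    exact ((h3.add h1).add (h2.const_mul (cm - y))).const_mul t
  have hcy : |cm - y| ≤ 3 * ε := by
    have : |P.2 - y| ≤ ε := abs_le.2 ⟨by linarith [hy.2], by linarith [hy.1]⟩
    calc |cm - y| = |(cm - P.2) + (P.2 - y)| := by ring_nf
      _ ≤ _ := abs_add_le _ _
      _ ≤ 3 * ε := by linarith
  have hlow : ∀ x ∈ Set.Icc (P.1 - ε) (P.1 + ε),
      |(f (k + 2) x) / t - D P| ≤ lam / 2 + lam / 4 := by
    intro x hx
    have hin : (x, y) ∈ box P ε := ⟨hx, hy⟩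
    have h1 : |D (x, y) - D P| < lam / 2 := hsub (box_subset hεle2 hin)
    have h2 := hM (x, y) (box_subset hεle1 hin)
    have e : f (k + 2) x / t - D P = (D (x, y) - D P) + (cm - y) * (pd1^[k + 2] (pd2 T)) (x, y) := by
      simp only [hf]
      rw [mul_div_cancel_left₀ _ ht0.ne', if_neg (by omega), if_neg (by omega)]
      ring
    rw [e]
    refine (abs_add_le _ _).trans (add_le_add h1.le ?_)
    rw [abs_mul]
    exact (mul_le_mul hcy h2 (abs_nonneg _) (by positivity)).trans hεle3
  have hsign : (∀ x ∈ Set.Icc (P.1 - ε) (P.1 + ε), t * (lam / 4) ≤ f (k + 2) x) ∨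
      (∀ x ∈ Set.Icc (P.1 - ε) (P.1 + ε), f (k + 2) x ≤ -(t * (lam / 4))) := by
    rcases lt_or_gt_of_ne hk with h | h
    · right; intro x hx
      have h1 := (abs_le.1 (hlow x hx)).2
      have h2 : lam = -D P := abs_of_neg h
      have h3 : f (k + 2) x / t ≤ -(lam / 4) := by linarith
      rw [div_le_iff₀ ht0] at h3; linarith
    · left; intro x hx
      have h1 := (abs_le.1 (hlow x hx)).1
      have h2 : lam = D P := abs_of_pos h
      have h3 : lam / 4 ≤ f (k + 2) x / t := by linarith
      rw [le_div_iff₀ ht0] at h3; linarith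
  have hf0 : ∀ n, t * (cn * n + T (n, y) + (cm - y) * pd2 T (n, y)) = f 0 n := fun n => by
    simp [hf]
  simp_rw [hf0]
  have hF : Continuous fun n => cis (f 0 n) := by
    have : Continuous (f 0) := continuous_iff_continuousAt.2 fun x => (hfd 0 x).continuousAt
    fun_prop
  have hbd : Continuous fun n => pd1 b (n, y) := by
    have := (contDiff_pd1 hb).continuous; fun_prop
  have hmain := norm_integral_amplitude_le hF (fun x => hasDerivAt_pd1 hb x y) hbd
    (a := P.1 - ε) (b := P.1 + ε) (K := Cv * (t * (lam / 4)) ^ κ) (B := B1 + B2) (by linarith)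
    (fun x hx => hv f hfd _ _ _ hx.1 (by positivity)
      (hsign.imp (fun h z hz => h z ⟨hz.1, hz.2.trans hx.2⟩) fun h z hz => h z ⟨hz.1, hz.2.trans hx.2⟩))
    (fun x hx => (hB1 (x, y) ⟨hx, hy⟩).trans (by linarith))
    (fun x hx => (hB2 (x, y) ⟨hx, hy⟩).trans (by linarith))
  refine hmain.trans ?_
  have hkpow : t ^ κ ≤ t ^ (-(1 / 4 : ℝ)) := by
    apply rpow_le_rpow_of_exponent_le ht
    rw [hκ]
    have : (k : ℝ) ≤ 2 := by exact_mod_cast hk2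
    have : (1 : ℝ) / 4 ≤ 1 / ((k : ℝ) + 2) :=
      one_div_le_one_div_of_le (by positivity) (by linarith)
    linarith
  rw [mul_rpow ht0.le (by positivity)]
  have e : P.1 + ε - (P.1 - ε) = 2 * ε := by ring
  rw [e]
  have : (B1 + B2) * (1 + 2 * ε) * (Cv * (t ^ κ * (lam / 4) ^ κ))
    = (B1 + B2) * (1 + 2 * ε) * (Cv * (lam / 4) ^ κ) * t ^ κ := by ring
  rw [this]
  exact mul_le_mul_of_nonneg_left hkpow (by positivity)

/-- Oscillatory integrals whose phase is in normal form `c_n n + T + (c_m - γ) T_γ`. -/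
lemma norm_integral_normalForm_le {T : ℝ × ℝ → ℝ} (hT : ContDiff ℝ ∞ T) (P : ℝ × ℝ) {k : ℕ}
    (hk2 : k ≤ 2) (hk : pd1^[k + 2] T P ≠ 0) :
    ∃ ε0, 0 < ε0 ∧ ∀ ε, 0 < ε → ε ≤ ε0 → ∀ b : ℝ × ℝ → ℝ, ContDiff ℝ ∞ b →
      ∃ C, 0 < C ∧ ∀ cn cm t : ℝ, 1 ≤ t →
        ‖∫ y in (P.2 - ε)..(P.2 + ε), ∫ n in (P.1 - ε)..(P.1 + ε),
          ((b (n, y) * pd2 (pd2 T) (n, y) : ℝ) : ℂ) *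
          cis (t * (cn * n + T (n, y) + (cm - y) * pd2 T (n, y)))‖ ≤ C * t ^ (-(3 / 4 : ℝ)) := by
  obtain ⟨ε0, hε0, H⟩ := slice_bound hT P hk2 hk
  refine ⟨ε0, hε0, fun ε hε hεε0 b hb => ?_⟩
  have hT2 := contDiff_pd2 hT
  have hT22 := contDiff_pd2 hT2
  have hbT : ContDiff ℝ ∞ (fun p => b p * pd2 (pd2 T) p) := hb.mul hT22
  have hb2 := contDiff_pd2 hb
  obtain ⟨C1, hC1, H1⟩ := H ε hε hεε0 _ hbT
  obtain ⟨C2, hC2, H2⟩ := H ε hε hεε0 _ hb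
  obtain ⟨C3, hC3, H3⟩ := H ε hε hεε0 _ hb2
  obtain ⟨B2, hB20, hB2⟩ := exists_bound_box hb.continuous P ε
  obtain ⟨B3, hB30, hB3⟩ := exists_bound_box hb2.continuous P ε
  refine ⟨(C1 + C2 + C3) * (8 + 2 * (2 * ε)) + (B2 + B3) * (2 * ε) / ε * (3 + 2 * ε),
    by positivity, fun cn cm t ht => ?_⟩
  have ht0 : 0 < t := by linarith
  have hle1 : P.2 - ε ≤ P.2 + ε := by linarith
  set ph : ℝ × ℝ → ℝ := fun p => t * (cn * p.1 + T p + (cm - p.2) * pd2 T p) with hph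
  have hphc : Continuous ph := by
    have := hT.continuous; have := hT2.continuous; fun_prop
  have hphd : ∀ x y, HasDerivAt (fun y => ph (x, y)) (t * ((cm - y) * pd2 (pd2 T) (x, y))) y := by
    intro x y
    have h1 := hasDerivAt_pd2 hT x y
    have h2 := ((hasDerivAt_id y).const_sub cm).mul (hasDerivAt_pd2 hT2 x y)
    refine HasDerivAt.congr_deriv (((h1.const_add (cn * x)).add h2).const_mul t) ?_
    simp
  have hpara : ∀ β : ℝ × ℝ → ℝ, Continuous β →
      Continuous fun y => ∫ n in (P.1 - ε)..(P.1 + ε), (β (n, y) : ℂ) * cis (ph (n, y)) := by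
    intro β hβ
    exact intervalIntegral.continuous_parametric_intervalIntegral_of_continuous'
      (by simp only [Function.uncurry_def]; fun_prop) _ _
  have hM : ∀ y, HasDerivAt (fun y => ∫ n in (P.1 - ε)..(P.1 + ε), (b (n, y) : ℂ) * cis (ph (n, y)))
      ((∫ n in (P.1 - ε)..(P.1 + ε), (pd2 b (n, y) : ℂ) * cis (ph (n, y)))
        + Complex.I * t * (cm - y : ℝ) *
        ∫ n in (P.1 - ε)..(P.1 + ε), ((b (n, y) * pd2 (pd2 T) (n, y) : ℝ) : ℂ) * cis (ph (n, y))) y := by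
    intro y
    have h := hasDerivAt_intervalIntegral_param
      (F := fun y n => (b (n, y) : ℂ) * cis (ph (n, y)))
      (F' := fun y n => (pd2 b (n, y) : ℂ) * cis (ph (n, y)) + Complex.I * t * (cm - y : ℝ) *
        (((b (n, y) * pd2 (pd2 T) (n, y) : ℝ) : ℂ) * cis (ph (n, y))))
      (by have := hb.continuous; simp only [Function.uncurry_def]; fun_prop)
      (by
        have := hb.continuous; have := hb2.continuous; have := hT22.continuous
        simp only [Function.uncurry_def]; fun_prop)
      (fun y n => by
        refine HasDerivAt.congr_deriv
          ((hasDerivAt_pd2 hb n y).ofReal_comp.mul (hasDerivAt_cis (hphd n y))) ?_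
        push_cast; ring) (P.1 - ε) (P.1 + ε) y
    refine h.congr_deriv ?_
    rw [intervalIntegral.integral_add, intervalIntegral.integral_const_mul]
    · apply Continuous.intervalIntegrable
      have := hb2.continuous; fun_prop
    · apply Continuous.intervalIntegrable
      have := hb.continuous; have := hT22.continuous; fun_prop
  have hmain : ‖∫ y in (P.2 - ε)..(P.2 + ε), ∫ n in (P.1 - ε)..(P.1 + ε),
          ((b (n, y) * pd2 (pd2 T) (n, y) : ℝ) : ℂ) * cis (ph (n, y))‖ ≤
      ((C1 + C2 + C3) * (8 + 2 * (2 * ε)) + (B2 + B3) * (2 * ε) / ε * (3 + 2 * ε))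
        * t ^ (-(3 / 4 : ℝ)) := by
    by_cases hcm : |cm - P.2| ≤ 2 * ε
    · have key := norm_integral_le_stationary (B := (C1 + C2 + C3) * t ^ (-(1 / 4 : ℝ)))
        (hpara _ hbT.continuous) (hpara _ hb2.continuous) ht0 hM hle1
        (fun y hy => (H1 cn cm t y ht hcm hy).trans
          (mul_le_mul_of_nonneg_right (by linarith) (by positivity)))
        (fun y hy => (H2 cn cm t y ht hcm hy).trans
          (mul_le_mul_of_nonneg_right (by linarith) (by positivity)))
        (fun y hy => (H3 cn cm t y ht hcm hy).trans
          (mul_le_mul_of_nonneg_right (by linarith) (by positivity)))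
      refine key.trans ?_
      have e1 : t ^ (-(1 / 4 : ℝ)) * t ^ (-(1 / 2 : ℝ)) = t ^ (-(3 / 4 : ℝ)) := by
        rw [← rpow_add ht0]; norm_num
      have e2 : P.2 + ε - (P.2 - ε) = 2 * ε := by ring
      rw [e2]
      have e3 : (C1 + C2 + C3) * t ^ (-(1 / 4 : ℝ)) * (8 + 2 * (2 * ε)) * t ^ (-(1 / 2 : ℝ))
        = (C1 + C2 + C3) * (8 + 2 * (2 * ε)) * t ^ (-(3 / 4 : ℝ)) := by rw [← e1]; ring
      rw [e3, add_mul]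
      have : 0 ≤ (B2 + B3) * (2 * ε) / ε * (3 + 2 * ε) * t ^ (-(3 / 4 : ℝ)) := by positivity
      linarith
    · push Not at hcm
      have hz : P.2 + ε + ε ≤ cm ∨ cm ≤ P.2 - ε - ε := by
        rcases lt_abs.1 hcm with h | h
        · left; linarith
        · right; linarith
      have triv : ∀ β : ℝ × ℝ → ℝ, ∀ B, (∀ p ∈ box P ε, |β p| ≤ B) →
          ∀ y ∈ Set.Icc (P.2 - ε) (P.2 + ε),
          ‖∫ n in (P.1 - ε)..(P.1 + ε), (β (n, y) : ℂ) * cis (ph (n, y))‖ ≤ B * (2 * ε) := by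
        intro β B hB y hy
        refine (intervalIntegral.norm_integral_le_of_norm_le_const (C := B) fun n hn => ?_).trans ?_
        · rw [Set.uIoc_of_le (by linarith)] at hn
          rw [norm_mul, norm_cis, mul_one, Complex.norm_real]
          exact hB _ ⟨⟨hn.1.le, hn.2⟩, hy⟩
        · rw [show P.1 + ε - (P.1 - ε) = 2 * ε by ring, abs_of_nonneg (by positivity)]
      have key := norm_integral_le_of_away (B := (B2 + B3) * (2 * ε)) (δ := ε)
        (hpara _ hbT.continuous) (hpara _ hb2.continuous) ht0 hε hM hle1
        (triv b (B2 + B3) fun p hp => (hB2 p hp).trans (by linarith))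
        (triv (pd2 b) (B2 + B3) fun p hp => (hB3 p hp).trans (by linarith)) hz
      refine key.trans ?_
      have e2 : P.2 + ε - (P.2 - ε) = 2 * ε := by ring
      rw [e2]
      have e4 : t⁻¹ ≤ t ^ (-(3 / 4 : ℝ)) := by
        rw [← rpow_neg_one]; exact rpow_le_rpow_of_exponent_le ht (by norm_num)
      have e5 : (B2 + B3) * (2 * ε) / (t * ε) * (3 + 2 * ε)
        = (B2 + B3) * (2 * ε) / ε * (3 + 2 * ε) * t⁻¹ := by field_simp
      rw [e5]
      refine (mul_le_mul_of_nonneg_left e4 (by positivity)).trans ?_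
      refine mul_le_mul_of_nonneg_right ?_ (by positivity)
      have : 0 ≤ (C1 + C2 + C3) * (8 + 2 * (2 * ε)) := by positivity
      linarith
  exact hmain

end

section

open Filter Topology
open scoped ContDiff

lemma contDiff_omega_pd2 {f : ℝ × ℝ → ℝ} (hf : ContDiff ℝ ω f) : ContDiff ℝ ω (pd2 f) :=
  (hf.fderiv_right (m := ω) (by simp)).clm_apply contDiff_const

/-- A function smooth near a point agrees near it with a globally smooth function. -/
lemma exists_contDiff_eventuallyEq {f : ℝ × ℝ → ℝ} {Q : ℝ × ℝ} (hf : ContDiffAt ℝ ω f Q) :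
    ∃ g : ℝ × ℝ → ℝ, ContDiff ℝ ∞ g ∧ g =ᶠ[𝓝 Q] f := by
  obtain ⟨ε, hε, hsub⟩ := Metric.nhds_basis_closedBall.mem_iff.1 (hf.eventually (by simp))
  let φ : ContDiffBump Q := ⟨ε / 2, ε, by positivity, by linarith⟩
  refine ⟨fun x => φ x * f x, contDiff_iff_contDiffAt.2 fun x => ?_, ?_⟩
  · by_cases hx : x ∈ Metric.closedBall Q ε
    · have hx2 : ContDiffAt ℝ ω f x := hsub hx
      exact φ.contDiffAt.mul (hx2.of_le le_top)
    · have : (fun x => φ x * f x) =ᶠ[𝓝 x] fun _ => 0 := by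
        filter_upwards [Metric.isClosed_closedBall.isOpen_compl.mem_nhds hx] with y hy
        rw [φ.zero_of_le_dist (le_of_lt (by simpa using hy)), zero_mul]
      exact contDiffAt_const.congr_of_eventuallyEq this
  · filter_upwards [φ.eventuallyEq_one] with x hx
    simp only [hx, Pi.one_apply, one_mul]

/-- Integration of a little-o bound on a derivative. -/
lemma isLittleO_of_deriv {h h' : ℝ → ℝ} (hd : ∀ x, HasDerivAt h (h' x) x) {a : ℝ} {k : ℕ}
    (ho : h' =o[𝓝 a] fun x => (x - a) ^ k) :
    (fun x => h x - h a) =o[𝓝 a] fun x => (x - a) ^ (k + 1) := by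
  rw [Asymptotics.isLittleO_iff] at ho ⊢
  intro c hc
  obtain ⟨ε, hε, hball⟩ := Metric.eventually_nhds_iff_ball.1 (ho hc)
  filter_upwards [Metric.ball_mem_nhds a hε] with x hx
  have hseg : ∀ y ∈ segment ℝ a x, dist y a ≤ dist x a := fun y hy => by
    have := (convex_closedBall a (dist x a)).segment_subset
      (Metric.mem_closedBall_self dist_nonneg) (Metric.mem_closedBall.2 le_rfl) hy
    simpa using this
  have := (convex_segment (𝕜 := ℝ) a x).norm_image_sub_le_of_norm_hasDerivWithin_le
    (f := h) (f' := h') (C := c * |x - a| ^ k) (fun y _ => (hd y).hasDerivWithinAt) (fun y hy => ?_)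
    (left_mem_segment ℝ a x) (right_mem_segment ℝ a x)
  · refine this.trans (le_of_eq ?_)
    rw [Real.norm_eq_abs, Real.norm_eq_abs, abs_pow, pow_succ]; ring
  · have hy' := hseg y hy
    have h1 := hball y (lt_of_le_of_lt hy' hx)
    refine h1.trans (mul_le_mul_of_nonneg_left ?_ hc.le)
    rw [norm_pow]
    exact pow_le_pow_left₀ (norm_nonneg _) hy' _

/-- If the first three derivatives vanish, the increment is `o(δ³)`. -/
lemma isLittleO_cube_of_iterate_pd1 {T : ℝ × ℝ → ℝ} (hT : ContDiff ℝ ∞ T) (Q : ℝ × ℝ)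
    (h : ∀ k ≤ 2, pd1^[k + 2] T Q = 0) :
    (fun n => pd1 T (n, Q.2) - pd1 T Q) =o[𝓝 Q.1] fun n => (n - Q.1) ^ 3 := by
  have hd : ∀ j x, HasDerivAt (fun n => (pd1^[j] T) (n, Q.2)) ((pd1^[j + 1] T) (x, Q.2)) x := by
    intro j x
    rw [Function.iterate_succ_apply']; exact hasDerivAt_pd1 (contDiff_iterate_pd1 hT j) x Q.2
  have h4 : (fun n => (pd1^[4] T) (n, Q.2)) =o[𝓝 Q.1] fun n => (n - Q.1) ^ 0 := by
    have hc : Continuous fun n => (pd1^[4] T) (n, Q.2) := by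
      have := (contDiff_iterate_pd1 hT 4).continuous; fun_prop
    have := hc.tendsto Q.1
    have h0 : (pd1^[4] T) (Q.1, Q.2) = 0 := h 2 le_rfl
    rw [h0] at this
    simpa using (Asymptotics.isLittleO_one_iff ℝ).2 this
  have h3 := isLittleO_of_deriv (hd 3) h4
  have h30 : (pd1^[3] T) (Q.1, Q.2) = 0 := h 1 (by norm_num)
  simp only [h30, sub_zero] at h3
  have h2 := isLittleO_of_deriv (hd 2) h3
  have h20 : (pd1^[2] T) (Q.1, Q.2) = 0 := h 0 (by norm_num)
  simp only [h20, sub_zero] at h2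
  exact isLittleO_of_deriv (hd 1) h2

/-- The critical curve: solve `∂_m w (n, m) = γ` for `m` near a point where `∂_m² w ≠ 0`. -/
lemma exists_partial_inverse {w : ℝ × ℝ → ℝ} (hw : ContDiff ℝ ω w) (P : ℝ × ℝ)
    (hP : pd2 (pd2 w) P ≠ 0) :
    ∃ V : ℝ × ℝ → ℝ, ContDiff ℝ ∞ V ∧ V (P.1, pd2 w P) = P.2 ∧
      ∀ᶠ q in 𝓝 (P.1, pd2 w P), pd2 w (q.1, V q) = q.2 := by
  have hw2 := contDiff_omega_pd2 hw
  set Ψ : ℝ × ℝ → ℝ × ℝ := fun p => (p.1, pd2 w p) with hΨ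
  have hΨs : ContDiff ℝ ω Ψ := contDiff_fst.prodMk hw2
  set L : ℝ × ℝ →L[ℝ] ℝ × ℝ := (ContinuousLinearMap.fst ℝ ℝ ℝ).prod (fderiv ℝ (pd2 w) P) with hL
  have hΨd : HasFDerivAt Ψ L P :=
    hasFDerivAt_fst.prodMk (hw2.differentiable (by simp) P).hasFDerivAt
  have hinj : Function.Injective (L : ℝ × ℝ →ₗ[ℝ] ℝ × ℝ) := by
    rw [← LinearMap.ker_eq_bot, LinearMap.ker_eq_bot']
    rintro ⟨h, k⟩ hk
    have h1 : h = 0 := congrArg Prod.fst hk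
    have h2 : fderiv ℝ (pd2 w) P (h, k) = 0 := congrArg Prod.snd hk
    subst h1
    have e : ((0 : ℝ), k) = k • ((0 : ℝ), (1 : ℝ)) := by simp
    rw [e, map_smul, smul_eq_mul] at h2
    rcases mul_eq_zero.1 h2 with h2 | h2
    · rw [h2]; rfl
    · exact absurd h2 hP
  let Le : (ℝ × ℝ) ≃L[ℝ] (ℝ × ℝ) := (LinearEquiv.ofInjectiveEndo _ hinj).toContinuousLinearEquiv
  have hΨd' : HasFDerivAt Ψ (Le : ℝ × ℝ →L[ℝ] ℝ × ℝ) P := by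
    convert hΨd using 1
    exact ContinuousLinearMap.ext fun _ => rfl
  have hΨa : ContDiffAt ℝ ω Ψ P := hΨs.contDiffAt
  set I := hΨa.localInverse hΨd' (by simp) with hI
  have hIs : ContDiffAt ℝ ω I (Ψ P) := hΨa.to_localInverse hΨd' (by simp)
  have hIP : I (Ψ P) = P := hΨa.localInverse_apply_image hΨd' (by simp)
  have hIr : ∀ᶠ q in 𝓝 (Ψ P), Ψ (I q) = q :=
    (hΨa.hasStrictFDerivAt' hΨd' (by simp)).eventually_right_inverse
  obtain ⟨V, hV, hVe⟩ := exists_contDiff_eventuallyEq (f := fun q => (I q).2)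
    (contDiffAt_snd.comp _ hIs)
  refine ⟨V, hV, ?_, ?_⟩
  · have := hVe.self_of_nhds
    exact this.trans (congrArg Prod.snd hIP)
  · filter_upwards [hVe, hIr] with q hq1 hq2
    have e1 : (Ψ (I q)).1 = q.1 := congrArg Prod.fst hq2
    have e2 : (Ψ (I q)).2 = q.2 := congrArg Prod.snd hq2
    rw [hq1, ← e1]; exact e2

/-- Local dispersive estimate near a point with `∂_m² w ≠ 0`, provided that `∂_n w` is not
constant to third order along the curve `∂_m w = const`. -/
lemma local_dispersive {w : ℝ × ℝ → ℝ} (hw : ContDiff ℝ ω w) (P : ℝ × ℝ)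
    (hP : pd2 (pd2 w) P ≠ 0)
    (hyp : ∀ v : ℝ → ℝ, ContDiff ℝ ∞ v → v P.1 = P.2 →
      (∀ᶠ n in 𝓝 P.1, pd2 w (n, v n) = pd2 w P) →
      ¬ ((fun n => pd1 w (n, v n) - pd1 w P) =o[𝓝 P.1] fun n => (n - P.1) ^ 3)) :
    ∃ ρ, 0 < ρ ∧ ∀ χ : ℝ × ℝ → ℝ, ContDiff ℝ ∞ χ → (∀ p, p ∉ box P ρ → χ p = 0) →
      ∃ C, 0 < C ∧ ∀ cn cm t : ℝ, 1 ≤ t →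
        ‖∫ p : ℝ × ℝ, (χ p : ℂ) * cis (t * (cn * p.1 + cm * p.2 - w p))‖
          ≤ C * t ^ (-(3 / 4 : ℝ)) := by
  obtain ⟨V, hV, hVP, hVe⟩ := exists_partial_inverse hw P hP
  set Q : ℝ × ℝ := (P.1, pd2 w P) with hQ
  have hws : ContDiff ℝ ∞ w := hw.of_le (by simp)
  set T : ℝ × ℝ → ℝ := fun q => q.2 * V q - w (q.1, V q) with hTdef
  have hT : ContDiff ℝ ∞ T :=
    (contDiff_snd.mul hV).sub (hws.comp (contDiff_fst.prodMk hV))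
  -- derivative of `w (x, V)` along curves
  have hwcurve : ∀ {u v : ℝ → ℝ} {u' v' s : ℝ}, HasDerivAt u u' s → HasDerivAt v v' s →
      HasDerivAt (fun s => w (u s, v s)) (u' * pd1 w (u s, v s) + v' * pd2 w (u s, v s)) s := by
    intro u v u' v' s hu hv
    have h1 : HasFDerivAt w (fderiv ℝ w (u s, v s)) (u s, v s) :=
      (hws.differentiable (by simp) _).hasFDerivAt
    refine (h1.comp_hasDerivAt s (hu.prodMk hv)).congr_deriv ?_
    have e : (u', v') = u' • ((1 : ℝ), (0 : ℝ)) + v' • ((0 : ℝ), (1 : ℝ)) := by simp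
    rw [e, map_add, map_smul, map_smul]; rfl
  have hpd2T : ∀ᶠ q in 𝓝 Q, pd2 T q = V q := by
    filter_upwards [hVe] with q hq
    obtain ⟨x, y⟩ := q
    have hv := hasDerivAt_pd2 hV x y
    have h1 := ((hasDerivAt_id y).mul hv).sub (hwcurve (hasDerivAt_const y x) hv)
    have h2 := h1.unique (hasDerivAt_pd2 hT x y)
    simp only at hq
    rw [← h2, hq]; simp only [id]; ring
  have hpd1T : ∀ᶠ q in 𝓝 Q, pd1 T q = -pd1 w (q.1, V q) := by
    filter_upwards [hVe] with q hq
    obtain ⟨x, y⟩ := q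
    have hv := hasDerivAt_pd1 hV x y
    have h1 := (hv.const_mul y).sub (hwcurve (hasDerivAt_id x) hv)
    have h2 := h1.unique (hasDerivAt_pd1 hT x y)
    simp only [id] at hq h2
    rw [← h2, hq]; ring
  have hpd22T : ∀ᶠ q in 𝓝 Q, pd2 (pd2 T) q = pd2 V q := by
    have h : pd2 T =ᶠ[𝓝 Q] V := hpd2T
    filter_upwards [h.fderiv (𝕜 := ℝ)] with q hq
    show fderiv ℝ (pd2 T) q (0, 1) = fderiv ℝ V q (0, 1)
    rw [hq]
  have hVQ : pd2 V Q ≠ 0 := by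
    have hv := hasDerivAt_pd2 hV P.1 (pd2 w P)
    have hw2 : ContDiff ℝ ∞ (pd2 w) := contDiff_pd2 hws
    have h1 : HasDerivAt (fun y => pd2 w (P.1, V (P.1, y)))
        (pd2 (pd2 w) (P.1, V (P.1, pd2 w P)) * pd2 V (P.1, pd2 w P)) (pd2 w P) :=
      HasDerivAt.comp (h₂ := fun m => pd2 w (P.1, m)) (pd2 w P)
        (hasDerivAt_pd2 hw2 P.1 (V (P.1, pd2 w P))) hv
    have h2 : (fun y => pd2 w (P.1, V (P.1, y))) =ᶠ[𝓝 (pd2 w P)] fun y => y := by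
      have : Tendsto (fun y : ℝ => (P.1, y)) (𝓝 (pd2 w P)) (𝓝 Q) := by
        have : Continuous fun y : ℝ => (P.1, y) := by fun_prop
        exact this.tendsto _
      exact this.eventually hVe
    have h3 := (h1.congr_of_eventuallyEq h2.symm).unique (hasDerivAt_id _)
    intro h0
    rw [hQ] at h0
    rw [h0, mul_zero] at h3
    exact one_ne_zero h3.symm
  obtain ⟨k, hk2, hk⟩ : ∃ k ≤ 2, pd1^[k + 2] T Q ≠ 0 := by
    by_contra hcon
    push Not at hcon
    have ho := isLittleO_cube_of_iterate_pd1 hT Q hcon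
    have hline : Tendsto (fun n : ℝ => (n, Q.2)) (𝓝 P.1) (𝓝 Q) := by
      have : Continuous fun n : ℝ => (n, Q.2) := by fun_prop
      exact this.tendsto P.1
    refine hyp (fun n => V (n, Q.2)) (hV.comp (contDiff_id.prodMk contDiff_const)) hVP
      (hline.eventually hVe) ?_
    refine (ho.neg_left).congr' ?_ EventuallyEq.rfl
    filter_upwards [hline.eventually hpd1T] with n hn
    have h0 := hpd1T.self_of_nhds
    rw [hn, h0]
    have : (Q.1, V Q) = P := by rw [hVP]
    rw [this]; ring
  obtain ⟨ε0, hε0, H⟩ := norm_integral_normalForm_le hT Q hk2 hk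
  have hsgn : ∀ᶠ q in 𝓝 Q, 0 < pd2 V q * pd2 V Q := by
    have hc : Continuous fun q => pd2 V q * pd2 V Q := by
      have := (contDiff_pd2 hV).continuous; fun_prop
    exact (hc.tendsto Q).eventually_const_lt (mul_self_pos.2 hVQ)
  obtain ⟨ε1, hε1, hbox⟩ := exists_box_subset (hVe.and (hpd2T.and (hpd22T.and hsgn)))
  set ε := min ε0 ε1 with hε
  have hεpos : 0 < ε := lt_min hε0 hε1
  have hW : ∀ q ∈ box Q ε, pd2 w (q.1, V q) = q.2 ∧ pd2 T q = V q ∧ pd2 (pd2 T) q = pd2 V q ∧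
      0 < pd2 V q * pd2 V Q := fun q hq => hbox (box_subset (min_le_right _ _) hq)
  set ga := Q.2 - ε with hga
  set gb := Q.2 + ε with hgb
  have hVd : ∀ x y, HasDerivAt (fun y => V (x, y)) (pd2 V (x, y)) y := hasDerivAt_pd2 hV
  have hVc := hV.continuous
  -- the endpoints of the curve lie on both sides of `P.2`
  have hsides : 0 < (V (P.1, gb) - P.2) * pd2 V Q ∧ (V (P.1, ga) - P.2) * pd2 V Q < 0 := by
    have hm : StrictMonoOn (fun y => V (P.1, y) * pd2 V Q) (Set.Icc ga gb) := by
      refine strictMonoOn_of_deriv_pos (convex_Icc _ _) (by fun_prop) fun y hy => ?_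
      rw [((hVd P.1 y).mul_const _).deriv]
      rw [interior_Icc] at hy
      exact (hW (P.1, y) ⟨⟨by simp [hQ]; positivity, by simp [hQ]; positivity⟩, hy.1.le, hy.2.le⟩).2.2.2
    have h1 := hm (a := Q.2) (b := gb) ⟨by linarith, by linarith⟩ ⟨by linarith, by linarith⟩ (by linarith)
    have h2 := hm (a := ga) (b := Q.2) ⟨by linarith, by linarith⟩ ⟨by linarith, by linarith⟩ (by linarith)
    have h3 : V (P.1, Q.2) = P.2 := hVP
    simp only [h3] at h1 h2
    constructor <;> linarith
  have hnear : ∀ᶠ p in 𝓝 P, 0 < (V (p.1, gb) - p.2) * pd2 V Q ∧ (V (p.1, ga) - p.2) * pd2 V Q < 0 := by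
    have c1 : Continuous fun p : ℝ × ℝ => (V (p.1, gb) - p.2) * pd2 V Q := by fun_prop
    have c2 : Continuous fun p : ℝ × ℝ => (V (p.1, ga) - p.2) * pd2 V Q := by fun_prop
    exact ((c1.tendsto P).eventually_const_lt hsides.1).and
      ((c2.tendsto P).eventually_lt_const hsides.2)
  obtain ⟨ρ0, hρ0, hρbox⟩ := exists_box_subset hnear
  refine ⟨min ρ0 (ε / 2), by positivity, fun χ hχ hχ0 => ?_⟩
  set ρ := min ρ0 (ε / 2) with hρ
  have hρ1 : ρ ≤ ρ0 := min_le_left _ _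
  have hρ2 : ρ ≤ ε / 2 := min_le_right _ _
  obtain ⟨C, hC, HC⟩ := H ε hεpos (min_le_left _ _) (fun q => χ (q.1, V q))
    (hχ.comp (contDiff_fst.prodMk hV))
  refine ⟨C, hC, fun cn cm t ht => ?_⟩
  have hχc := hχ.continuous
  have hwc := hws.continuous
  set G : ℝ → ℝ → ℂ := fun n m => (χ (n, m) : ℂ) * cis (t * (cn * n + cm * m - w (n, m))) with hG
  have hGc : Continuous (Function.uncurry G) := by
    simp only [hG, Function.uncurry_def]; fun_prop
  have hG0 : ∀ n m, (n, m) ∉ box P ρ → G n m = 0 := fun n m h => by simp [hG, hχ0 _ h]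
  have hsupp : HasCompactSupport (Function.uncurry G) :=
    HasCompactSupport.intro (isCompact_box P ρ) fun p hp => hG0 p.1 p.2 hp
  have hInt : Integrable (Function.uncurry G) (volume.prod volume) :=
    hGc.integrable_of_hasCompactSupport hsupp
  have e1 : ∫ p : ℝ × ℝ, (χ p : ℂ) * cis (t * (cn * p.1 + cm * p.2 - w p))
      = ∫ n, ∫ m, G n m := integral_prod (Function.uncurry G) hInt
  have e2 : ∫ n, ∫ m, G n m = ∫ n in (Q.1 - ε)..(Q.1 + ε), ∫ m, G n m := by
    refine (intervalIntegral.integral_eq_integral_of_support_subset fun n hn => ?_).symm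
    by_contra hcon
    refine hn (integral_eq_zero_of_ae (.of_forall fun m => hG0 n m fun hm => hcon ?_))
    have h1 := hm.1.1
    have h2 := hm.1.2
    simp only at h1 h2
    constructor <;> simp only [hQ] <;> linarith
  have e3 : ∀ n ∈ Set.uIcc (Q.1 - ε) (Q.1 + ε), ∫ m, G n m =
      SignType.sign (pd2 V Q) * ∫ m in (V (n, ga))..(V (n, gb)), G n m := by
    intro n _
    by_cases hn : n ∈ Set.Icc (P.1 - ρ) (P.1 + ρ)
    · have hmem : ∀ m, G n m ≠ 0 → (n, m) ∈ box P ρ := fun m hm => by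
        by_contra h; exact hm (hG0 n m h)
      rcases lt_or_gt_of_ne hVQ with h | h
      · rw [sign_neg h, intervalIntegral.integral_symm,
          intervalIntegral.integral_eq_integral_of_support_subset]
        · simp
        · intro m hm
          obtain ⟨h1, h2⟩ := hρbox (box_subset hρ1 (hmem m hm))
          simp only at h1 h2
          constructor
          · by_contra hc; nlinarith
          · by_contra hc; nlinarith
      · rw [sign_pos h, intervalIntegral.integral_eq_integral_of_support_subset]
        · simp
        · intro m hm
          obtain ⟨h1, h2⟩ := hρbox (box_subset hρ1 (hmem m hm))
          simp only at h1 h2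
          constructor
          · by_contra hc; nlinarith
          · by_contra hc; nlinarith
    · have : G n = fun _ => 0 := by
        ext m; exact hG0 n m fun h => hn h.1
      rw [this]; simp
  have e4 : ∀ n ∈ Set.uIcc (Q.1 - ε) (Q.1 + ε), ∫ m in (V (n, ga))..(V (n, gb)), G n m =
      ∫ y in ga..gb, ((χ (n, V (n, y)) * pd2 (pd2 T) (n, y) : ℝ) : ℂ) *
          cis (t * (cn * n + T (n, y) + (cm - y) * pd2 T (n, y))) := by
    intro n hn
    have hGn : Continuous (G n) := by
      have : G n = Function.uncurry G ∘ fun m => (n, m) := rfl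
      rw [this]; fun_prop
    rw [← intervalIntegral.integral_deriv_smul_comp (f := fun y => V (n, y)) (fun y _ => hVd n y)
      (by have := (contDiff_pd2 hV).continuous; fun_prop) hGn]
    refine intervalIntegral.integral_congr fun y hy => ?_
    rw [Set.uIcc_of_le (by linarith)] at hn hy
    obtain ⟨-, h2, h3, -⟩ := hW (n, y) ⟨hn, hy⟩
    have e : cn * n + cm * V (n, y) - w (n, V (n, y)) =
        cn * n + T (n, y) + (cm - y) * V (n, y) := by
      show _ = cn * n + (y * V (n, y) - w (n, V (n, y))) + (cm - y) * V (n, y)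
      ring
    simp only [h2, h3, hG, Function.comp, Complex.real_smul, e, Complex.ofReal_mul]
    ring
  rw [e1, e2, intervalIntegral.integral_congr e3, intervalIntegral.integral_const_mul,
    intervalIntegral.integral_congr e4, intervalIntegral_intervalIntegral_swap]
  · rw [norm_mul]
    refine le_trans (mul_le_of_le_one_left (norm_nonneg _) ?_) (HC cn cm t ht)
    rcases SignType.sign (pd2 V Q) <;> simp
  · have hT2c := (contDiff_pd2 hT).continuous
    have hT22c := (contDiff_pd2 (contDiff_pd2 hT)).continuous
    have hTc := hT.continuous
    refine (ContinuousOn.integrableOn_compact (K := Set.uIcc (Q.1 - ε) (Q.1 + ε) ×ˢ Set.uIcc ga gb)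
      (isCompact_uIcc.prod isCompact_uIcc) (Continuous.continuousOn ?_)).mono_set
      (Set.prod_mono Set.uIoc_subset_uIcc Set.uIoc_subset_uIcc)
    simp only [Function.uncurry_def]
    fun_prop

end

section

open Filter Topology
open scoped ContDiff

/-- The Klein-Gordon dispersion relation in two variables. -/
def wKG (p : ℝ × ℝ) : ℝ := √(5 - 2 * cos p.1 - 2 * cos p.2)

lemma one_le_wKG_sq_arg (p : ℝ × ℝ) : 1 ≤ 5 - 2 * cos p.1 - 2 * cos p.2 := by
  linarith [cos_le_one p.1, cos_le_one p.2]

lemma wKG_pos (p : ℝ × ℝ) : 0 < wKG p :=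
  Real.sqrt_pos.2 (by linarith [one_le_wKG_sq_arg p])

lemma wKG_sq (p : ℝ × ℝ) : wKG p ^ 2 = 5 - 2 * cos p.1 - 2 * cos p.2 :=
  Real.sq_sqrt (by linarith [one_le_wKG_sq_arg p])

lemma contDiff_wKG : ContDiff ℝ ω wKG := by
  refine ContDiff.sqrt ?_ fun p => by linarith [one_le_wKG_sq_arg p]
  have h1 := (contDiff_cos (n := ω)).comp (contDiff_fst (𝕜 := ℝ) (E := ℝ) (F := ℝ))
  have h2 := (contDiff_cos (n := ω)).comp (contDiff_snd (𝕜 := ℝ) (E := ℝ) (F := ℝ))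
  exact (contDiff_const.sub (contDiff_const.mul h1)).sub (contDiff_const.mul h2)

lemma continuous_wKG : Continuous wKG := contDiff_wKG.continuous

lemma wKG_swap (p : ℝ × ℝ) : wKG p.swap = wKG p := by
  simp only [wKG, Prod.fst_swap, Prod.snd_swap]; congr 1; ring

lemma hasDerivAt_wKG {x y : ℝ → ℝ} {x' y' s : ℝ} (hx : HasDerivAt x x' s)
    (hy : HasDerivAt y y' s) :
    HasDerivAt (fun s => wKG (x s, y s))
      ((sin (x s) * x' + sin (y s) * y') / wKG (x s, y s)) s := by
  have h := (((hasDerivAt_const s (5 : ℝ)).sub (hx.cos.const_mul 2)).sub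
    (hy.cos.const_mul 2)).sqrt (by
      have := one_le_wKG_sq_arg (x s, y s)
      simp only [Pi.sub_apply] at *; linarith)
  refine h.congr_deriv ?_
  have := (wKG_pos (x s, y s)).ne'
  show _ / (2 * wKG (x s, y s)) = _
  field_simp
  ring

lemma hasDerivAt_sin_div_wKG {z x y : ℝ → ℝ} {z' x' y' s : ℝ} (hz : HasDerivAt z z' s)
    (hx : HasDerivAt x x' s) (hy : HasDerivAt y y' s) :
    HasDerivAt (fun s => sin (z s) / wKG (x s, y s))
      ((cos (z s) * z' * wKG (x s, y s) ^ 2 - sin (z s) * (sin (x s) * x' + sin (y s) * y'))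
        / wKG (x s, y s) ^ 3) s := by
  refine (hz.sin.div (hasDerivAt_wKG hx hy) (wKG_pos _).ne').congr_deriv ?_
  have := (wKG_pos (x s, y s)).ne'
  field_simp

lemma pd1_wKG (p : ℝ × ℝ) : pd1 wKG p = sin p.1 / wKG p := by
  have h := (hasDerivAt_pd1 (contDiff_wKG.of_le le_top) p.1 p.2).unique
    (hasDerivAt_wKG (hasDerivAt_id p.1) (hasDerivAt_const p.1 p.2))
  simpa using h

lemma pd2_wKG (p : ℝ × ℝ) : pd2 wKG p = sin p.2 / wKG p := by
  have h := (hasDerivAt_pd2 (contDiff_wKG.of_le le_top) p.1 p.2).unique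
    (hasDerivAt_wKG (hasDerivAt_const p.2 p.1) (hasDerivAt_id p.2))
  simpa using h

lemma pd2_pd2_wKG (p : ℝ × ℝ) :
    pd2 (pd2 wKG) p = (cos p.2 * wKG p ^ 2 - sin p.2 ^ 2) / wKG p ^ 3 := by
  have hs : ContDiff ℝ ∞ (pd2 wKG) := contDiff_pd2 (contDiff_wKG.of_le le_top)
  have h := (hasDerivAt_pd2 hs p.1 p.2)
  simp only [pd2_wKG] at h
  have h2 := h.unique (hasDerivAt_sin_div_wKG (hasDerivAt_id p.2) (hasDerivAt_const p.2 p.1)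
    (hasDerivAt_id p.2))
  rw [show p = (p.1, p.2) from rfl, h2]
  ring

/-- Reading off a vanishing coefficient. -/
lemma coeff_zero_step {l : Filter ℝ} [l.NeBot] {e g : ℝ → ℝ} {a b : ℝ} {k : ℕ}
    (he : Tendsto e l (𝓝 0)) (hne : ∀ᶠ x in l, e x ≠ 0) (hg : Tendsto g l (𝓝 b))
    (h : (fun x => a + e x * g x) =o[l] fun x => e x ^ (k + 1)) :
    a = 0 ∧ g =o[l] fun x => e x ^ k := by
  have ha : a = 0 := by
    have h1 : Tendsto (fun x => a + e x * g x) l (𝓝 (a + 0 * b)) :=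
      tendsto_const_nhds.add (he.mul hg)
    have h2 : Tendsto (fun x => e x ^ (k + 1)) l (𝓝 0) := by
      simpa using he.pow (k + 1)
    have h3 := (h.trans_tendsto h2)
    have := tendsto_nhds_unique h1 h3
    simpa using this
  refine ⟨ha, ?_⟩
  rw [Asymptotics.isLittleO_iff] at h ⊢
  intro c hc
  filter_upwards [h hc, hne] with x hx hx0
  rw [ha, zero_add, pow_succ', norm_mul, norm_mul] at hx
  have hp : 0 < ‖e x‖ := norm_pos_iff.2 hx0
  nlinarith

lemma quartic_coeffs {l : Filter ℝ} [l.NeBot] {e : ℝ → ℝ} {a0 a1 a2 a3 : ℝ}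
    (he : Tendsto e l (𝓝 0)) (hne : ∀ᶠ x in l, e x ≠ 0)
    (h : (fun x => a0 + e x * (a1 + e x * (a2 + e x * (a3 + e x)))) =o[l] fun x => e x ^ 3) :
    a0 = 0 ∧ a1 = 0 ∧ a2 = 0 ∧ a3 = 0 := by
  have t3 : Tendsto (fun x => a3 + e x) l (𝓝 (a3 + 0)) := tendsto_const_nhds.add he
  have t2 := (tendsto_const_nhds (x := a2)).add (he.mul t3)
  have t1 := (tendsto_const_nhds (x := a1)).add (he.mul t2)
  obtain ⟨h0, h⟩ := coeff_zero_step he hne t1 h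
  obtain ⟨h1, h⟩ := coeff_zero_step he hne t2 h
  obtain ⟨h2, h⟩ := coeff_zero_step (k := 0) he hne t3 h
  refine ⟨h0, h1, h2, ?_⟩
  have h3 : Tendsto (fun x => a3 + e x) l (𝓝 0) := by
    simpa [Asymptotics.isLittleO_one_iff] using h
  simpa using tendsto_nhds_unique t3 h3

lemma hasDerivAt_of_isLittleO_cube {G : ℝ → ℝ} {n0 G0 : ℝ} (hG0 : G n0 = G0)
    (h : (fun n => G n - G0) =o[𝓝 n0] fun n => (n - n0) ^ 3) : HasDerivAt G 0 n0 := by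
  rw [hasDerivAt_iff_isLittleO]
  simp only [smul_zero, sub_zero, hG0]
  refine h.trans_isBigO ?_
  have : (fun n : ℝ => (n - n0) ^ 3) = fun n => (n - n0) ^ 2 * (n - n0) := by ext; ring
  rw [this]
  have h2 : Tendsto (fun n : ℝ => (n - n0) ^ 2) (𝓝 n0) (𝓝 ((n0 - n0) ^ 2)) :=
    ((continuous_id.sub continuous_const).pow 2).tendsto n0
  simpa using (h2.isBigO_one ℝ).mul (Asymptotics.isBigO_refl (fun n : ℝ => n - n0) (𝓝 n0))

/-- Third-order nondegeneracy of `∂₁ω` along the level curve of `∂₂ω`. -/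
lemma wKG_curve_nondegenerate (P : ℝ × ℝ)
    (v : ℝ → ℝ) (hv : ContDiff ℝ ∞ v) (hvP : v P.1 = P.2)
    (hcurve : ∀ᶠ n in 𝓝 P.1, pd2 wKG (n, v n) = pd2 wKG P) :
    ¬ ((fun n => pd1 wKG (n, v n) - pd1 wKG P) =o[𝓝 P.1] fun n => (n - P.1) ^ 3) := by
  intro ho
  have hvd : HasDerivAt v (deriv v P.1) P.1 := (hv.differentiable (by simp) _).hasDerivAt
  have hPe : (P.1, v P.1) = P := by rw [hvP]
  have hw0 := (wKG_pos P).ne'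
  by_cases hs1 : sin P.1 = 0
  · have hG := hasDerivAt_of_isLittleO_cube (G := fun n => pd1 wKG (n, v n))
      (by simp only [hPe]) ho
    simp only [pd1_wKG] at hG
    have e1 := hG.unique (hasDerivAt_sin_div_wKG (hasDerivAt_id P.1) (hasDerivAt_id P.1) hvd)
    have hc : HasDerivAt (fun n => pd2 wKG (n, v n)) 0 P.1 :=
      (hasDerivAt_const P.1 (pd2 wKG P)).congr_of_eventuallyEq hcurve
    simp only [pd2_wKG] at hc
    have e2 := hc.unique (hasDerivAt_sin_div_wKG hvd (hasDerivAt_id P.1) hvd)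
    simp only [hvP, hs1, zero_mul, zero_add, sub_zero, mul_one] at e1 e2
    rw [show (P.1, P.2) = P from rfl] at e1 e2
    have hcos : cos P.1 = 0 := by
      rcases div_eq_zero_iff.1 e1.symm with h | h
      · exact (mul_eq_zero.1 h).resolve_right (pow_ne_zero _ hw0)
      · exact absurd h (pow_ne_zero _ hw0)
    have := sin_sq_add_cos_sq P.1
    rw [hs1, hcos] at this
    norm_num at this
  · set γ := pd2 wKG P with hγ
    set A : ℝ → ℝ := fun n => pd1 wKG (n, v n) ^ 2 with hA
    set A0 := pd1 wKG P ^ 2 with hA0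
    have hA0pos : 0 < A0 := by
      rw [hA0, pd1_wKG]
      exact pow_pos (abs_pos.2 (div_ne_zero hs1 hw0)) 2 |>.trans_eq (sq_abs _)
    -- the algebraic identity along the curve
    have hid : ∀ᶠ n in 𝓝 P.1, (cos n ^ 2 - 2 * A n * cos n + 5 * A n - 1) ^ 2 - 4 * A n ^ 2
        + 4 * γ ^ 2 * A n * (1 - cos n ^ 2) = 0 := by
      filter_upwards [hcurve] with n hn
      have hw := wKG_pos (n, v n)
      have hX := wKG_sq (n, v n)
      simp only [hA, pd1_wKG]
      rw [pd2_wKG, div_eq_iff hw.ne'] at hn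
      simp only at hn hX
      have hs := sin_sq_add_cos_sq n
      have hs2 := sin_sq_add_cos_sq (v n)
      set W := wKG (n, v n)
      set G := sin n / W with hG
      have hsn : sin n = G * W := by rw [hG]; field_simp
      have h1 : G ^ 2 * W ^ 2 = 1 - cos n ^ 2 := by rw [← mul_pow, ← hsn]; linarith
      have h2 : γ ^ 2 * W ^ 2 = 1 - cos (v n) ^ 2 := by rw [← mul_pow, ← hn]; linarith
      have h3 : cos n ^ 2 - 2 * G ^ 2 * cos n + 5 * G ^ 2 - 1 = G ^ 2 * (2 * cos (v n)) := by
        rw [hX] at h1; linarith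
      rw [h3, ← h1]
      linear_combination (4 * G ^ 4) * h2
    have hAo : (fun n => A n - A0) =o[𝓝 P.1] fun n => (n - P.1) ^ 3 := by
      have : (fun n => A n - A0) = fun n => (pd1 wKG (n, v n) + pd1 wKG P) *
          (pd1 wKG (n, v n) - pd1 wKG P) := by ext n; simp only [hA, hA0]; ring
      rw [this]
      have hb : (fun n => pd1 wKG (n, v n) + pd1 wKG P) =O[𝓝 P.1] fun _ => (1 : ℝ) := by
        have hc : Continuous fun n => pd1 wKG (n, v n) + pd1 wKG P := by
          have h1 := (contDiff_pd1 (contDiff_wKG.of_le le_top)).continuous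
          have h2 := hv.continuous
          fun_prop
        exact (hc.tendsto P.1).isBigO_one ℝ
      simpa using hb.mul_isLittleO ho
    have hAt : Tendsto A (𝓝 P.1) (𝓝 A0) := by
      have h1 := (contDiff_pd1 (contDiff_wKG.of_le le_top)).continuous
      have h2 := hv.continuous
      have hc : Continuous A := by simp only [hA]; fun_prop
      have := hc.tendsto P.1
      simpa only [hA, hPe] using this
    have hfr : (fun n => (cos n ^ 2 - 2 * A0 * cos n + 5 * A0 - 1) ^ 2 - 4 * A0 ^ 2
        + 4 * γ ^ 2 * A0 * (1 - cos n ^ 2)) =o[𝓝 P.1] fun n => (n - P.1) ^ 3 := by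
      have hb : Tendsto (fun n => (cos n ^ 2 - 1 + cos n ^ 2 - 1 + (5 - 2 * cos n) * (A n + A0))
          * (5 - 2 * cos n) - 4 * (A n + A0) + 4 * γ ^ 2 * (1 - cos n ^ 2)) (𝓝 P.1)
          (𝓝 ((cos P.1 ^ 2 - 1 + cos P.1 ^ 2 - 1 + (5 - 2 * cos P.1) * (A0 + A0))
          * (5 - 2 * cos P.1) - 4 * (A0 + A0) + 4 * γ ^ 2 * (1 - cos P.1 ^ 2))) := by
        have hc : Tendsto cos (𝓝 P.1) (𝓝 (cos P.1)) := continuous_cos.tendsto _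
        have hk : ∀ k : ℝ, Tendsto (fun _ : ℝ => k) (𝓝 P.1) (𝓝 k) := fun k => tendsto_const_nhds
        exact ((((((hc.pow 2).sub (hk 1)).add (hc.pow 2)).sub (hk 1)).add
          (((hk 5).sub ((hk 2).mul hc)).mul (hAt.add (hk A0)))).mul
          ((hk 5).sub ((hk 2).mul hc))).sub ((hk 4).mul (hAt.add (hk A0))) |>.add
          ((hk (4 * γ ^ 2)).mul ((hk 1).sub (hc.pow 2)))
      have := ((hb.isBigO_one ℝ).mul_isLittleO hAo).neg_left
      simp only [one_mul] at this
      refine this.congr' ?_ EventuallyEq.rfl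
      filter_upwards [hid] with n hn
      linear_combination -hn
    have hcd : HasDerivAt cos (-sin P.1) P.1 := hasDerivAt_cos P.1
    set e : ℝ → ℝ := fun n => cos n - cos P.1 with he
    have hee : Tendsto e (𝓝[≠] P.1) (𝓝 0) := by
      have : Continuous e := by simp only [he]; fun_prop
      have := this.tendsto P.1
      simp only [he, sub_self] at this
      exact this.mono_left nhdsWithin_le_nhds
    have hne : ∀ᶠ n in 𝓝[≠] P.1, e n ≠ 0 := by
      filter_upwards [hcd.eventually_ne (c := cos P.1) (neg_ne_zero.2 hs1)] with n hn
      exact sub_ne_zero.2 hn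
    have hO : (fun n => n - P.1) =O[𝓝 P.1] e :=
      (HasDerivAtFilter.isTheta_sub hcd (neg_ne_zero.2 hs1)).2.comp_tendsto
        (k := fun n : ℝ => (n, P.1)) (tendsto_id.prodMk tendsto_const_pure)
    have hfin := (hfr.trans_isBigO (hO.pow 3)).mono (nhdsWithin_le_nhds (s := {P.1}ᶜ))
    set c := cos P.1 with hcdef
    set k := 5 * A0 - 1 with hkdef
    have hform := quartic_coeffs (a0 := (c ^ 2 - 2 * A0 * c + k) ^ 2 - 4 * A0 ^ 2
        + 4 * γ ^ 2 * A0 * (1 - c ^ 2))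
      (a1 := 2 * (c ^ 2 - 2 * A0 * c + k) * (2 * c - 2 * A0) - 8 * γ ^ 2 * A0 * c)
      (a2 := (2 * c - 2 * A0) ^ 2 + 2 * (c ^ 2 - 2 * A0 * c + k) - 4 * γ ^ 2 * A0)
      (a3 := 2 * (2 * c - 2 * A0)) hee hne (hfin.congr_left fun n => by
        have : cos n = c + e n := by simp only [he]; ring
        rw [this, hkdef]; ring)
    obtain ⟨h0, h1, h2, h3⟩ := hform
    have hcA : c = A0 := by linarith
    rw [hcA] at h0 h1 h2
    have hγ0 : γ ^ 2 = 0 := by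
      have : γ ^ 2 * (A0 * A0) = 0 := by linarith
      exact (mul_eq_zero.1 this).resolve_right (mul_pos hA0pos hA0pos).ne'
    rw [hγ0] at h0 h2
    have hk0 : A0 ^ 2 - 2 * A0 * A0 + k = 0 := by linarith
    rw [hk0] at h0
    nlinarith

lemma wKG_dispersive_of_pd2 (P : ℝ × ℝ) (hP : pd2 (pd2 wKG) P ≠ 0) :
    ∃ ρ, 0 < ρ ∧ ∀ χ : ℝ × ℝ → ℝ, ContDiff ℝ ∞ χ → (∀ p, p ∉ box P ρ → χ p = 0) →
      ∃ C, 0 < C ∧ ∀ cn cm t : ℝ, 1 ≤ t →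
        ‖∫ p : ℝ × ℝ, (χ p : ℂ) * cis (t * (cn * p.1 + cm * p.2 - wKG p))‖
          ≤ C * t ^ (-(3 / 4 : ℝ)) :=
  local_dispersive contDiff_wKG P hP (wKG_curve_nondegenerate P)

lemma integral_comp_of_measurePreserving {φ : ℝ × ℝ → ℝ × ℝ} (hφ : MeasurePreserving φ)
    {f : ℝ × ℝ → ℂ} (hf : Continuous f) : ∫ p, f (φ p) = ∫ p, f p := by
  rw [← integral_map hφ.measurable.aemeasurable hf.aestronglyMeasurable, hφ.map_eq]

lemma measurePreserving_shear :
    MeasurePreserving (fun p : ℝ × ℝ => (p.1 + p.2, p.2)) := by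
  have h1 : MeasurePreserving (Prod.swap : ℝ × ℝ → ℝ × ℝ) volume volume :=
    Measure.measurePreserving_swap
  have h2 : MeasurePreserving (fun z : ℝ × ℝ => (z.1, z.2 + z.1)) volume volume :=
    measurePreserving_prod_add_right volume volume
  exact h1.comp (h2.comp h1)

lemma sheared_curve_nondegenerate (P : ℝ × ℝ)
    (h1 : cos P.1 * wKG P ^ 2 = sin P.1 ^ 2) (h2 : cos P.2 * wKG P ^ 2 = sin P.2 ^ 2)
    {x y : ℝ → ℝ} {x' y' s : ℝ} (hx : HasDerivAt x x' s) (hy : HasDerivAt y y' s)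
    (hPx : (x s, y s) = P)
    (e1 : HasDerivAt (fun s => pd1 wKG (x s, y s)) 0 s)
    (e2 : HasDerivAt (fun s => pd1 wKG (x s, y s) + pd2 wKG (x s, y s)) 0 s) :
    x' = 0 ∧ y' = 0 := by
  have hw0 := (wKG_pos P).ne'
  have hs : ∀ z, cos z * wKG P ^ 2 = sin z ^ 2 → sin z ≠ 0 := by
    intro z hz h
    rw [h] at hz
    have := (mul_eq_zero.1 (hz.trans (by norm_num : (0 : ℝ) ^ 2 = 0))).resolve_right
      (pow_ne_zero _ hw0)
    have h4 := sin_sq_add_cos_sq z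
    rw [h, this] at h4; norm_num at h4
  have e3 := e2.sub e1
  simp only [pd1_wKG, pd2_wKG] at e1 e3
  have e1' := e1.unique (hasDerivAt_sin_div_wKG hx hx hy)
  have e3' := (e3.congr_of_eventuallyEq (.of_forall fun n => by simp)).unique
    (hasDerivAt_sin_div_wKG hy hx hy)
  obtain ⟨rfl, -⟩ : P = (x s, y s) ∧ True := ⟨hPx.symm, trivial⟩
  simp only at h1 h2
  have hs1 := hs _ h1
  have hs2 := hs _ h2
  rw [eq_comm, div_eq_zero_iff] at e1'
  rw [sub_zero, eq_comm, div_eq_zero_iff] at e3'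
  have e1' := e1'.resolve_right (pow_ne_zero _ hw0)
  have e3' := e3'.resolve_right (pow_ne_zero _ hw0)
  constructor
  · have : sin (x s) * sin (y s) * x' = 0 := by linear_combination y' * h2 - e3'
    exact (mul_eq_zero.1 this).resolve_left (mul_ne_zero hs1 hs2)
  · have : sin (x s) * sin (y s) * y' = 0 := by linear_combination x' * h1 - e1'
    exact (mul_eq_zero.1 this).resolve_left (mul_ne_zero hs1 hs2)

/-- Local dispersive estimate for the Klein-Gordon relation near every point. -/
lemma wKG_local_dispersive (P : ℝ × ℝ) :
    ∃ ρ, 0 < ρ ∧ ∀ χ : ℝ × ℝ → ℝ, ContDiff ℝ ∞ χ → (∀ p, p ∉ box P ρ → χ p = 0) →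
      ∃ C, 0 < C ∧ ∀ cn cm t : ℝ, 1 ≤ t →
        ‖∫ p : ℝ × ℝ, (χ p : ℂ) * cis (t * (cn * p.1 + cm * p.2 - wKG p))‖
          ≤ C * t ^ (-(3 / 4 : ℝ)) := by
  have hcw := continuous_wKG
  by_cases h22 : pd2 (pd2 wKG) P = 0
  swap
  · exact wKG_dispersive_of_pd2 P h22
  by_cases h11 : pd2 (pd2 wKG) P.swap = 0
  swap
  · obtain ⟨ρ, hρ, H⟩ := wKG_dispersive_of_pd2 P.swap h11
    refine ⟨ρ, hρ, fun χ hχ hχ0 => ?_⟩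
    obtain ⟨C, hC, HC⟩ := H (fun p => χ p.swap) (hχ.comp (contDiff_snd.prodMk contDiff_fst))
      fun p hp => hχ0 _ fun h => hp ⟨h.2, h.1⟩
    refine ⟨C, hC, fun cn cm t ht => le_trans (le_of_eq ?_) (HC cm cn t ht)⟩
    have hχc := hχ.continuous
    rw [← integral_comp_of_measurePreserving (φ := Prod.swap) Measure.measurePreserving_swap
      (by fun_prop)]
    simp only [wKG_swap, Prod.fst_swap, Prod.snd_swap, add_comm]
  -- both pure second derivatives vanish: shear
  have hw0 := (wKG_pos P).ne'
  rw [pd2_pd2_wKG, div_eq_zero_iff] at h22 h11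
  have h22 := sub_eq_zero.1 (h22.resolve_right (pow_ne_zero _ hw0))
  have h11 := sub_eq_zero.1 (h11.resolve_right (pow_ne_zero _ (wKG_pos _).ne'))
  rw [wKG_swap, Prod.snd_swap] at h11
  set w : ℝ × ℝ → ℝ := fun p => wKG (p.1 + p.2, p.2) with hwdef
  have hsh : ContDiff ℝ ω fun p : ℝ × ℝ => (p.1 + p.2, p.2) :=
    (contDiff_fst.add contDiff_snd).prodMk contDiff_snd
  have hw : ContDiff ℝ ω w := contDiff_wKG.comp hsh
  have hws : ContDiff ℝ ∞ w := hw.of_le le_top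
  have hd1 : ∀ p, pd1 w p = pd1 wKG (p.1 + p.2, p.2) := by
    intro p
    have h := (hasDerivAt_pd1 hws p.1 p.2).unique
      (hasDerivAt_wKG ((hasDerivAt_id p.1).add_const p.2) (hasDerivAt_const p.1 p.2))
    rw [pd1_wKG]; simpa using h
  have hd2 : ∀ p, pd2 w p = pd1 wKG (p.1 + p.2, p.2) + pd2 wKG (p.1 + p.2, p.2) := by
    intro p
    have h := (hasDerivAt_pd2 hws p.1 p.2).unique
      (hasDerivAt_wKG ((hasDerivAt_id p.2).const_add p.1) (hasDerivAt_id p.2))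
    rw [pd1_wKG, pd2_wKG, ← add_div]; simpa using h
  set Pt : ℝ × ℝ := (P.1 - P.2, P.2) with hPt
  have hPe : (Pt.1 + Pt.2, Pt.2) = P := by simp [hPt]
  have hcp1 : ContDiff ℝ ∞ (pd1 wKG) := contDiff_pd1 (contDiff_wKG.of_le le_top)
  have hnd : pd2 (pd2 w) Pt ≠ 0 := by
    intro h0
    have h := hasDerivAt_pd2 (contDiff_pd2 hws) Pt.1 Pt.2
    rw [show (Pt.1, Pt.2) = Pt from rfl, h0] at h
    simp only [hd2] at h
    have hx : HasDerivAt (fun s => Pt.1 + s) 1 Pt.2 := (hasDerivAt_id _).const_add _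
    have a1 := hasDerivAt_sin_div_wKG hx hx (hasDerivAt_id Pt.2)
    have a2 := hasDerivAt_sin_div_wKG (hasDerivAt_id Pt.2) hx (hasDerivAt_id Pt.2)
    simp only [pd1_wKG, pd2_wKG] at h
    have h3 := h.unique (a1.add a2)
    simp only [id, hPe, mul_one] at h3
    have f1 : Pt.1 + Pt.2 = P.1 := congrArg Prod.fst hPe
    have f2 : Pt.2 = P.2 := rfl
    rw [f1, f2, ← add_div, eq_comm, div_eq_zero_iff] at h3
    have h3 := h3.resolve_right (pow_ne_zero _ hw0)
    have h4 : sin P.1 * sin P.2 = 0 := by linarith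
    have hs : ∀ z, cos z * wKG P ^ 2 = sin z ^ 2 → sin z ≠ 0 := by
      intro z hz h
      rw [h] at hz
      have := (mul_eq_zero.1 (hz.trans (by norm_num : (0 : ℝ) ^ 2 = 0))).resolve_right
        (pow_ne_zero _ hw0)
      have h4 := sin_sq_add_cos_sq z
      rw [h, this] at h4; norm_num at h4
    exact mul_ne_zero (hs _ h11) (hs _ h22) h4
  obtain ⟨ρ, hρ, H⟩ := local_dispersive hw Pt hnd (by
    intro v hv hvP hcurve ho
    have hvd : HasDerivAt v (deriv v Pt.1) Pt.1 := (hv.differentiable (by simp) _).hasDerivAt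
    have hG := hasDerivAt_of_isLittleO_cube (G := fun n => pd1 w (n, v n))
      (by rw [hvP]) ho
    have hc : HasDerivAt (fun n => pd2 w (n, v n)) 0 Pt.1 :=
      (hasDerivAt_const Pt.1 (pd2 w Pt)).congr_of_eventuallyEq hcurve
    simp only [hd1] at hG
    simp only [hd2] at hc
    obtain ⟨g1, g2⟩ := sheared_curve_nondegenerate P h11 h22 ((hasDerivAt_id Pt.1).add hvd) hvd
      (by simp only [Pi.add_apply, id, hvP]; exact hPe) hG hc
    linarith)
  refine ⟨ρ / 2, by positivity, fun χ hχ hχ0 => ?_⟩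
  obtain ⟨C, hC, HC⟩ := H (fun p => χ (p.1 + p.2, p.2)) (hχ.comp (hsh.of_le le_top)) (by
    intro p hp
    refine hχ0 _ fun h => hp ?_
    obtain ⟨⟨b1, b2⟩, b3, b4⟩ := h
    simp only at b1 b2 b3 b4
    refine ⟨⟨?_, ?_⟩, ?_, ?_⟩ <;> simp only [hPt] <;> linarith)
  refine ⟨C, hC, fun cn cm t ht => le_trans (le_of_eq ?_) (HC cn (cn + cm) t ht)⟩
  have hχc := hχ.continuous
  rw [← integral_comp_of_measurePreserving measurePreserving_shear (by fun_prop)]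
  refine congrArg _ (integral_congr_ae (.of_forall fun p => ?_))
  simp only [hwdef]
  congr 2
  ring

end

section

open Filter Topology
open scoped ContDiff Manifold

/-- A smooth cutoff whose `2π`-periodization is `1`. -/
def eta (x : ℝ) : ℝ := smoothTransition (x / (2 * π)) - smoothTransition (x / (2 * π) - 1)

lemma contDiff_eta : ContDiff ℝ ∞ eta := by
  have hS : ContDiff ℝ ∞ smoothTransition := smoothTransition.contDiff
  have h1 : ContDiff ℝ ∞ fun x : ℝ => x / (2 * π) := contDiff_id.div_const _
  exact (hS.comp h1).sub (hS.comp (h1.sub contDiff_const))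

lemma eta_eq_zero {x : ℝ} (hx : x ∉ Set.Icc 0 (4 * π)) : eta x = 0 := by
  have hp := pi_pos
  rcases lt_or_ge x 0 with h | h
  · have : x / (2 * π) < 0 := div_neg_of_neg_of_pos h (by positivity)
    rw [eta, smoothTransition.zero_of_nonpos this.le, smoothTransition.zero_of_nonpos (by linarith),
      sub_self]
  · have h4 : 4 * π < x := by
      by_contra hc; exact hx ⟨h, not_lt.1 hc⟩
    have : 2 ≤ x / (2 * π) := by rw [le_div_iff₀ (by positivity)]; linarith
    rw [eta, smoothTransition.one_of_one_le (by linarith), smoothTransition.one_of_one_le (by linarith),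
      sub_self]

lemma integral_eta_mul {f : ℝ → ℂ} (hf : Continuous f) (hp : ∀ x, f (x + 2 * π) = f x) :
    ∫ x, (eta x : ℂ) * f x = ∫ x in (0 : ℝ)..(2 * π), f x := by
  have hpi := pi_pos
  have hS := smoothTransition.continuous
  have hηc := contDiff_eta.continuous
  have hsub : Function.support (fun x => (eta x : ℂ) * f x) ⊆ Set.Ioc (-π) (4 * π) := by
    intro x hx
    by_contra hcon
    refine hx ?_
    have : eta x = 0 := eta_eq_zero fun h => hcon ⟨by linarith [h.1], h.2⟩
    simp [this]
  rw [← intervalIntegral.integral_eq_integral_of_support_subset hsub,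
    ← intervalIntegral.integral_add_adjacent_intervals (b := 2 * π)
      (Continuous.intervalIntegrable (by fun_prop) _ _)
      (Continuous.intervalIntegrable (by fun_prop) _ _),
    ← intervalIntegral.integral_add_adjacent_intervals (a := -π) (b := 0)
      (Continuous.intervalIntegrable (by fun_prop) _ _)
      (Continuous.intervalIntegrable (by fun_prop) _ _)]
  have e0 : ∫ x in (-π)..0, (eta x : ℂ) * f x = 0 := by
    refine intervalIntegral.integral_zero_ae (.of_forall fun x hx => ?_)
    rw [Set.uIoc_of_le (by linarith)] at hx
    have h0 : x / (2 * π) ≤ 0 := div_nonpos_of_nonpos_of_nonneg hx.2 (by positivity)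
    rw [eta, smoothTransition.zero_of_nonpos h0, smoothTransition.zero_of_nonpos (by linarith)]
    simp
  have e1 : ∫ x in (0 : ℝ)..(2 * π), (eta x : ℂ) * f x =
      ∫ x in (0 : ℝ)..(2 * π), (smoothTransition (x / (2 * π)) : ℂ) * f x := by
    refine intervalIntegral.integral_congr fun x hx => ?_
    rw [Set.uIcc_of_le (by positivity)] at hx
    have : x / (2 * π) ≤ 1 := by rw [div_le_one (by positivity)]; exact hx.2
    simp only [eta, smoothTransition.zero_of_nonpos (sub_nonpos.2 this), sub_zero]
  have e2 : ∫ x in (2 * π)..(4 * π), (eta x : ℂ) * f x =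
      ∫ x in (0 : ℝ)..(2 * π), (1 - smoothTransition (x / (2 * π)) : ℂ) * f x := by
    have := intervalIntegral.integral_comp_add_right (a := 0) (b := 2 * π)
      (fun x => (eta x : ℂ) * f x) (2 * π)
    rw [show (4 * π : ℝ) = 2 * π + 2 * π by ring]
    rw [zero_add] at this
    rw [← this]
    refine intervalIntegral.integral_congr fun x hx => ?_
    rw [Set.uIcc_of_le (by positivity)] at hx
    have h1 : (x + 2 * π) / (2 * π) = x / (2 * π) + 1 := by field_simp
    have h2 : 1 ≤ x / (2 * π) + 1 := by
      have : 0 ≤ x / (2 * π) := div_nonneg hx.1 (by positivity)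
      linarith
    simp only [eta, h1, smoothTransition.one_of_one_le h2, hp, add_sub_cancel_right]
    push_cast; ring
  rw [e0, e1, e2, zero_add, ← intervalIntegral.integral_add
    (Continuous.intervalIntegrable (by fun_prop) _ _)
    (Continuous.intervalIntegrable (by fun_prop) _ _)]
  refine intervalIntegral.integral_congr fun x _ => ?_
  ring

lemma integral_eta_mul_prod {F : ℝ × ℝ → ℂ} (hF : Continuous F)
    (h1 : ∀ x y, F (x + 2 * π, y) = F (x, y)) (h2 : ∀ x y, F (x, y + 2 * π) = F (x, y)) :
    ∫ p : ℝ × ℝ, ((eta p.1 * eta p.2 : ℝ) : ℂ) * F p =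
      ∫ x in (0 : ℝ)..(2 * π), ∫ y in (0 : ℝ)..(2 * π), F (x, y) := by
  have hηc := contDiff_eta.continuous
  have hc : Continuous fun p : ℝ × ℝ => ((eta p.1 * eta p.2 : ℝ) : ℂ) * F p := by fun_prop
  have hs : HasCompactSupport fun p : ℝ × ℝ => ((eta p.1 * eta p.2 : ℝ) : ℂ) * F p := by
    refine HasCompactSupport.intro ((isCompact_Icc (a := 0) (b := 4 * π)).prod
      (isCompact_Icc (a := 0) (b := 4 * π))) fun p hp => ?_
    have : eta p.1 * eta p.2 = 0 := by
      by_cases hh : p.1 ∈ Set.Icc 0 (4 * π)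
      · rw [eta_eq_zero (x := p.2) fun h => hp ⟨hh, h⟩, mul_zero]
      · rw [eta_eq_zero hh, zero_mul]
    rw [this]; simp
  rw [show (volume : Measure (ℝ × ℝ)) = volume.prod volume from rfl,
    integral_prod _ (hc.integrable_of_hasCompactSupport hs)]
  have hin : ∀ x, ∫ y, ((eta x * eta y : ℝ) : ℂ) * F (x, y) =
      (eta x : ℂ) * ∫ y in (0 : ℝ)..(2 * π), F (x, y) := by
    intro x
    rw [← integral_eta_mul (f := fun y => F (x, y)) (by fun_prop) (h2 x), ← integral_const_mul]
    refine integral_congr_ae (.of_forall fun y => ?_)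
    push_cast; ring
  simp only [hin]
  refine integral_eta_mul ?_ fun x => by simp only [h1]
  exact intervalIntegral.continuous_parametric_intervalIntegral_of_continuous'
    (by simpa [Function.uncurry_def] using hF) 0 (2 * π)

/-- Dispersive estimate with a smooth compactly supported amplitude. -/
lemma wKG_dispersive_of_compactSupport {χ : ℝ × ℝ → ℝ} (hχ : ContDiff ℝ ∞ χ) {K : Set (ℝ × ℝ)}
    (hK : IsCompact K) (hχ0 : ∀ p ∉ K, χ p = 0) :
    ∃ C, 0 < C ∧ ∀ cn cm t : ℝ, 1 ≤ t →
        ‖∫ p : ℝ × ℝ, (χ p : ℂ) * cis (t * (cn * p.1 + cm * p.2 - wKG p))‖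
          ≤ C * t ^ (-(3 / 4 : ℝ)) := by
  choose ρ hρ H using wKG_local_dispersive
  obtain ⟨s, hs⟩ := hK.elim_finite_subcover (fun P : ℝ × ℝ => Metric.ball P (ρ P))
    (fun _ => Metric.isOpen_ball)
    (fun P _ => Set.mem_iUnion.2 ⟨P, Metric.mem_ball_self (hρ P)⟩)
  obtain ⟨f, hf⟩ := SmoothPartitionOfUnity.exists_isSubordinate (𝓘(ℝ, ℝ × ℝ)) hK.isClosed
    (fun P : s => Metric.ball P.1 (ρ P.1)) (fun _ => Metric.isOpen_ball) (fun p hp => by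
      obtain ⟨P, hP, hp⟩ := Set.mem_iUnion₂.1 (hs hp)
      exact Set.mem_iUnion.2 ⟨⟨P, hP⟩, hp⟩)
  have hfs : ∀ P : s, ContDiff ℝ ∞ fun p => f P p * χ p := fun P =>
    ((f P).contMDiff.contDiff).mul hχ
  have hsum : ∀ p, χ p = ∑ P : s, f P p * χ p := by
    intro p
    by_cases hp : p ∈ K
    · have := f.sum_eq_one hp
      rw [finsum_eq_sum_of_fintype] at this
      rw [← Finset.sum_mul, this, one_mul]
    · simp [hχ0 p hp]
  have hz : ∀ (P : s) p, p ∉ box P.1 (ρ P.1) → f P p * χ p = 0 := by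
    intro P p hp
    have : p ∉ tsupport (f P) := fun h => hp (by
      rw [box_eq_closedBall]; exact Metric.ball_subset_closedBall (hf P h))
    rw [image_eq_zero_of_notMem_tsupport this, zero_mul]
  choose C hC HC using fun P : s => H P.1 (fun p => f P p * χ p) (hfs P) (hz P)
  refine ⟨1 + ∑ P : s, C P, by
    have := Finset.sum_nonneg fun (P : s) (_ : P ∈ Finset.univ) => (hC P).le
    positivity,
    fun cn cm t ht => ?_⟩
  have hcw := continuous_wKG
  have e : ∫ p : ℝ × ℝ, (χ p : ℂ) * cis (t * (cn * p.1 + cm * p.2 - wKG p)) =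
      ∑ P : s, ∫ p : ℝ × ℝ, ((f P p * χ p : ℝ) : ℂ) * cis (t * (cn * p.1 + cm * p.2 - wKG p)) := by
    rw [← integral_finsetSum]
    · refine integral_congr_ae (.of_forall fun p => ?_)
      simp only
      rw [← Finset.sum_mul, ← Complex.ofReal_sum, ← hsum p]
    · intro P _
      have hc := (hfs P).continuous
      refine Continuous.integrable_of_hasCompactSupport (by fun_prop)
        (HasCompactSupport.intro (isCompact_box P.1 (ρ P.1)) fun p hp => ?_)
      rw [hz P p hp]; simp
  rw [e]
  refine (norm_sum_le _ _).trans ((Finset.sum_le_sum fun P _ => HC P cn cm t ht).trans ?_)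
  rw [← Finset.sum_mul]
  gcongr
  linarith

/-- The decay function of the dispersive estimate. -/
def decay (τ : ℝ) : ℝ := (max 1 |τ|) ^ (-(3 / 4 : ℝ))

lemma continuous_decay : Continuous decay :=
  (continuous_const.max continuous_abs).rpow_const fun _ =>
    Or.inl (lt_of_lt_of_le one_pos (le_max_left _ _)).ne'

lemma decay_neg (τ : ℝ) : decay (-τ) = decay τ := by rw [decay, decay, abs_neg]

lemma decay_nonneg (τ : ℝ) : 0 ≤ decay τ := by unfold decay; positivity

lemma omegaKG_eq_wKG (ξ : Fin 2 → ℝ) : omegaKG 2 ξ = wKG (ξ 0, ξ 1) := by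
  rw [omegaKG, wKG, Fin.sum_univ_two]; congr 1; ring

lemma continuous_omegaKG : Continuous (omegaKG 2) := by
  have h := continuous_wKG
  have : omegaKG 2 = fun ξ => wKG (ξ 0, ξ 1) := funext omegaKG_eq_wKG
  rw [this]; fun_prop

lemma one_le_omegaKG (ξ : Fin 2 → ℝ) : 1 ≤ omegaKG 2 ξ := by
  rw [omegaKG_eq_wKG, wKG, Real.one_le_sqrt]; exact one_le_wKG_sq_arg _

lemma integral_cube_eq {F : ℝ × ℝ → ℂ} (hF : Continuous F) :
    ∫ ξ in cube 2, F (ξ 0, ξ 1) = ∫ x in (0 : ℝ)..(2 * π), ∫ y in (0 : ℝ)..(2 * π), F (x, y) := by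
  have hmp := volume_preserving_finTwoArrow ℝ
  have hcube : cube 2 = MeasurableEquiv.finTwoArrow ⁻¹'
      (Set.Icc 0 (2 * π) ×ˢ Set.Icc 0 (2 * π) : Set (ℝ × ℝ)) := by
    ext ξ
    simp [cube, Set.mem_Icc, Pi.le_def, Fin.forall_fin_two, MeasurableEquiv.finTwoArrow]
  have := hmp.setIntegral_preimage_emb (MeasurableEquiv.measurableEmbedding _) F
    (Set.Icc 0 (2 * π) ×ˢ Set.Icc 0 (2 * π))
  rw [← hcube] at this
  refine Eq.trans this ?_
  rw [show (volume : Measure (ℝ × ℝ)) = volume.prod volume from rfl,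
    setIntegral_prod _ (hF.continuousOn.integrableOn_compact (isCompact_Icc.prod isCompact_Icc))]
  rw [intervalIntegral.integral_of_le (by positivity), ← integral_Icc_eq_integral_Ioc]
  refine setIntegral_congr_fun measurableSet_Icc fun x _ => ?_
  rw [intervalIntegral.integral_of_le (by positivity), ← integral_Icc_eq_integral_Ioc]

lemma isCompact_cube : IsCompact (cube 2) := isCompact_Icc

lemma measurableSet_cube : MeasurableSet (cube 2) := isCompact_cube.isClosed.measurableSet

lemma volume_cube_lt_top : volume (cube 2) < ⊤ := isCompact_cube.measure_lt_top

/-- The global dispersive estimate on the torus. -/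
theorem dispersive_bound {a : ℝ × ℝ → ℝ} (ha : ContDiff ℝ ∞ a)
    (ha1 : ∀ x y, a (x + 2 * π, y) = a (x, y)) (ha2 : ∀ x y, a (x, y + 2 * π) = a (x, y)) :
    ∃ C, 0 < C ∧ ∀ (x : Fin 2 → ℤ) (τ : ℝ),
      ‖∫ ξ in cube 2, (a (ξ 0, ξ 1) : ℂ) * cis (∑ j, x j * ξ j + τ * omegaKG 2 ξ)‖
        ≤ C * decay τ := by
  have hηs := contDiff_eta
  have hχ : ContDiff ℝ ∞ fun p : ℝ × ℝ => eta p.1 * eta p.2 * a p :=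
    ((hηs.comp contDiff_fst).mul (hηs.comp contDiff_snd)).mul ha
  obtain ⟨C, hC, HC⟩ := wKG_dispersive_of_compactSupport hχ
    ((isCompact_Icc (a := 0) (b := 4 * π)).prod (isCompact_Icc (a := 0) (b := 4 * π)))
    (fun p hp => by
      by_cases hh : p.1 ∈ Set.Icc 0 (4 * π)
      · simp only [eta_eq_zero (x := p.2) fun h => hp ⟨hh, h⟩, mul_zero, zero_mul]
      · simp only [eta_eq_zero hh, zero_mul])
  have hac := ha.continuous
  have hwc := continuous_wKG
  have hwo := continuous_omegaKG
  -- negative times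
  have key : ∀ (x : Fin 2 → ℤ) (t : ℝ), 1 ≤ t →
      ‖∫ ξ in cube 2, (a (ξ 0, ξ 1) : ℂ) * cis (∑ j, x j * ξ j + (-t) * omegaKG 2 ξ)‖
        ≤ C * t ^ (-(3 / 4 : ℝ)) := by
    intro x t ht
    have ht0 : t ≠ 0 := by positivity
    refine le_trans (le_of_eq (congrArg _ ?_)) (HC (x 0 / t) (x 1 / t) t ht)
    set F : ℝ × ℝ → ℂ := fun p =>
      (a p : ℂ) * cis (t * (x 0 / t * p.1 + x 1 / t * p.2 - wKG p)) with hF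
    have hFc : Continuous F := by fun_prop
    have hper : ∀ (k : ℤ) (θ : ℝ), cis (θ + k * (2 * π)) = cis θ := by
      intro k θ
      rw [cis, cis, Complex.exp_eq_exp_iff_exists_int]
      exact ⟨k, by push_cast; ring⟩
    have h1 : ∀ u v, F (u + 2 * π, v) = F (u, v) := by
      intro u v
      simp only [hF, ha1, wKG, cos_add_two_pi]
      refine Eq.trans ?_ (congrArg (_ * ·) (hper (x 0) _))
      congr 2
      field_simp
      ring
    have h2 : ∀ u v, F (u, v + 2 * π) = F (u, v) := by
      intro u v
      simp only [hF, ha2, wKG, cos_add_two_pi]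
      refine Eq.trans ?_ (congrArg (_ * ·) (hper (x 1) _))
      congr 2
      field_simp
      ring
    have e1 := integral_cube_eq hFc
    rw [← integral_eta_mul_prod hFc h1 h2] at e1
    refine Eq.trans ?_ (e1.trans ?_)
    · refine setIntegral_congr_fun measurableSet_cube fun ξ _ => ?_
      simp only [hF, Fin.sum_univ_two, omegaKG_eq_wKG]
      congr 2
      field_simp
      ring
    · refine integral_congr_ae (.of_forall fun p => ?_)
      simp only [hF]
      push_cast; ring
  obtain ⟨B, hB⟩ := isCompact_cube.exists_bound_of_continuousOn
    (f := fun ξ : Fin 2 → ℝ => a (ξ 0, ξ 1)) (by fun_prop)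
  set M := B * (volume (cube 2)).toReal with hM
  refine ⟨max C M, lt_max_of_lt_left hC, fun x τ => ?_⟩
  have htriv : ‖∫ ξ in cube 2, (a (ξ 0, ξ 1) : ℂ) * cis (∑ j, x j * ξ j + τ * omegaKG 2 ξ)‖
      ≤ M := by
    refine norm_setIntegral_le_of_norm_le_const volume_cube_lt_top fun ξ hξ => ?_
    rw [norm_mul, norm_cis, mul_one, Complex.norm_real]
    exact hB ξ hξ
  rcases le_or_gt |τ| 1 with h | h
  · rw [decay, max_eq_left h, one_rpow, mul_one]
    exact htriv.trans (le_max_right _ _)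
  · rw [decay, max_eq_right h.le]
    refine le_trans ?_ (mul_le_mul_of_nonneg_right (le_max_left C M) (by positivity))
    rcases le_or_gt τ 0 with hτ | hτ
    · rw [abs_of_nonpos hτ] at h ⊢
      simpa using key x (-τ) h.le
    · rw [abs_of_pos hτ] at h ⊢
      have := key (-x) τ h.le
      rw [← RCLike.norm_conj, ← integral_conj] at this
      refine le_trans (le_of_eq (congrArg _ ?_)) this
      refine setIntegral_congr_fun measurableSet_cube fun ξ _ => ?_
      simp only [map_mul, Complex.conj_ofReal, conj_cis, Fin.sum_univ_two, Pi.neg_apply]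
      congr 2
      push_cast; ring

end

section

/-- The decay profile as an extended nonnegative function. -/
def kd (τ : ℝ) : ℝ≥0∞ := ENNReal.ofReal (decay τ)

@[fun_prop]
lemma measurable_kd : Measurable kd := continuous_decay.measurable.ennreal_ofReal

lemma kd_neg (τ : ℝ) : kd (-τ) = kd τ := by rw [kd, decay_neg, kd]

lemma decay_le {τ : ℝ} (h : 0 < τ) : decay τ ≤ τ ^ (-(3/4:ℝ)) := by
  rw [decay, abs_of_pos h]
  exact rpow_le_rpow_of_nonpos h (le_max_right _ _) (by norm_num)

lemma lintegral_even_Icc {f : ℝ → ℝ≥0∞} (hf : ∀ x, f (-x) = f x) (R : ℝ) :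
    ∫⁻ τ in Set.Icc (-R) R, f τ ≤ 2 * ∫⁻ τ in Set.Ioc 0 R, f τ := by
  have h1 : ∫⁻ τ in Set.Ico (-R) 0, f τ = ∫⁻ τ in Set.Ioc 0 R, f τ := by
    have := (Measure.measurePreserving_neg (volume : Measure ℝ)).setLIntegral_comp_preimage_emb
      (MeasurableEquiv.neg ℝ).measurableEmbedding f (Set.Ico (-R) 0)
    rw [← this]
    simp only [hf]
    congr 2
    ext x; simp [and_comm]
  have h2 : Set.Icc (-R) R ⊆ Set.Ico (-R) 0 ∪ ({0} ∪ Set.Ioc 0 R) := by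
    intro x hx
    rcases lt_trichotomy x 0 with h | h | h
    · exact Or.inl ⟨hx.1, h⟩
    · exact Or.inr (Or.inl h)
    · exact Or.inr (Or.inr ⟨h, hx.2⟩)
  calc _ ≤ _ := lintegral_mono_set h2
    _ ≤ _ := lintegral_union_le _ _ _
    _ ≤ (∫⁻ τ in Set.Ioc 0 R, f τ) + ((∫⁻ τ in {0}, f τ) + ∫⁻ τ in Set.Ioc 0 R, f τ) := by
        rw [h1]; exact add_le_add_right (lintegral_union_le _ _ _) _
    _ = _ := by
        have : ∫⁻ τ in ({0} : Set ℝ), f τ = 0 := by simp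
        rw [this]; ring

lemma lintegral_even_compl {f : ℝ → ℝ≥0∞} (hf : ∀ x, f (-x) = f x) (R : ℝ) :
    ∫⁻ τ in (Set.Icc (-R) R)ᶜ, f τ ≤ 2 * ∫⁻ τ in Set.Ioi R, f τ := by
  have h1 : ∫⁻ τ in Set.Iio (-R), f τ = ∫⁻ τ in Set.Ioi R, f τ := by
    have := (Measure.measurePreserving_neg (volume : Measure ℝ)).setLIntegral_comp_preimage_emb
      (MeasurableEquiv.neg ℝ).measurableEmbedding f (Set.Iio (-R))
    rw [← this]
    simp only [hf]
    congr 2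
    ext x; simp
  have h2 : (Set.Icc (-R) R)ᶜ ⊆ Set.Iio (-R) ∪ Set.Ioi R := by
    intro x hx
    by_contra h
    simp only [Set.mem_union, Set.mem_Iio, Set.mem_Ioi, not_or, not_lt] at h
    exact hx h
  calc _ ≤ _ := lintegral_mono_set h2
    _ ≤ _ := lintegral_union_le _ _ _
    _ = _ := by rw [h1]; ring

lemma lintegral_kd_near {R : ℝ} (hR : 0 < R) :
    ∫⁻ τ in Set.Icc (-R) R, kd τ ≤ ENNReal.ofReal (8 * R ^ (1/4:ℝ)) := by
  have hi : IntervalIntegrable (fun x : ℝ => x ^ (-(3/4:ℝ))) volume 0 R :=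
    intervalIntegral.intervalIntegrable_rpow' (by norm_num)
  have h : ∫⁻ τ in Set.Ioc 0 R, kd τ ≤ ENNReal.ofReal (4 * R ^ (1/4:ℝ)) := by
    calc _ ≤ ∫⁻ τ in Set.Ioc 0 R, ENNReal.ofReal (τ ^ (-(3/4:ℝ))) :=
          setLIntegral_mono' measurableSet_Ioc fun x hx =>
            ENNReal.ofReal_le_ofReal (decay_le hx.1)
      _ = ENNReal.ofReal (∫ τ in Set.Ioc 0 R, τ ^ (-(3/4:ℝ))) := by
          refine (ofReal_integral_eq_lintegral_ofReal
            ((intervalIntegrable_iff_integrableOn_Ioc_of_le hR.le).1 hi) ?_).symm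
          filter_upwards [ae_restrict_mem measurableSet_Ioc] with x hx
          exact (rpow_pos_of_pos hx.1 _).le
      _ = _ := by
          rw [← intervalIntegral.integral_of_le hR.le, integral_rpow (by left; norm_num)]
          norm_num
          rw [div_eq_mul_inv]; norm_num [mul_comm]
  refine (lintegral_even_Icc kd_neg R).trans ((mul_le_mul_right h 2).trans (le_of_eq ?_))
  rw [show (2:ℝ≥0∞) = ENNReal.ofReal 2 by simp, ← ENNReal.ofReal_mul (by norm_num)]
  congr 1; ring

lemma lintegral_kd_far {R : ℝ} (hR : 0 < R) :
    ∫⁻ τ in (Set.Icc (-R) R)ᶜ, kd τ ^ (8/3:ℝ) ≤ ENNReal.ofReal (2 * R⁻¹) := by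
  have h : ∫⁻ τ in Set.Ioi R, kd τ ^ (8/3:ℝ) ≤ ENNReal.ofReal (R⁻¹) := by
    calc _ ≤ ∫⁻ τ in Set.Ioi R, ENNReal.ofReal (τ ^ (-2:ℝ)) := by
          refine setLIntegral_mono' measurableSet_Ioi fun x hx => ?_
          have hx0 : 0 < x := hR.trans hx
          rw [kd, ENNReal.ofReal_rpow_of_nonneg (decay_nonneg x) (by norm_num)]
          refine ENNReal.ofReal_le_ofReal ?_
          calc decay x ^ (8/3:ℝ) ≤ (x ^ (-(3/4:ℝ))) ^ (8/3:ℝ) :=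
                rpow_le_rpow (decay_nonneg x) (decay_le hx0) (by norm_num)
            _ = _ := by rw [← rpow_mul hx0.le]; norm_num
      _ = ENNReal.ofReal (∫ τ in Set.Ioi R, τ ^ (-2:ℝ)) := by
          refine (ofReal_integral_eq_lintegral_ofReal
            (integrableOn_Ioi_rpow_of_lt (by norm_num) hR) ?_).symm
          filter_upwards [ae_restrict_mem measurableSet_Ioi] with x hx
          exact (rpow_pos_of_pos (hR.trans hx) _).le
      _ = _ := by
          rw [integral_Ioi_rpow_of_lt (by norm_num) hR]
          norm_num
          rw [rpow_neg_one]
  refine (lintegral_even_compl (fun x => by rw [kd_neg]) R).trans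
    ((mul_le_mul_right h 2).trans (le_of_eq ?_))
  rw [show (2:ℝ≥0∞) = ENNReal.ofReal 2 by simp, ← ENNReal.ofReal_mul (by norm_num)]

/-- The truncated potential estimate behind the Hardy–Littlewood–Sobolev inequality. -/
lemma lintegral_trunc_kd {g : ℝ → ℝ≥0∞} (hg : Measurable g) (h1 : ∫⁻ s, g s ^ (8/5:ℝ) ≤ 1)
    {l : ℝ} (hl : 0 < l) (t : ℝ) :
    ∫⁻ s in {s | g s ≤ ENNReal.ofReal l}, g s * kd (t - s) ≤ 10 * ENNReal.ofReal l ^ (3/5:ℝ) := by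
  set R := l ^ (-(8/5):ℝ) with hRdef
  have hR : 0 < R := rpow_pos_of_pos hl _
  set A : Set ℝ := {s | t - s ∈ Set.Icc (-R) R}
  have hA : MeasurableSet A := (measurable_const.sub measurable_id) measurableSet_Icc
  have hlow : MeasurableSet {s | g s ≤ ENNReal.ofReal l} := hg measurableSet_Iic
  have shift : ∀ (φ : ℝ → ℝ≥0∞) (S : Set ℝ), MeasurableSet S →
      ∫⁻ s in {s | t - s ∈ S}, φ (t - s) = ∫⁻ τ in S, φ τ := by
    intro φ S hS
    have hS' : MeasurableSet {s | t - s ∈ S} := (measurable_const.sub measurable_id) hS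
    rw [← lintegral_indicator hS',
      ← lintegral_indicator hS, ← lintegral_sub_left_eq_self (S.indicator φ) t]
    rfl
  have hconst : ENNReal.ofReal l ^ (3/5:ℝ) = ENNReal.ofReal (l ^ (3/5:ℝ)) :=
    ENNReal.ofReal_rpow_of_pos hl
  have near : ∫⁻ s in A ∩ {s | g s ≤ ENNReal.ofReal l}, g s * kd (t - s)
      ≤ 8 * ENNReal.ofReal l ^ (3/5:ℝ) := by
    calc _ ≤ ∫⁻ s in A ∩ {s | g s ≤ ENNReal.ofReal l}, ENNReal.ofReal l * kd (t - s) :=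
          setLIntegral_mono' (hA.inter hlow) fun s hs => mul_le_mul_left hs.2 _
      _ ≤ ∫⁻ s in A, ENNReal.ofReal l * kd (t - s) := lintegral_mono_set Set.inter_subset_left
      _ = ENNReal.ofReal l * ∫⁻ τ in Set.Icc (-R) R, kd τ := by
          rw [lintegral_const_mul' _ _ ENNReal.ofReal_ne_top, shift kd _ measurableSet_Icc]
      _ ≤ ENNReal.ofReal l * ENNReal.ofReal (8 * R ^ (1/4:ℝ)) := by
          gcongr; exact lintegral_kd_near hR
      _ = _ := by
          rw [← ENNReal.ofReal_mul hl.le, hconst, show (8:ℝ≥0∞) = ENNReal.ofReal 8 by simp,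
            ← ENNReal.ofReal_mul (by norm_num), hRdef, ← rpow_mul hl.le]
          congr 1
          rw [show (3/5:ℝ) = 1 + -(8/5) * (1/4) by norm_num, rpow_add hl, rpow_one]; ring
  have far : ∫⁻ s in Aᶜ, g s * kd (t - s) ≤ 2 * ENNReal.ofReal l ^ (3/5:ℝ) := by
    have hpq : (8/5:ℝ).HolderConjugate (8/3) := by
      rw [Real.holderConjugate_iff]; norm_num
    calc _ ≤ (∫⁻ s in Aᶜ, g s ^ (8/5:ℝ)) ^ (1/(8/5:ℝ)) *
            (∫⁻ s in Aᶜ, kd (t - s) ^ (8/3:ℝ)) ^ (1/(8/3:ℝ)) :=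
          ENNReal.lintegral_mul_le_Lp_mul_Lq _ hpq hg.aemeasurable (by fun_prop)
      _ ≤ 1 ^ (1/(8/5:ℝ)) * (ENNReal.ofReal (2 * R⁻¹)) ^ (1/(8/3:ℝ)) := by
          gcongr
          · exact (setLIntegral_le_lintegral _ _).trans h1
          · have := shift (fun τ => kd τ ^ (8/3:ℝ)) (Set.Icc (-R) R)ᶜ measurableSet_Icc.compl
            exact this.le.trans (lintegral_kd_far hR)
      _ = ENNReal.ofReal (2 ^ (3/8:ℝ) * l ^ (3/5:ℝ)) := by
          rw [ENNReal.one_rpow, one_mul, ENNReal.ofReal_rpow_of_pos (by positivity),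
            mul_rpow (by norm_num) (by positivity), hRdef, ← rpow_neg hl.le, ← rpow_mul hl.le]
          norm_num
      _ ≤ ENNReal.ofReal (2 * l ^ (3/5:ℝ)) := by
          refine ENNReal.ofReal_le_ofReal (mul_le_mul_of_nonneg_right ?_ (by positivity))
          calc (2:ℝ) ^ (3/8:ℝ) ≤ 2 ^ (1:ℝ) :=
                rpow_le_rpow_of_exponent_le (by norm_num) (by norm_num)
            _ = 2 := rpow_one 2
      _ = _ := by rw [ENNReal.ofReal_mul (by norm_num), hconst]; simp
  calc _ = (∫⁻ s in {s | g s ≤ ENNReal.ofReal l} ∩ A, g s * kd (t - s)) +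
        ∫⁻ s in {s | g s ≤ ENNReal.ofReal l} \ A, g s * kd (t - s) :=
        (lintegral_inter_add_sdiff (μ := volume) (fun s => g s * kd (t - s))
          {s | g s ≤ ENNReal.ofReal l} hA).symm
    _ ≤ 8 * ENNReal.ofReal l ^ (3/5:ℝ) + 2 * ENNReal.ofReal l ^ (3/5:ℝ) := by
        refine add_le_add ?_ ((lintegral_mono_set (Set.sdiff_subset_compl _ _)).trans far)
        rw [Set.inter_comm]; exact near
    _ = _ := by rw [← add_mul]; norm_num

/-- Half of the bilinear form, where the second function is dominated by the first. -/
lemma lintegral_half_bilin {f g : ℝ → ℝ≥0∞} (hg : Measurable g)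
    (h1 : ∫⁻ s, g s ^ (8/5:ℝ) ≤ 1) :
    ∫⁻ t, ∫⁻ s in {s | g s ≤ f t}, f t * (g s * kd (t - s)) ≤ 10 * ∫⁻ t, f t ^ (8/5:ℝ) := by
  rw [← lintegral_const_mul' _ _ (by norm_num)]
  refine lintegral_mono fun t => ?_
  rcases eq_or_ne (f t) 0 with h0 | h0
  · simp [h0]
  rcases eq_or_ne (f t) ∞ with ht | ht
  · simp [ht]
  rw [lintegral_const_mul' _ _ ht]
  have hl : 0 < (f t).toReal := ENNReal.toReal_pos h0 ht
  have := lintegral_trunc_kd hg h1 hl t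
  rw [ENNReal.ofReal_toReal ht] at this
  calc _ ≤ f t * (10 * f t ^ (3/5:ℝ)) := by gcongr
    _ = 10 * (f t ^ (1:ℝ) * f t ^ (3/5:ℝ)) := by rw [ENNReal.rpow_one]; ring
    _ = _ := by rw [← ENNReal.rpow_add _ _ h0 ht]; norm_num

lemma lintegral_bilin_normalized {f g : ℝ → ℝ≥0∞} (hf : Measurable f) (hg : Measurable g)
    (hf1 : ∫⁻ s, f s ^ (8/5:ℝ) ≤ 1) (hg1 : ∫⁻ s, g s ^ (8/5:ℝ) ≤ 1) :
    ∫⁻ t, ∫⁻ s, f t * (g s * kd (t - s)) ≤ 20 := by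
  have split : ∀ t, ∫⁻ s, f t * (g s * kd (t - s)) =
      (∫⁻ s in {s | g s ≤ f t}, f t * (g s * kd (t - s))) +
      ∫⁻ s in {s | g s ≤ f t}ᶜ, f t * (g s * kd (t - s)) := fun t =>
    (lintegral_add_compl (μ := volume) (fun s => f t * (g s * kd (t - s)))
      (show MeasurableSet {s | g s ≤ f t} from hg measurableSet_Iic)).symm
  have hA : MeasurableSet {p : ℝ × ℝ | g p.2 ≤ f p.1} :=
    measurableSet_le (hg.comp measurable_snd) (hf.comp measurable_fst)
  have hm : Measurable fun p : ℝ × ℝ => f p.1 * (g p.2 * kd (p.1 - p.2)) := by fun_prop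
  have e1 : ∀ t, ∫⁻ s in {s | g s ≤ f t}, f t * (g s * kd (t - s)) =
      ∫⁻ s, {p : ℝ × ℝ | g p.2 ≤ f p.1}.indicator
        (fun p => f p.1 * (g p.2 * kd (p.1 - p.2))) (t, s) := fun t => by
    rw [← lintegral_indicator (show MeasurableSet {s | g s ≤ f t} from hg measurableSet_Iic)]; rfl
  have e2 : ∀ t, ∫⁻ s in {s | g s ≤ f t}ᶜ, f t * (g s * kd (t - s)) =
      ∫⁻ s, {p : ℝ × ℝ | g p.2 ≤ f p.1}ᶜ.indicator
        (fun p => f p.1 * (g p.2 * kd (p.1 - p.2))) (t, s) := fun t => by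
    rw [← lintegral_indicator
      (show MeasurableSet {s | g s ≤ f t}ᶜ from (hg measurableSet_Iic).compl)]; rfl
  have m1 := hm.indicator hA
  have m2 := hm.indicator hA.compl
  simp_rw [split]
  rw [lintegral_add_left (by simp_rw [e1]; exact m1.lintegral_prod_right')]
  have b1 := lintegral_half_bilin (f := f) hg hg1
  have b2 : ∫⁻ t, ∫⁻ s in {s | g s ≤ f t}ᶜ, f t * (g s * kd (t - s)) ≤
      10 * ∫⁻ t, g t ^ (8/5:ℝ) := by
    refine le_trans ?_ (lintegral_half_bilin (f := g) hf hf1)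
    simp_rw [e2]
    rw [lintegral_lintegral_swap (f := fun t s => {p : ℝ × ℝ | g p.2 ≤ f p.1}ᶜ.indicator
        (fun p => f p.1 * (g p.2 * kd (p.1 - p.2))) (t, s)) m2.aemeasurable]
    refine lintegral_mono fun s => ?_
    rw [← lintegral_indicator (show MeasurableSet {t | f t ≤ g s} from hf measurableSet_Iic)]
    refine lintegral_mono fun t => ?_
    by_cases h : f t ≤ g s
    · rw [Set.indicator_of_mem (s := {t | f t ≤ g s}) (a := t) h]
      refine (Set.indicator_le_self _ _ _).trans (le_of_eq ?_)
      simp only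
      rw [← kd_neg, neg_sub]; ring
    · rw [Set.indicator_of_notMem (s := {p : ℝ × ℝ | g p.2 ≤ f p.1}ᶜ) (a := (t, s))]
      · exact zero_le
      · exact fun h' => h' (not_le.1 h).le
  calc _ ≤ 10 * 1 + 10 * 1 := add_le_add (b1.trans (by gcongr)) (b2.trans (by gcongr))
    _ = 20 := by norm_num

/-- `L^{8/5}` norm of an extended nonnegative function. -/
def N85 (f : ℝ → ℝ≥0∞) : ℝ≥0∞ := (∫⁻ s, f s ^ (8/5:ℝ)) ^ (5/8:ℝ)

/-- The Hardy–Littlewood–Sobolev inequality for the kernel `kd`. -/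
lemma hls_bilin {f g : ℝ → ℝ≥0∞} (hf : Measurable f) (hg : Measurable g) :
    ∫⁻ t, ∫⁻ s, f t * (g s * kd (t - s)) ≤ 20 * (N85 f * N85 g) := by
  have hz : ∀ {h : ℝ → ℝ≥0∞}, Measurable h → N85 h = 0 → h =ᵐ[volume] 0 := by
    intro h hh h0
    rw [N85, ENNReal.rpow_eq_zero_iff_of_pos (by norm_num), lintegral_eq_zero_iff (by fun_prop)] at h0
    filter_upwards [h0] with s hs
    simpa [show ¬ (8/5:ℝ) < 0 by norm_num] using hs
  rcases eq_or_ne (N85 f) 0 with hf0 | hf0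
  · have : ∫⁻ t, ∫⁻ s, f t * (g s * kd (t - s)) = 0 := by
      rw [lintegral_eq_zero_iff (by
        exact Measurable.lintegral_prod_right' (f := fun p : ℝ × ℝ => f p.1 * (g p.2 * kd (p.1 - p.2)))
          (by fun_prop))]
      filter_upwards [hz hf hf0] with t ht
      simp [ht]
    rw [this]; exact zero_le
  rcases eq_or_ne (N85 g) 0 with hg0 | hg0
  · have : ∀ t, ∫⁻ s, f t * (g s * kd (t - s)) = 0 := by
      intro t
      rw [lintegral_eq_zero_iff (by fun_prop)]
      filter_upwards [hz hg hg0] with s hs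
      simp [hs]
    simp [this]
  rcases eq_or_ne (N85 f) ∞ with hft | hft
  · rw [hft, ENNReal.top_mul hg0]; simp
  rcases eq_or_ne (N85 g) ∞ with hgt | hgt
  · rw [hgt, ENNReal.mul_top hf0]; simp
  have norm1 : ∀ {h : ℝ → ℝ≥0∞}, Measurable h → N85 h ≠ 0 → N85 h ≠ ∞ →
      ∫⁻ s, ((N85 h)⁻¹ * h s) ^ (8/5:ℝ) ≤ 1 := by
    intro h hh h0 ht
    simp_rw [ENNReal.mul_rpow_of_nonneg _ _ (show (0:ℝ) ≤ 8/5 by norm_num)]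
    rw [lintegral_const_mul _ (by fun_prop)]
    have : ∫⁻ s, h s ^ (8/5:ℝ) = N85 h ^ (8/5:ℝ) := by
      rw [N85, ← ENNReal.rpow_mul]; norm_num
    rw [this, ← ENNReal.mul_rpow_of_nonneg _ _ (by norm_num), ENNReal.inv_mul_cancel h0 ht]
    simp
  have key := lintegral_bilin_normalized (f := fun t => (N85 f)⁻¹ * f t)
    (g := fun t => (N85 g)⁻¹ * g t) (by fun_prop) (by fun_prop) (norm1 hf hf0 hft)
    (norm1 hg hg0 hgt)
  have e : ∀ t s, (N85 f)⁻¹ * f t * ((N85 g)⁻¹ * g s * kd (t - s)) =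
      ((N85 f)⁻¹ * (N85 g)⁻¹) * (f t * (g s * kd (t - s))) := fun t s => by ring
  have hc : (N85 f)⁻¹ * (N85 g)⁻¹ ≠ ∞ :=
    ENNReal.mul_ne_top (ENNReal.inv_ne_top.2 hf0) (ENNReal.inv_ne_top.2 hg0)
  simp_rw [e, lintegral_const_mul' _ _ hc] at key
  rw [← ENNReal.mul_inv (Or.inl hf0) (Or.inl hft), mul_comm, ← div_eq_mul_inv] at key
  rwa [ENNReal.div_le_iff (mul_ne_zero hf0 hg0) (ENNReal.mul_ne_top hft hgt)] at key

/-- The fractional integration estimate `L^{8/5} → L^{8/3}` for the kernel `kd`. -/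
lemma hls_potential {g : ℝ → ℝ≥0∞} (hg : Measurable g) :
    (∫⁻ t, (∫⁻ s, g s * kd (t - s)) ^ (8/3:ℝ)) ^ (3/8:ℝ) ≤ 20 * N85 g := by
  set h : ℝ → ℝ≥0∞ := fun t => ∫⁻ s, g s * kd (t - s) with hh
  have hm : Measurable h :=
    Measurable.lintegral_prod_right' (f := fun p : ℝ × ℝ => g p.2 * kd (p.1 - p.2)) (by fun_prop)
  set hn : ℕ → ℝ → ℝ≥0∞ := fun n => (Set.Icc (-(n:ℝ)) n).indicator fun t => min (h t) n with hhn
  have hnm : ∀ n, Measurable (hn n) := fun n =>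
    (hm.min measurable_const).indicator measurableSet_Icc
  have hle : ∀ n t, hn n t ≤ h t := fun n t =>
    (Set.indicator_le_self _ _ _).trans (min_le_left _ _)
  have bound : ∀ n, ∫⁻ t, hn n t ^ (8/3:ℝ) ≤ (20 * N85 g) ^ (8/3:ℝ) := by
    intro n
    set J := ∫⁻ t, hn n t ^ (8/3:ℝ) with hJ
    have hJfin : J ≠ ∞ := by
      have : J ≤ ∫⁻ t in Set.Icc (-(n:ℝ)) n, ((n:ℝ≥0∞)) ^ (8/3:ℝ) := by
        rw [hJ, ← lintegral_indicator measurableSet_Icc]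
        refine lintegral_mono fun t => ?_
        by_cases ht : t ∈ Set.Icc (-(n:ℝ)) n
        · simp only [hhn, Set.indicator_of_mem ht]
          gcongr
          exact min_le_right _ _
        · simp [hhn, Set.indicator_of_notMem ht]
      refine ne_top_of_le_ne_top ?_ this
      rw [setLIntegral_const]
      exact ENNReal.mul_ne_top (ENNReal.rpow_ne_top_of_nonneg (by norm_num) (by simp)) (by simp)
    have e1 : J ≤ ∫⁻ t, ∫⁻ s, hn n t ^ (5/3:ℝ) * (g s * kd (t - s)) := by
      refine lintegral_mono fun t => ?_
      rw [lintegral_const_mul _ (by fun_prop)]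
      calc hn n t ^ (8/3:ℝ) = hn n t ^ (5/3:ℝ) * hn n t ^ (1:ℝ) := by
            rw [← ENNReal.rpow_add_of_nonneg _ _ (by norm_num) (by norm_num)]; norm_num
        _ ≤ _ := by rw [ENNReal.rpow_one]; gcongr; exact hle n t
    have e2 := e1.trans (hls_bilin (f := fun t => hn n t ^ (5/3:ℝ)) ((hnm n).pow_const _) hg)
    have e3 : N85 (fun t => hn n t ^ (5/3:ℝ)) = J ^ (5/8:ℝ) := by
      rw [N85]; simp_rw [← ENNReal.rpow_mul]; norm_num; rfl
    rw [e3] at e2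
    rcases eq_or_ne J 0 with h0 | h0
    · rw [h0]; exact zero_le
    have e4 : J ^ (3/8:ℝ) ≤ 20 * N85 g := by
      have : J ^ (3/8:ℝ) = J * (J ^ (5/8:ℝ))⁻¹ := by
        rw [← ENNReal.rpow_neg]
        nth_rw 2 [← ENNReal.rpow_one J]
        rw [← ENNReal.rpow_add _ _ h0 hJfin]; norm_num
      rw [this, ← div_eq_mul_inv, ENNReal.div_le_iff
        (by simp [ENNReal.rpow_eq_zero_iff, h0, hJfin])
        (ENNReal.rpow_ne_top_of_nonneg (by norm_num) hJfin)]
      calc J ≤ _ := e2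
        _ = _ := by ring
    calc J = (J ^ (3/8:ℝ)) ^ (8/3:ℝ) := by rw [← ENNReal.rpow_mul]; norm_num
      _ ≤ _ := by gcongr
  have mono : ∀ t, Monotone fun n => hn n t ^ (8/3:ℝ) := by
    intro t m n hmn
    refine ENNReal.rpow_le_rpow ?_ (by norm_num)
    have hmn' : (m:ℝ) ≤ n := by exact_mod_cast hmn
    refine (Set.indicator_le_indicator_of_subset
      (Set.Icc_subset_Icc (neg_le_neg hmn') hmn') (fun _ => zero_le) t).trans ?_
    refine Set.indicator_le_indicator (min_le_min le_rfl (by exact_mod_cast hmn))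
  have sup : ∀ t, h t ^ (8/3:ℝ) ≤ ⨆ n, hn n t ^ (8/3:ℝ) := by
    intro t
    obtain ⟨n0, hn0⟩ := exists_nat_ge |t|
    refine le_of_tendsto' (f := fun n : ℕ => (min (h t) n) ^ (8/3:ℝ)) (x := Filter.atTop)
      (a := h t ^ (8/3:ℝ)) ?_ ?_ |>.trans le_rfl
    · have : Filter.Tendsto (fun n : ℕ => min (h t) n) Filter.atTop (nhds (min (h t) ∞)) :=
        Filter.Tendsto.min tendsto_const_nhds ENNReal.tendsto_nat_nhds_top
      rw [min_eq_left le_top] at this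
      exact ((ENNReal.continuous_rpow_const).tendsto _).comp this
    · intro n
      refine le_trans ?_ (le_iSup (fun n => hn n t ^ (8/3:ℝ)) (max n n0))
      have : t ∈ Set.Icc (-((max n n0 : ℕ):ℝ)) ((max n n0 : ℕ):ℝ) := by
        have : |t| ≤ ((max n n0 : ℕ):ℝ) := hn0.trans (by exact_mod_cast le_max_right _ _)
        exact abs_le.1 this
      simp only [hhn, Set.indicator_of_mem this]
      gcongr
      exact_mod_cast le_max_left _ _
  have final : ∫⁻ t, h t ^ (8/3:ℝ) ≤ (20 * N85 g) ^ (8/3:ℝ) := by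
    refine (lintegral_mono sup).trans ?_
    rw [lintegral_iSup (fun n => (hnm n).pow_const _) (fun m n hmn t => mono t hmn)]
    exact iSup_le bound
  calc _ ≤ ((20 * N85 g) ^ (8/3:ℝ)) ^ (3/8:ℝ) := by gcongr
    _ = _ := by rw [← ENNReal.rpow_mul]; norm_num

end

section

/-- The character `e^{ix·ξ}`. -/
def ph (x : Fin 2 → ℤ) (ξ : Fin 2 → ℝ) : ℂ := cis (∑ j, (x j : ℝ) * ξ j)

/-- The time oscillation `e^{itω(ξ)}`. -/
def osc (t : ℝ) (ξ : Fin 2 → ℝ) : ℂ := cis (t * omegaKG 2 ξ)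

lemma norm_ph (x ξ) : ‖ph x ξ‖ = 1 := norm_cis _
lemma norm_osc (t ξ) : ‖osc t ξ‖ = 1 := norm_cis _

@[fun_prop]
lemma measurable_omegaKG : Measurable (omegaKG 2) := continuous_omegaKG.measurable

@[fun_prop]
lemma measurable_ph (x) : Measurable (ph x) := by unfold ph; fun_prop

@[fun_prop]
lemma measurable_osc (t) : Measurable (osc t) := by unfold osc; fun_prop

lemma conj_ph (x ξ) : (starRingEnd ℂ) (ph x ξ) = ph (-x) ξ := by
  simp [ph, conj_cis, add_comm]

lemma conj_osc (t ξ) : (starRingEnd ℂ) (osc t ξ) = osc (-t) ξ := by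
  simp [osc, conj_cis]

lemma ph_add (x y ξ) : ph (x + y) ξ = ph x ξ * ph y ξ := by
  rw [ph, ph, ph, ← cis_add, ← Finset.sum_add_distrib]
  congr 1
  refine Finset.sum_congr rfl fun j _ => ?_
  simp; ring

lemma osc_add (s t ξ) : osc (s + t) ξ = osc s ξ * osc t ξ := by
  rw [osc, osc, osc, ← cis_add, add_mul]

lemma ph_zero (ξ) : ph 0 ξ = 1 := by simp [ph, cis_zero]

/-- Bounded measurable functions on frequency space. -/
structure BM (Ψ : (Fin 2 → ℝ) → ℂ) : Prop where
  meas : Measurable Ψ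
  bdd : ∃ B, ∀ ξ, ‖Ψ ξ‖ ≤ B

lemma BM.mul {Ψ Φ} (h : BM Ψ) (k : BM Φ) : BM fun ξ => Ψ ξ * Φ ξ := by
  obtain ⟨B, hB⟩ := h.bdd
  obtain ⟨D, hD⟩ := k.bdd
  refine ⟨h.meas.mul k.meas, B * D, fun ξ => ?_⟩
  rw [norm_mul]
  exact mul_le_mul (hB ξ) (hD ξ) (norm_nonneg _) ((norm_nonneg _).trans (hB ξ))

lemma BM.add {Ψ Φ} (h : BM Ψ) (k : BM Φ) : BM fun ξ => Ψ ξ + Φ ξ := by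
  obtain ⟨B, hB⟩ := h.bdd
  obtain ⟨D, hD⟩ := k.bdd
  exact ⟨h.meas.add k.meas, B + D, fun ξ => (norm_add_le _ _).trans (add_le_add (hB ξ) (hD ξ))⟩

lemma BM.sub {Ψ Φ} (h : BM Ψ) (k : BM Φ) : BM fun ξ => Ψ ξ - Φ ξ := by
  obtain ⟨B, hB⟩ := h.bdd
  obtain ⟨D, hD⟩ := k.bdd
  exact ⟨h.meas.sub k.meas, B + D, fun ξ => (norm_sub_le _ _).trans (add_le_add (hB ξ) (hD ξ))⟩

lemma BM.const (c : ℂ) : BM fun _ => c := ⟨measurable_const, ‖c‖, fun _ => le_rfl⟩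

lemma BM.conj {Ψ} (h : BM Ψ) : BM fun ξ => (starRingEnd ℂ) (Ψ ξ) := by
  obtain ⟨B, hB⟩ := h.bdd
  exact ⟨by have := h.meas; fun_prop, B, fun ξ => by simpa using hB ξ⟩

lemma BM.ph (x) : BM (ph x) := ⟨measurable_ph x, 1, fun ξ => (norm_ph x ξ).le⟩
lemma BM.osc (t) : BM (osc t) := ⟨measurable_osc t, 1, fun ξ => (norm_osc t ξ).le⟩

lemma BM.inv_omega : BM fun ξ => ((omegaKG 2 ξ : ℝ) : ℂ)⁻¹ := by
  refine ⟨by fun_prop, 1, fun ξ => ?_⟩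
  have := one_le_omegaKG ξ
  rw [norm_inv, Complex.norm_real, norm_of_nonneg (by linarith)]
  exact inv_le_one_of_one_le₀ this

lemma BM.sum {ι : Type*} (S : Finset ι) {Ψ : ι → (Fin 2 → ℝ) → ℂ} (h : ∀ i, BM (Ψ i)) :
    BM fun ξ => ∑ i ∈ S, Ψ i ξ := by
  classical
  induction S using Finset.induction_on with
  | empty => simpa using BM.const 0
  | insert a S ha ih =>
    simp only [Finset.sum_insert ha]
    exact (h a).add ih

lemma BM.integrable {Ψ} (h : BM Ψ) : IntegrableOn Ψ (cube 2) := by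
  obtain ⟨B, hB⟩ := h.bdd
  exact IntegrableOn.of_bound volume_cube_lt_top h.meas.aestronglyMeasurable B (.of_forall hB)

/-- The `L²` norm over the torus. -/
def n2 (Ψ : (Fin 2 → ℝ) → ℂ) : ℝ≥0∞ := eLpNorm Ψ 2 (volume.restrict (cube 2))

lemma eLpNorm_two_sq {α E : Type*} [MeasurableSpace α] [NormedAddCommGroup E] (f : α → E)
    (μ : Measure α) :
    eLpNorm f 2 μ ^ 2 = ∫⁻ x, ‖f x‖ₑ ^ 2 ∂μ := by
  have := eLpNorm_nnreal_pow_eq_lintegral (f := f) (μ := μ) (p := 2) (by norm_num)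
  simpa using this

lemma n2_lt_top {Ψ} (h : BM Ψ) : n2 Ψ < ∞ := by
  obtain ⟨B, hB⟩ := h.bdd
  have : IsFiniteMeasure (volume.restrict (cube 2)) := ⟨by
    simpa using volume_cube_lt_top⟩
  exact (MemLp.of_bound h.meas.aestronglyMeasurable B (.of_forall hB)).2

lemma n2_sq {Ψ} (h : BM Ψ) : n2 Ψ ^ 2 = ‖∫ ξ in cube 2, Ψ ξ * (starRingEnd ℂ) (Ψ ξ)‖ₑ := by
  rw [n2, eLpNorm_two_sq]
  have e : ∀ ξ, Ψ ξ * (starRingEnd ℂ) (Ψ ξ) = ((‖Ψ ξ‖ ^ 2 : ℝ) : ℂ) := fun ξ => by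
    rw [Complex.mul_conj, Complex.normSq_eq_norm_sq]
  have hi : IntegrableOn (fun ξ => ‖Ψ ξ‖ ^ 2) (cube 2) := by
    have := (h.mul h.conj).integrable.norm
    refine this.congr (.of_forall fun ξ => ?_)
    simp [sq]
  simp_rw [e]
  rw [integral_complex_ofReal, ← ofReal_norm, Complex.norm_real,
    norm_of_nonneg (integral_nonneg fun ξ => by positivity),
    ofReal_integral_eq_lintegral_ofReal hi (.of_forall fun ξ => by positivity)]
  refine lintegral_congr fun ξ => ?_
  rw [ENNReal.ofReal_pow (norm_nonneg _), ofReal_norm]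

lemma enorm_integral_mul_le {Ψ Φ} (h : BM Ψ) (k : BM Φ) :
    ‖∫ ξ in cube 2, Ψ ξ * Φ ξ‖ₑ ≤ n2 Ψ * n2 Φ := by
  refine (enorm_integral_le_lintegral_enorm _).trans ?_
  simp_rw [enorm_mul]
  have := ENNReal.lintegral_mul_le_Lp_mul_Lq (volume.restrict (cube 2)) Real.HolderConjugate.two_two
    (f := fun ξ => ‖Ψ ξ‖ₑ) (g := fun ξ => ‖Φ ξ‖ₑ) h.meas.enorm.aemeasurable
    k.meas.enorm.aemeasurable
  refine this.trans (le_of_eq ?_)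
  rw [n2, n2, eLpNorm_eq_lintegral_rpow_enorm_toReal (by norm_num) (by norm_num),
    eLpNorm_eq_lintegral_rpow_enorm_toReal (by norm_num) (by norm_num)]
  simp

lemma le_of_self_dual {A X Y K : ℝ≥0∞} (hA : A ≠ ∞) (h1 : A ≤ X * Y) (h2 : Y ^ 2 ≤ K ^ 2 * A) :
    A ≤ (X * K) ^ 2 := by
  rcases eq_or_ne A 0 with h0 | h0
  · rw [h0]; exact zero_le
  have : A * A ≤ (X * K) ^ 2 * A := by
    calc A * A ≤ (X * Y) * (X * Y) := mul_le_mul' h1 h1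
      _ = X ^ 2 * Y ^ 2 := by ring
      _ ≤ X ^ 2 * (K ^ 2 * A) := by gcongr
      _ = _ := by ring
  exact (ENNReal.mul_le_mul_iff_left h0 hA).1 this

lemma integral_exp_int (n : ℤ) (hn : n ≠ 0) :
    ∫ x in (0:ℝ)..(2*π), cis ((n:ℝ) * x) = 0 := by
  have hc : (Complex.I * n) ≠ 0 := mul_ne_zero Complex.I_ne_zero (by exact_mod_cast hn)
  have := integral_exp_mul_complex (a := 0) (b := 2 * π) hc
  have e : ∀ x : ℝ, cis ((n:ℝ) * x) = Complex.exp (Complex.I * n * x) := fun x => by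
    rw [cis]; push_cast; ring_nf
  simp_rw [e]
  rw [this]
  have : Complex.exp (Complex.I * n * ((2 * π : ℝ) : ℂ)) = 1 := by
    rw [Complex.exp_eq_one_iff]
    exact ⟨n, by push_cast; ring⟩
  rw [this]; simp

lemma integral_ph (x : Fin 2 → ℤ) :
    ∫ ξ in cube 2, ph x ξ = if x = 0 then ((2 * π : ℝ) : ℂ) ^ 2 else 0 := by
  have := integral_cube_eq (F := fun p : ℝ × ℝ => cis ((x 0 : ℝ) * p.1) * cis ((x 1 : ℝ) * p.2))
    (by fun_prop)
  simp only [← cis_add] at this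
  simp only [ph, Fin.sum_univ_two]
  rw [this]
  simp only [cis_add, intervalIntegral.integral_const_mul, intervalIntegral.integral_mul_const]
  split_ifs with h
  · subst h
    simp [cis_zero]; ring
  · have : x 0 ≠ 0 ∨ x 1 ≠ 0 := by
      by_contra hc
      push Not at hc
      exact h (funext fun j => by fin_cases j; exacts [hc.1, hc.2])
    rcases this with h | h
    · rw [integral_exp_int _ h, zero_mul]
    · rw [integral_exp_int _ h, mul_zero]

lemma n2_sq_trig (S : Finset (Fin 2 → ℤ)) (c : (Fin 2 → ℤ) → ℂ) :
    n2 (fun ξ => ∑ x ∈ S, c x * ph x ξ) ^ 2 = ENNReal.ofReal (2 * π) ^ 2 * ∑ x ∈ S, ‖c x‖ₑ ^ 2 := by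
  classical
  rw [n2_sq (BM.sum S fun x => (BM.const (c x)).mul (BM.ph x))]
  have e : ∀ ξ, (∑ x ∈ S, c x * ph x ξ) * (starRingEnd ℂ) (∑ x ∈ S, c x * ph x ξ) =
      ∑ x ∈ S, ∑ y ∈ S, c x * (starRingEnd ℂ) (c y) * ph (x - y) ξ := fun ξ => by
    rw [map_sum, Finset.sum_mul_sum]
    refine Finset.sum_congr rfl fun x _ => Finset.sum_congr rfl fun y _ => ?_
    rw [sub_eq_add_neg, ph_add, map_mul, conj_ph]; ring
  simp_rw [e]
  rw [integral_finsetSum _ fun x _ =>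
    (BM.sum S fun y => (BM.const (c x * (starRingEnd ℂ) (c y))).mul (BM.ph (x - y))).integrable]
  have e2 : ∀ x ∈ S, ∫ ξ in cube 2, ∑ y ∈ S, c x * (starRingEnd ℂ) (c y) * ph (x - y) ξ =
      (((2 * π) ^ 2 * ‖c x‖ ^ 2 : ℝ) : ℂ) := by
    intro x hx
    rw [integral_finsetSum _ fun y _ =>
      ((BM.const (c x * (starRingEnd ℂ) (c y))).mul (BM.ph (x - y))).integrable]
    simp_rw [integral_const_mul, integral_ph, sub_eq_zero, mul_ite, mul_zero]
    rw [Finset.sum_ite_eq S x, if_pos hx, Complex.mul_conj, Complex.normSq_eq_norm_sq]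
    push_cast; ring
  rw [Finset.sum_congr rfl e2, ← Complex.ofReal_sum, ← ofReal_norm, Complex.norm_real,
    norm_of_nonneg (by positivity), ← Finset.mul_sum, ENNReal.ofReal_mul (by positivity),
    ENNReal.ofReal_pow (by positivity), ENNReal.ofReal_sum_of_nonneg fun _ _ => by positivity]
  congr 1
  refine Finset.sum_congr rfl fun x _ => ?_
  rw [ENNReal.ofReal_pow (norm_nonneg _), ofReal_norm]

lemma eLpNorm_count_two_le {c : (Fin 2 → ℤ) → ℂ} {M : ℝ≥0∞}
    (h : ∀ S : Finset (Fin 2 → ℤ), ∑ x ∈ S, ‖c x‖ₑ ^ 2 ≤ M ^ 2) :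
    eLpNorm c 2 Measure.count ≤ M := by
  refine (ENNReal.pow_le_pow_left_iff two_ne_zero).1 ?_
  rw [eLpNorm_two_sq, lintegral_count, ENNReal.tsum_eq_iSup_sum]
  exact iSup_le h

/-- Bessel's inequality for the Fourier coefficients of a function on the torus. -/
lemma bessel {Ψ} (h : BM Ψ) :
    eLpNorm (fun x => ∫ ξ in cube 2, Ψ ξ * ph x ξ) 2 Measure.count ≤
      ENNReal.ofReal (2 * π) * n2 Ψ := by
  refine eLpNorm_count_two_le fun S => ?_
  set c : (Fin 2 → ℤ) → ℂ := fun x => ∫ ξ in cube 2, Ψ ξ * ph x ξ with hc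
  have hA : ∑ x ∈ S, ‖c x‖ₑ ^ 2 ≠ ∞ := by
    refine (ENNReal.sum_lt_top.2 fun x _ => ?_).ne
    exact ENNReal.pow_lt_top enorm_lt_top
  have hQ := BM.sum S fun x => (BM.const ((starRingEnd ℂ) (c x))).mul (BM.ph x)
  have h1 : ∑ x ∈ S, ‖c x‖ₑ ^ 2 ≤ n2 Ψ * n2 fun ξ => ∑ x ∈ S, (starRingEnd ℂ) (c x) * ph x ξ := by
    refine le_trans (le_of_eq ?_) (enorm_integral_mul_le h hQ)
    have e : ∫ ξ in cube 2, Ψ ξ * ∑ x ∈ S, (starRingEnd ℂ) (c x) * ph x ξ =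
        ((∑ x ∈ S, ‖c x‖ ^ 2 : ℝ) : ℂ) := by
      simp_rw [Finset.mul_sum, mul_left_comm (Ψ _)]
      rw [integral_finsetSum _ fun x _ => ((BM.const _).mul (h.mul (BM.ph x))).integrable]
      simp_rw [integral_const_mul]
      push_cast
      refine Finset.sum_congr rfl fun x _ => ?_
      change _ * c x = _
      rw [mul_comm]
      rw [Complex.mul_conj, Complex.normSq_eq_norm_sq]
      push_cast; rfl
    rw [e, ← ofReal_norm, Complex.norm_real, norm_of_nonneg (by positivity),
      ENNReal.ofReal_sum_of_nonneg fun _ _ => by positivity]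
    refine Finset.sum_congr rfl fun x _ => ?_
    rw [ENNReal.ofReal_pow (norm_nonneg _), ofReal_norm]
  refine (le_of_self_dual (K := ENNReal.ofReal (2 * π)) hA h1 ?_).trans (by rw [mul_comm])
  rw [n2_sq_trig]
  simp

end

section

lemma adm_toReal {q r : ℝ≥0∞} (hr : 2 ≤ r) (hadm : 1/q ≤ 3/4 * (1/2 - 1/r)) :
    1 / q.toReal ≤ 3/4 * (1/2 - 1/r.toReal) := by
  have hr' : 1/r ≤ 1/2 := ENNReal.div_le_div_left hr 1
  have hfin : (3/4 * (1/2 - 1/r) : ℝ≥0∞) ≠ ∞ := by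
    refine ENNReal.mul_ne_top (ENNReal.div_ne_top (by norm_num) (by norm_num)) ?_
    exact ne_top_of_le_ne_top (by norm_num) (tsub_le_self : (1/2 - 1/r : ℝ≥0∞) ≤ 1/2)
  have := ENNReal.toReal_mono hfin hadm
  rw [ENNReal.toReal_mul, ENNReal.toReal_sub_of_le hr' (by norm_num)] at this
  simpa using this

lemma eLpNorm_top_count {v : (Fin 2 → ℤ) → ℂ} :
    eLpNorm v ∞ Measure.count = ⨆ x, ‖v x‖ₑ := by
  rw [eLpNorm_exponent_top, eLpNormEssSup_count]

lemma eLpNorm_top_le_two (v : (Fin 2 → ℤ) → ℂ) :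
    eLpNorm v ∞ Measure.count ≤ eLpNorm v 2 Measure.count := by
  rw [eLpNorm_top_count]
  exact iSup_le fun x => enorm_le_eLpNorm_count v x (by norm_num)

/-- Log-convexity of `ℓ^r` norms between `ℓ²` and `ℓ^∞`. -/
lemma eLpNorm_interp (v : (Fin 2 → ℤ) → ℂ) {r : ℝ≥0∞} (hr : 2 ≤ r) {θ : ℝ} (h1 : θ ≤ 1)
    (h2 : 2 / r.toReal ≤ θ) :
    eLpNorm v r Measure.count ≤
      eLpNorm v 2 Measure.count ^ θ * eLpNorm v ∞ Measure.count ^ (1 - θ) := by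
  set N2 := eLpNorm v 2 Measure.count with hN2
  set Ni := eLpNorm v ∞ Measure.count with hNi
  have hle : Ni ≤ N2 := eLpNorm_top_le_two v
  have h0 : 0 ≤ 2 / r.toReal := by positivity
  have hθ : 0 ≤ θ := h0.trans h2
  rcases eq_or_ne r ∞ with rfl | hrt
  · rw [← hNi]
    calc Ni = Ni ^ (θ + (1 - θ)) := by simp
      _ = Ni ^ θ * Ni ^ (1 - θ) := ENNReal.rpow_add_of_nonneg _ _ hθ (by linarith)
      _ ≤ _ := by gcongr
  · have hr2 : 2 ≤ r.toReal := by
      simpa using ENNReal.toReal_mono hrt hr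
    have hr0 : 0 < r.toReal := by linarith
    have key : ∫⁻ x, ‖v x‖ₑ ^ r.toReal ∂Measure.count ≤ N2 ^ (2:ℝ) * Ni ^ (r.toReal - 2) := by
      have : N2 ^ (2:ℝ) = ∫⁻ x, ‖v x‖ₑ ^ 2 ∂Measure.count := by
        rw [← eLpNorm_two_sq]; norm_cast
      rw [this, lintegral_count, lintegral_count, ← ENNReal.tsum_mul_right]
      refine ENNReal.tsum_le_tsum fun x => ?_
      calc ‖v x‖ₑ ^ r.toReal = ‖v x‖ₑ ^ ((2:ℝ) + (r.toReal - 2)) := by congr 1; ring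
        _ = ‖v x‖ₑ ^ 2 * ‖v x‖ₑ ^ (r.toReal - 2) := by
          rw [ENNReal.rpow_add_of_nonneg _ _ (by norm_num) (by linarith)]; norm_cast
        _ ≤ _ := by
          refine mul_le_mul_right (ENNReal.rpow_le_rpow ?_ (by linarith)) _
          rw [hNi, eLpNorm_top_count]
          exact le_iSup (fun x => ‖v x‖ₑ) x
    rw [eLpNorm_eq_lintegral_rpow_enorm_toReal (by rintro rfl; simp at hr) hrt]
    calc _ ≤ (N2 ^ (2:ℝ) * Ni ^ (r.toReal - 2)) ^ (1 / r.toReal) := by gcongr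
      _ = N2 ^ (2 / r.toReal) * Ni ^ ((1 - θ) + (θ - 2 / r.toReal)) := by
        rw [ENNReal.mul_rpow_of_nonneg _ _ (by positivity), ← ENNReal.rpow_mul, ← ENNReal.rpow_mul]
        congr 2
        · ring
        · field_simp; ring
      _ = N2 ^ (2 / r.toReal) * (Ni ^ (1 - θ) * Ni ^ (θ - 2 / r.toReal)) := by
        rw [ENNReal.rpow_add_of_nonneg _ _ (by linarith) (by linarith)]
      _ ≤ N2 ^ (2 / r.toReal) * (Ni ^ (1 - θ) * N2 ^ (θ - 2 / r.toReal)) := by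
        have := ENNReal.rpow_le_rpow hle (show 0 ≤ θ - 2 / r.toReal by linarith)
        gcongr
      _ = (N2 ^ (2 / r.toReal) * N2 ^ (θ - 2 / r.toReal)) * Ni ^ (1 - θ) := by ring
      _ = _ := by
        rw [← ENNReal.rpow_add_of_nonneg _ _ h0 (by linarith)]
        congr 2; ring

/-- Interpolation of mixed norms between `L^∞ ℓ²` and `L^{8/3} ℓ^∞`. -/
lemma mixedNorm_le_of_endpoints {q r : ℝ≥0∞} (hq : 2 ≤ q) (hr : 2 ≤ r)
    (hadm : 1/q ≤ 3/4 * (1/2 - 1/r)) {u : ℝ → (Fin 2 → ℤ) → ℂ} {M : ℝ≥0∞}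
    (h2 : ∀ t, eLpNorm (u t) 2 Measure.count ≤ M)
    (hi : ∫⁻ t, eLpNorm (u t) ∞ Measure.count ^ (8/3:ℝ) ≤ M ^ (8/3:ℝ)) :
    mixedNorm 2 q r u ≤ M := by
  rcases eq_or_ne M ∞ with rfl | hM
  · exact le_top
  have had := adm_toReal hr hadm
  set θ : ℝ := 1 - 8 / 3 * (1 / q.toReal) with hθ
  have hθ1 : θ ≤ 1 := by
    have : 0 ≤ 1 / q.toReal := by positivity
    linarith
  have hθ2 : 2 / r.toReal ≤ θ := by
    rw [hθ, show 2 / r.toReal = 2 * (1 / r.toReal) by ring]; linarith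
  have hθ0 : 0 ≤ θ := le_trans (by positivity) hθ2
  have hp : ∀ t, eLpNorm (u t) r Measure.count ≤
      M ^ θ * eLpNorm (u t) ∞ Measure.count ^ (1 - θ) := fun t =>
    (eLpNorm_interp (u t) hr hθ1 hθ2).trans (mul_le_mul_left (ENNReal.rpow_le_rpow (h2 t) hθ0) _)
  rw [mixedNorm, lqNorm]
  split_ifs with hqt
  · subst hqt
    refine essSup_le_of_ae_le M (.of_forall fun t => (hp t).trans ?_)
    have : θ = 1 := by simp [hθ]
    simp [this]
  · have hq0 : 0 < q.toReal := by
      refine ENNReal.toReal_pos ?_ hqt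
      rintro rfl; simp at hq
    have hMt : M ^ (θ * q.toReal) ≠ ∞ := ENNReal.rpow_ne_top_of_nonneg (by positivity) hM
    have e : (1 - θ) * q.toReal = 8 / 3 := by rw [hθ]; field_simp; ring
    have : ∫⁻ t, eLpNorm (u t) r Measure.count ^ q.toReal ≤ M ^ q.toReal := by
      calc _ ≤ ∫⁻ t, M ^ (θ * q.toReal) * eLpNorm (u t) ∞ Measure.count ^ (8/3:ℝ) := by
            refine lintegral_mono fun t => ?_
            refine (ENNReal.rpow_le_rpow (hp t) hq0.le).trans (le_of_eq ?_)
            rw [ENNReal.mul_rpow_of_nonneg _ _ hq0.le, ← ENNReal.rpow_mul, ← ENNReal.rpow_mul, e]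
        _ ≤ M ^ (θ * q.toReal) * M ^ (8/3:ℝ) := by
            rw [lintegral_const_mul' _ _ hMt]; gcongr
        _ = _ := by
            rw [← ENNReal.rpow_add_of_nonneg _ _ (by positivity) (by norm_num), ← e]
            congr 1; ring
    calc _ ≤ (M ^ q.toReal) ^ (1 / q.toReal) := by gcongr
      _ = M := by rw [← ENNReal.rpow_mul, mul_one_div_cancel hq0.ne', ENNReal.rpow_one]

/-- Bounded measurable functions of time with bounded support. -/
structure TF (g : ℝ → ℂ) : Prop where
  meas : Measurable g
  bdd : ∃ B, ∀ t, ‖g t‖ ≤ B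
  supp : ∃ R, ∀ t, R < |t| → g t = 0

lemma TF.integrable {g} (h : TF g) : Integrable g := by
  obtain ⟨B, hB⟩ := h.bdd
  obtain ⟨R, hR⟩ := h.supp
  have : IntegrableOn g (Set.Icc (-R) R) :=
    IntegrableOn.of_bound (by simp) h.meas.aestronglyMeasurable B (.of_forall hB)
  rw [integrableOn_iff_integrable_of_support_subset] at this
  · exact this
  · intro t ht
    by_contra hc
    refine ht (hR t ?_)
    by_contra h'
    exact hc (abs_le.1 (not_lt.1 h'))

lemma TF.mul_bdd {g} (h : TF g) {b : ℝ → ℂ} (hb : Measurable b) {B : ℝ} (hB : ∀ t, ‖b t‖ ≤ B) :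
    TF fun t => b t * g t := by
  obtain ⟨D, hD⟩ := h.bdd
  obtain ⟨R, hR⟩ := h.supp
  refine ⟨hb.mul h.meas, ⟨B * D, fun t => ?_⟩, R, fun t ht => by rw [hR t ht, mul_zero]⟩
  rw [norm_mul]
  exact mul_le_mul (hB t) (hD t) (norm_nonneg _) ((norm_nonneg _).trans (hB t))

lemma measurable_eval {u : ℝ → (Fin 2 → ℤ) → ℂ} (hu : ∀ x, Measurable fun t => u t x)
    {x : ℝ → Fin 2 → ℤ} (hx : Measurable x) : Measurable fun t => u t (x t) := by
  have : Measurable fun p : ℝ × (Fin 2 → ℤ) => u p.1 p.2 :=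
    measurable_from_prod_countable_left fun x => hu x
  exact this.comp (measurable_id.prodMk hx)

lemma exists_measurable_argmax {u : ℝ → (Fin 2 → ℤ) → ℂ} (hu : ∀ x, Measurable fun t => u t x)
    (e : ℕ → Fin 2 → ℤ) (n : ℕ) : ∃ x : ℝ → Fin 2 → ℤ, Measurable x ∧
      ∀ t, ∀ k < n, ‖u t (e k)‖ ≤ ‖u t (x t)‖ := by
  induction n with
  | zero => exact ⟨fun _ => 0, measurable_const, by simp⟩
  | succ n ih =>
    obtain ⟨x, hx, hmax⟩ := ih
    have hS : MeasurableSet {t | ‖u t (x t)‖ ≤ ‖u t (e n)‖} :=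
      measurableSet_le (measurable_eval hu hx).norm (hu _).norm
    classical
    refine ⟨fun t => if ‖u t (x t)‖ ≤ ‖u t (e n)‖ then e n else x t,
      Measurable.ite hS measurable_const hx, fun t k hk => ?_⟩
    rcases Nat.lt_succ_iff_lt_or_eq.1 hk with h | rfl
    · dsimp only
      split_ifs with hc
      · exact (hmax t k h).trans hc
      · exact hmax t k h
    · dsimp only
      split_ifs with hc
      · exact le_rfl
      · exact (not_le.1 hc).le

/-- Linearization of the maximal function: an `L^{8/3} ℓ^∞` bound follows by duality from bounds
along measurable choices of the site. -/
lemma lintegral_sup_le_of_linearized {u : ℝ → (Fin 2 → ℤ) → ℂ}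
    (hu : ∀ x, Measurable fun t => u t x) {B : ℝ} (hB : ∀ t x, ‖u t x‖ ≤ B) {K : ℝ≥0∞}
    (hK : ∀ x : ℝ → Fin 2 → ℤ, Measurable x → ∀ g, TF g →
      ‖∫ t, g t * u t (x t)‖ₑ ≤ K * N85 fun t => ‖g t‖ₑ) :
    ∫⁻ t, eLpNorm (u t) ∞ Measure.count ^ (8/3:ℝ) ≤ K ^ (8/3:ℝ) := by
  have key : ∀ x : ℝ → Fin 2 → ℤ, Measurable x → ∀ R : ℝ,
      ∫⁻ t in Set.Icc (-R) R, ‖u t (x t)‖ₑ ^ (8/3:ℝ) ≤ K ^ (8/3:ℝ) := by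
    intro x hx R
    set h : ℝ → ℂ := fun t => u t (x t) with hh
    have hm : Measurable h := measurable_eval hu hx
    set g : ℝ → ℂ := (Set.Icc (-R) R).indicator
      fun t => (starRingEnd ℂ) (h t) * ((‖h t‖ ^ (2/3:ℝ) : ℝ) : ℂ) with hg
    have hB0 : 0 ≤ B := (norm_nonneg _).trans (hB 0 0)
    have hgm : Measurable g := by
      refine Measurable.indicator ?_ measurableSet_Icc
      fun_prop
    have hgn : ∀ t, ‖g t‖ₑ = (Set.Icc (-R) R).indicator (fun t => ‖h t‖ₑ ^ (5/3:ℝ)) t := by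
      intro t
      by_cases ht : t ∈ Set.Icc (-R) R
      · rw [hg, Set.indicator_of_mem ht, Set.indicator_of_mem ht, enorm_mul]
        have : ‖((‖h t‖ ^ (2/3:ℝ) : ℝ) : ℂ)‖ₑ = ‖h t‖ₑ ^ (2/3:ℝ) := by
          rw [← ofReal_norm, Complex.norm_real, norm_of_nonneg (by positivity), ← ofReal_norm,
            ENNReal.ofReal_rpow_of_nonneg (norm_nonneg _) (by norm_num)]
        rw [this, RCLike.enorm_conj]
        nth_rw 1 [← ENNReal.rpow_one ‖h t‖ₑ]
        rw [← ENNReal.rpow_add_of_nonneg _ _ (by norm_num) (by norm_num)]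
        norm_num
      · rw [hg, Set.indicator_of_notMem ht, Set.indicator_of_notMem ht, enorm_zero]
    have hTF : TF g := by
      refine ⟨hgm, ⟨B * B ^ (2/3:ℝ), fun t => ?_⟩, R, fun t ht => ?_⟩
      · by_cases ht : t ∈ Set.Icc (-R) R
        · rw [hg, Set.indicator_of_mem ht, norm_mul, RCLike.norm_conj, Complex.norm_real,
            norm_of_nonneg (by positivity)]
          have := hB t (x t)
          gcongr
        · rw [hg, Set.indicator_of_notMem ht, norm_zero]; positivity
      · rw [hg, Set.indicator_of_notMem]
        exact fun hc => absurd (abs_le.2 hc) (not_le.2 ht)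
    set J := ∫⁻ t in Set.Icc (-R) R, ‖h t‖ₑ ^ (8/3:ℝ) with hJ
    have hJfin : J ≠ ∞ := by
      have hle : J ≤ ∫⁻ t in Set.Icc (-R) R, ENNReal.ofReal B ^ (8/3:ℝ) := by
        refine lintegral_mono fun t => ?_
        refine ENNReal.rpow_le_rpow ?_ (by norm_num)
        rw [← ofReal_norm]
        exact ENNReal.ofReal_le_ofReal (hB t (x t))
      refine ne_top_of_le_ne_top ?_ hle
      rw [setLIntegral_const]
      exact ENNReal.mul_ne_top (ENNReal.rpow_ne_top_of_nonneg (by norm_num) (by simp)) (by simp)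
    have hN : N85 (fun t => ‖g t‖ₑ) = J ^ (5/8:ℝ) := by
      rw [N85, hJ, ← lintegral_indicator measurableSet_Icc]
      congr 1
      refine lintegral_congr fun t => ?_
      rw [hgn]
      by_cases ht : t ∈ Set.Icc (-R) R
      · rw [Set.indicator_of_mem ht, Set.indicator_of_mem ht, ← ENNReal.rpow_mul]; norm_num
      · rw [Set.indicator_of_notMem ht, Set.indicator_of_notMem ht]; norm_num
    have hInt : ‖∫ t, g t * h t‖ₑ = J := by
      have e : ∀ t, g t * h t =
          (((Set.Icc (-R) R).indicator (fun t => ‖h t‖ ^ (8/3:ℝ)) t : ℝ) : ℂ) := by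
        intro t
        by_cases ht : t ∈ Set.Icc (-R) R
        · rw [hg, Set.indicator_of_mem ht, Set.indicator_of_mem ht]
          rw [show (starRingEnd ℂ) (h t) * ((‖h t‖ ^ (2/3:ℝ) : ℝ) : ℂ) * h t =
            (h t * (starRingEnd ℂ) (h t)) * ((‖h t‖ ^ (2/3:ℝ) : ℝ) : ℂ) by ring,
            Complex.mul_conj, Complex.normSq_eq_norm_sq, ← Complex.ofReal_mul]
          congr 1
          rw [← rpow_natCast, ← rpow_add_of_nonneg (norm_nonneg _) (by norm_num) (by norm_num)]
          norm_num
        · rw [hg, Set.indicator_of_notMem ht, Set.indicator_of_notMem ht]; simp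
      simp_rw [e]
      have hnn : ∀ t, 0 ≤ (Set.Icc (-R) R).indicator (fun t => ‖h t‖ ^ (8/3:ℝ)) t := fun t =>
        Set.indicator_nonneg (fun _ _ => by positivity) t
      rw [integral_complex_ofReal, ← ofReal_norm, Complex.norm_real,
        norm_of_nonneg (integral_nonneg hnn), ofReal_integral_eq_lintegral_ofReal ?_ (.of_forall hnn),
        hJ, ← lintegral_indicator measurableSet_Icc]
      · refine lintegral_congr fun t => ?_
        by_cases ht : t ∈ Set.Icc (-R) R
        · rw [Set.indicator_of_mem ht, Set.indicator_of_mem ht,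
            ← ENNReal.ofReal_rpow_of_nonneg (norm_nonneg _) (by norm_num), ofReal_norm]
        · rw [Set.indicator_of_notMem ht, Set.indicator_of_notMem ht]; simp
      · rw [integrable_indicator_iff measurableSet_Icc]
        refine IntegrableOn.of_bound (by simp) (hm.norm.pow_const _).aestronglyMeasurable
          (B ^ (8/3:ℝ)) (.of_forall fun t => ?_)
        rw [norm_of_nonneg (by positivity)]
        exact rpow_le_rpow (norm_nonneg _) (hB t (x t)) (by norm_num)
    have h1 : J ≤ K * J ^ (5/8:ℝ) := by
      have := hK x hx g hTF
      rwa [hN, hInt] at this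
    rcases eq_or_ne J 0 with h0 | h0
    · rw [h0]; exact zero_le
    have h2 : J ^ (3/8:ℝ) ≤ K := by
      have : J ^ (3/8:ℝ) = J * (J ^ (5/8:ℝ))⁻¹ := by
        rw [← ENNReal.rpow_neg]
        nth_rw 2 [← ENNReal.rpow_one J]
        rw [← ENNReal.rpow_add _ _ h0 hJfin]; norm_num
      rwa [this, ← div_eq_mul_inv, ENNReal.div_le_iff
        (by simp [ENNReal.rpow_eq_zero_iff, h0, hJfin])
        (ENNReal.rpow_ne_top_of_nonneg (by norm_num) hJfin)]
    calc J = (J ^ (3/8:ℝ)) ^ (8/3:ℝ) := by rw [← ENNReal.rpow_mul]; norm_num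
      _ ≤ _ := by gcongr
  obtain ⟨e, he⟩ := exists_surjective_nat (Fin 2 → ℤ)
  set s : ℕ → ℝ → ℝ≥0∞ := fun n => (Set.Icc (-(n:ℝ)) n).indicator
    fun t => ((Finset.range n).sup fun k => ‖u t (e k)‖ₑ) ^ (8/3:ℝ) with hs
  have hsm : ∀ n, Measurable (s n) := by
    intro n
    refine Measurable.indicator ?_ measurableSet_Icc
    refine Measurable.pow_const ?_ _
    induction n with
    | zero => simp
    | succ n ih =>
      simp_rw [Finset.range_add_one, Finset.sup_insert]
      exact (hu (e n)).enorm.sup ih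
  have hmono : Monotone s := by
    intro m n hmn t
    have hmn' : (m:ℝ) ≤ n := by exact_mod_cast hmn
    refine (Set.indicator_le_indicator_of_subset
      (Set.Icc_subset_Icc (neg_le_neg hmn') hmn') (fun _ => zero_le) t).trans ?_
    refine Set.indicator_le_indicator (ENNReal.rpow_le_rpow ?_ (by norm_num))
    exact Finset.sup_mono (Finset.range_mono hmn)
  have hsn : ∀ n, ∫⁻ t, s n t ≤ K ^ (8/3:ℝ) := by
    intro n
    obtain ⟨x, hx, hmax⟩ := exists_measurable_argmax hu e n
    refine le_trans ?_ (key x hx n)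
    rw [hs, lintegral_indicator measurableSet_Icc]
    refine lintegral_mono fun t => ENNReal.rpow_le_rpow ?_ (by norm_num)
    refine Finset.sup_le fun k hk => ?_
    rw [← ofReal_norm, ← ofReal_norm]
    exact ENNReal.ofReal_le_ofReal (hmax t k (Finset.mem_range.1 hk))
  have hsup : ∀ t, eLpNorm (u t) ∞ Measure.count ^ (8/3:ℝ) ≤ ⨆ n, s n t := by
    intro t
    have hc : eLpNorm (u t) ∞ Measure.count ≤ (⨆ n, s n t) ^ (3/8:ℝ) := by
      rw [eLpNorm_top_count]
      refine iSup_le fun y => ?_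
      obtain ⟨k, rfl⟩ := he y
      obtain ⟨n0, hn0⟩ := exists_nat_ge |t|
      have hmem : t ∈ Set.Icc (-((max n0 (k+1) : ℕ):ℝ)) ((max n0 (k+1) : ℕ):ℝ) :=
        abs_le.1 (hn0.trans (by exact_mod_cast le_max_left _ _))
      have : ‖u t (e k)‖ₑ ^ (8/3:ℝ) ≤ ⨆ n, s n t := by
        refine le_trans ?_ (le_iSup (fun n => s n t) (max n0 (k+1)))
        simp only [hs]
        rw [Set.indicator_of_mem hmem]
        refine ENNReal.rpow_le_rpow ?_ (by norm_num)
        exact Finset.le_sup (f := fun k => ‖u t (e k)‖ₑ)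
          (Finset.mem_range.2 (lt_of_lt_of_le (Nat.lt_succ_self k) (le_max_right _ _)))
      calc ‖u t (e k)‖ₑ = (‖u t (e k)‖ₑ ^ (8/3:ℝ)) ^ (3/8:ℝ) := by
            rw [← ENNReal.rpow_mul]; norm_num
        _ ≤ _ := by gcongr
    calc _ ≤ ((⨆ n, s n t) ^ (3/8:ℝ)) ^ (8/3:ℝ) := by gcongr
      _ = _ := by rw [← ENNReal.rpow_mul]; norm_num
  refine (lintegral_mono hsup).trans ?_
  rw [lintegral_iSup hsm hmono]
  exact iSup_le hsn

end

section

@[fun_prop]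
lemma measurable_ph_comp {α : Type*} [MeasurableSpace α] {x : α → Fin 2 → ℤ}
    {ξ : α → Fin 2 → ℝ} (hx : Measurable x) (hξ : Measurable ξ) :
    Measurable fun a => ph (x a) (ξ a) := by
  unfold ph
  refine measurable_cis.comp (Finset.measurable_sum _ fun j _ => ?_)
  refine Measurable.mul ?_ ((measurable_pi_apply j).comp hξ)
  exact (measurable_of_countable (fun n : ℤ => (n : ℝ))).comp ((measurable_pi_apply j).comp hx)

@[fun_prop]
lemma measurable_osc_comp {α : Type*} [MeasurableSpace α] {t : α → ℝ}
    {ξ : α → Fin 2 → ℝ} (ht : Measurable t) (hξ : Measurable ξ) :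
    Measurable fun a => osc (t a) (ξ a) := by
  unfold osc; fun_prop

/-- The free evolution with profile `Ψ` on the frequency side. -/
def hKG (Ψ : (Fin 2 → ℝ) → ℂ) (t : ℝ) (x : Fin 2 → ℤ) : ℂ :=
  ∫ ξ in cube 2, Ψ ξ * osc t ξ * ph x ξ

/-- The adjoint of the free evolution, restricted to a space-time curve. -/
def adj (σ : ℝ) (x : ℝ → Fin 2 → ℤ) (g : ℝ → ℂ) (ξ : Fin 2 → ℝ) : ℂ :=
  ∫ t, g t * (ph (x t) ξ * osc (σ * t) ξ)

lemma bm_adj (σ : ℝ) {x : ℝ → Fin 2 → ℤ} (hx : Measurable x) {g : ℝ → ℂ} (hg : TF g) :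
    BM (adj σ x g) := by
  have hgm := hg.meas
  refine ⟨?_, ∫ t, ‖g t‖, fun ξ => ?_⟩
  · have hm : Measurable fun p : (Fin 2 → ℝ) × ℝ =>
        g p.2 * (ph (x p.2) p.1 * osc (σ * p.2) p.1) := by fun_prop
    exact hm.stronglyMeasurable.integral_prod_right'.measurable
  · refine (norm_integral_le_integral_norm _).trans (le_of_eq ?_)
    simp [norm_ph, norm_osc]

instance : IsFiniteMeasure ((volume : Measure (Fin 2 → ℝ)).restrict (cube 2)) :=
  ⟨by simpa using volume_cube_lt_top⟩

lemma exists_dispersive_one : ∃ C : ℝ≥0∞, C ≠ ∞ ∧ ∀ (x : Fin 2 → ℤ) (τ : ℝ),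
    ‖∫ ξ in cube 2, ph x ξ * osc τ ξ‖ₑ ≤ C * kd τ := by
  obtain ⟨C, hC, h⟩ := dispersive_bound (a := fun _ => 1) contDiff_const (by simp) (by simp)
  refine ⟨ENNReal.ofReal C, ENNReal.ofReal_ne_top, fun x τ => ?_⟩
  rw [kd, ← ENNReal.ofReal_mul hC.le, ← ofReal_norm]
  refine ENNReal.ofReal_le_ofReal (le_trans (le_of_eq ?_) (h x τ))
  congr 2
  ext ξ
  simp [ph, osc, cis_add]

/-- The `TT*` bound for the adjoint of the free evolution. -/
lemma exists_adj_bound : ∃ C : ℝ≥0∞, C ≠ ∞ ∧ ∀ σ : ℝ, |σ| = 1 →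
    ∀ x : ℝ → Fin 2 → ℤ, Measurable x → ∀ g, TF g →
      n2 (adj σ x g) ≤ C * N85 fun t => ‖g t‖ₑ := by
  obtain ⟨C, hC, hdisp⟩ := exists_dispersive_one
  refine ⟨(C * 20) ^ (1/2:ℝ), ENNReal.rpow_ne_top_of_nonneg (by norm_num)
    (ENNReal.mul_ne_top hC (by norm_num)), fun σ hσ x hx g hg => ?_⟩
  have hgm := hg.meas
  have hkd : ∀ τ, kd (σ * τ) = kd τ := by
    intro τ
    rcases (abs_eq (by norm_num)).1 hσ with h | h
    · rw [h, one_mul]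
    · rw [h, neg_one_mul, kd_neg]
  refine (ENNReal.pow_le_pow_left_iff two_ne_zero).1 ?_
  rw [n2_sq (bm_adj σ hx hg)]
  have e1 : ∀ ξ, adj σ x g ξ * (starRingEnd ℂ) (adj σ x g ξ) =
      ∫ p : ℝ × ℝ, (g p.1 * (starRingEnd ℂ) (g p.2)) *
        (ph (x p.1 - x p.2) ξ * osc (σ * (p.1 - p.2)) ξ) := by
    intro ξ
    rw [adj, ← integral_conj, ← integral_prod_mul]
    refine integral_congr_ae (.of_forall fun p => ?_)
    simp only [map_mul, conj_ph, conj_osc, sub_eq_add_neg, ph_add, mul_add, osc_add, mul_neg]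
    ring
  have hi : Integrable (Function.uncurry fun (ξ : Fin 2 → ℝ) (p : ℝ × ℝ) =>
      (g p.1 * (starRingEnd ℂ) (g p.2)) *
        (ph (x p.1 - x p.2) ξ * osc (σ * (p.1 - p.2)) ξ))
      ((volume.restrict (cube 2)).prod (volume.prod volume)) := by
    have h1 : Integrable (fun _ : Fin 2 → ℝ => (1:ℂ)) (volume.restrict (cube 2)) :=
      integrable_const _
    have hgc : Integrable fun t => (starRingEnd ℂ) (g t) := by
      refine hg.integrable.norm.mono' (by fun_prop) (.of_forall fun t => by simp)
    refine (h1.mul_prod (hg.integrable.mul_prod hgc)).mono ?_ (.of_forall fun p => ?_)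
    · refine Measurable.aestronglyMeasurable ?_
      simp only [Function.uncurry_def]
      fun_prop
    · simp [Function.uncurry, norm_ph, norm_osc]
  simp_rw [e1]
  rw [show (volume : Measure (ℝ × ℝ)) = volume.prod volume from rfl, integral_integral_swap hi]
  simp_rw [integral_const_mul]
  calc _ ≤ ∫⁻ p : ℝ × ℝ, ‖(g p.1 * (starRingEnd ℂ) (g p.2)) *
        ∫ ξ in cube 2, ph (x p.1 - x p.2) ξ * osc (σ * (p.1 - p.2)) ξ‖ₑ :=
        enorm_integral_le_lintegral_enorm _
    _ ≤ ∫⁻ p : ℝ × ℝ, C * (‖g p.1‖ₑ * (‖g p.2‖ₑ * kd (p.1 - p.2))) := by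
        refine lintegral_mono fun p => ?_
        rw [enorm_mul, enorm_mul, RCLike.enorm_conj]
        calc _ ≤ ‖g p.1‖ₑ * ‖g p.2‖ₑ * (C * kd (σ * (p.1 - p.2))) :=
              mul_le_mul_right (hdisp _ _) _
          _ = _ := by rw [hkd]; ring
    _ = C * ∫⁻ t, ∫⁻ s, ‖g t‖ₑ * (‖g s‖ₑ * kd (t - s)) := by
        rw [lintegral_const_mul' _ _ hC]
        congr 1
        rw [show (volume : Measure (ℝ × ℝ)) = volume.prod volume from rfl]
        exact lintegral_prod (fun p : ℝ × ℝ => ‖g p.1‖ₑ * (‖g p.2‖ₑ * kd (p.1 - p.2)))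
          (by fun_prop)
    _ ≤ C * (20 * (N85 (fun t => ‖g t‖ₑ) * N85 fun t => ‖g t‖ₑ)) := by
        gcongr
        exact hls_bilin (by fun_prop) (by fun_prop)
    _ = _ := by
        rw [mul_pow, ← ENNReal.rpow_natCast, ← ENNReal.rpow_mul]
        norm_num
        ring

lemma hKG_measurable {Ψ} (h : BM Ψ) (σ : ℝ) (x : Fin 2 → ℤ) :
    Measurable fun t => hKG Ψ (σ * t) x := by
  have hΨ := h.meas
  have hm : Measurable fun p : ℝ × (Fin 2 → ℝ) => Ψ p.2 * osc (σ * p.1) p.2 * ph x p.2 := by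
    fun_prop
  exact hm.stronglyMeasurable.integral_prod_right'.measurable

lemma hKG_l2 {Ψ} (h : BM Ψ) (t : ℝ) :
    eLpNorm (hKG Ψ t) 2 Measure.count ≤ ENNReal.ofReal (2 * π) * n2 Ψ := by
  refine (bessel (h.mul (BM.osc t))).trans (mul_le_mul_right ?_ _)
  refine eLpNorm_mono fun ξ => ?_
  rw [norm_mul, norm_osc, mul_one]

lemma hKG_bdd (Ψ) : ∃ B, ∀ t x, ‖hKG Ψ t x‖ ≤ B := by
  refine ⟨∫ ξ in cube 2, ‖Ψ ξ‖, fun t x => (norm_integral_le_integral_norm _).trans (le_of_eq ?_)⟩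
  simp [norm_ph, norm_osc]

/-- Homogeneous Strichartz estimate on the frequency side. -/
lemma exists_hKG_bound : ∃ C : ℝ≥0∞, C ≠ ∞ ∧ ∀ σ : ℝ, |σ| = 1 → ∀ Ψ, BM Ψ →
    (∀ t, eLpNorm (hKG Ψ (σ * t)) 2 Measure.count ≤ C * n2 Ψ) ∧
    ∫⁻ t, eLpNorm (hKG Ψ (σ * t)) ∞ Measure.count ^ (8/3:ℝ) ≤ (C * n2 Ψ) ^ (8/3:ℝ) := by
  obtain ⟨C, hC, hadj⟩ := exists_adj_bound
  refine ⟨max C (ENNReal.ofReal (2 * π)), (max_lt hC.lt_top ENNReal.ofReal_lt_top).ne, fun σ hσ Ψ hΨ => ⟨fun t => ?_, ?_⟩⟩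
  · exact (hKG_l2 hΨ _).trans (mul_le_mul_left (le_max_right _ _) _)
  have : ∫⁻ t, eLpNorm (hKG Ψ (σ * t)) ∞ Measure.count ^ (8/3:ℝ) ≤ (C * n2 Ψ) ^ (8/3:ℝ) := by
    obtain ⟨B, hB⟩ := hKG_bdd Ψ
    refine lintegral_sup_le_of_linearized (hKG_measurable hΨ σ) (fun t x => hB (σ * t) x) ?_
    intro x hx g hg
    have hgm := hg.meas
    have hΨm := hΨ.meas
    have hi : Integrable (Function.uncurry fun (t : ℝ) (ξ : Fin 2 → ℝ) =>
        g t * (Ψ ξ * osc (σ * t) ξ * ph (x t) ξ)) (volume.prod (volume.restrict (cube 2))) := by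
      refine (hg.integrable.mul_prod hΨ.integrable).mono ?_ (.of_forall fun p => ?_)
      · refine Measurable.aestronglyMeasurable ?_
        simp only [Function.uncurry_def]
        fun_prop
      · simp [Function.uncurry, norm_ph, norm_osc]
    have e : ∫ t, g t * hKG Ψ (σ * t) (x t) = ∫ ξ in cube 2, Ψ ξ * adj σ x g ξ := by
      simp_rw [hKG, ← integral_const_mul]
      rw [integral_integral_swap hi]
      simp_rw [adj, ← integral_const_mul]
      refine integral_congr_ae (.of_forall fun ξ => integral_congr_ae (.of_forall fun t => ?_))
      ring
    rw [e]
    calc _ ≤ n2 Ψ * n2 (adj σ x g) := enorm_integral_mul_le hΨ (bm_adj σ hx hg)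
      _ ≤ n2 Ψ * (C * N85 fun t => ‖g t‖ₑ) := by gcongr; exact hadj σ hσ x hx g hg
      _ = _ := by ring
  refine this.trans (ENNReal.rpow_le_rpow (mul_le_mul_left (le_max_left _ _) _) (by norm_num))

end

section

lemma measurable_eLpNorm_count {α : Type*} [MeasurableSpace α] {u : α → (Fin 2 → ℤ) → ℂ}
    (hu : ∀ x, Measurable fun t => u t x) (r : ℝ≥0∞) :
    Measurable fun t => eLpNorm (u t) r Measure.count := by
  rcases eq_or_ne r 0 with rfl | h0
  · simp
  rcases eq_or_ne r ∞ with rfl | ht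
  · simp_rw [eLpNorm_top_count]
    exact Measurable.iSup fun x => (hu x).enorm
  · simp_rw [eLpNorm_eq_lintegral_rpow_enorm_toReal h0 ht, lintegral_count]
    exact (Measurable.tsum fun x => (hu x).enorm.pow_const _).pow_const _

lemma tsum_mul_le_eLpNorm (v w : (Fin 2 → ℤ) → ℂ) {r r' : ℝ≥0∞} (h : 1/r + 1/r' = 1) :
    ∑' y, ‖v y‖ₑ * ‖w y‖ₑ ≤ eLpNorm v r' Measure.count * eLpNorm w r Measure.count := by
  have : ENNReal.HolderTriple r' r 1 := ⟨by simpa [add_comm] using h⟩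
  have := eLpNorm_smul_le_mul_eLpNorm (μ := Measure.count) (p := r') (q := r) (r := 1)
    (f := w) (φ := v) (measurable_of_countable _).aestronglyMeasurable
    (measurable_of_countable _).aestronglyMeasurable
  refine le_trans (le_of_eq ?_) this
  rw [eLpNorm_one_eq_lintegral_enorm, lintegral_count]
  simp [enorm_mul]

lemma lintegral_mul_le_lqNorm {q q' : ℝ≥0∞} (hq : 2 ≤ q) (h : 1/q + 1/q' = 1)
    {f g : ℝ → ℝ≥0∞} (hf : Measurable f) (hg : Measurable g) :
    ∫⁻ s, f s * g s ≤ lqNorm q' f * lqNorm q g := by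
  rcases eq_or_ne q ∞ with rfl | hqt
  · have : q' = 1 := by simpa using h
    subst this
    rw [lqNorm, lqNorm, if_neg (by norm_num), if_pos rfl]
    simp only [ENNReal.toReal_one, ENNReal.rpow_one, div_one]
    calc ∫⁻ s, f s * g s ≤ ∫⁻ s, f s * essSup g volume := by
          refine lintegral_mono_ae ?_
          filter_upwards [ENNReal.ae_le_essSup g] with s hs
          gcongr
      _ = _ := lintegral_mul_const _ hf
  · have hq0 : q ≠ 0 := by rintro rfl; simp at hq
    have hq't : q' ≠ ∞ := by
      rintro rfl
      rw [ENNReal.div_top, add_zero, ENNReal.div_eq_one_iff hq0 hqt] at h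
      rw [← h] at hq
      norm_num at hq
    have hpq : q'.toReal.HolderConjugate q.toReal := by
      have : ENNReal.HolderConjugate q' q := ⟨by simpa [add_comm] using h⟩
      have h1 : 1 < q := lt_of_lt_of_le (by norm_num) hq
      refine Real.HolderConjugate.symm ?_
      rw [Real.holderConjugate_iff]
      constructor
      · simpa using (ENNReal.toReal_lt_toReal (by norm_num) hqt).2 h1
      · have hq'0 : q' ≠ 0 := by rintro rfl; simp at h
        have := congrArg ENNReal.toReal h
        rw [ENNReal.toReal_add (by simp [hq0]) (by simp [hq'0])] at this
        simpa using this
    rw [lqNorm, lqNorm, if_neg hq't, if_neg hqt]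
    exact ENNReal.lintegral_mul_le_Lp_mul_Lq _ hpq hf.aemeasurable hg.aemeasurable

/-- Hölder's inequality for mixed norms. -/
lemma lintegral_tsum_mul_le {q q' r r' : ℝ≥0∞} (hq : 2 ≤ q) (h : 1/q + 1/q' = 1)
    (h' : 1/r + 1/r' = 1) {G W : ℝ → (Fin 2 → ℤ) → ℂ} (hG : ∀ x, Measurable fun t => G t x)
    (hW : ∀ x, Measurable fun t => W t x) :
    ∫⁻ s, ∑' y, ‖G s y‖ₑ * ‖W s y‖ₑ ≤ mixedNorm 2 q' r' G * mixedNorm 2 q r W :=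
  (lintegral_mono fun s => tsum_mul_le_eLpNorm (G s) (W s) h').trans
    (lintegral_mul_le_lqNorm hq h (measurable_eLpNorm_count hG r') (measurable_eLpNorm_count hW r))

lemma lqNorm_mono {q : ℝ≥0∞} {f g : ℝ → ℝ≥0∞} (h : ∀ t, f t ≤ g t) : lqNorm q f ≤ lqNorm q g := by
  rw [lqNorm, lqNorm]
  split_ifs
  · exact essSup_mono_ae (.of_forall h)
  · exact ENNReal.rpow_le_rpow (lintegral_mono fun t => ENNReal.rpow_le_rpow (h t) (by simp))
      (by simp)

lemma mixedNorm_mono {q r : ℝ≥0∞} {F G : ℝ → (Fin 2 → ℤ) → ℂ} (h : ∀ t x, ‖F t x‖ ≤ ‖G t x‖) :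
    mixedNorm 2 q r F ≤ mixedNorm 2 q r G :=
  lqNorm_mono fun t => eLpNorm_mono (h t)

/-- Space-time functions with both Strichartz endpoint norms bounded by `M`. -/
structure EP (u : ℝ → (Fin 2 → ℤ) → ℂ) (M : ℝ≥0∞) : Prop where
  meas : ∀ x, Measurable fun t => u t x
  two : ∀ t, eLpNorm (u t) 2 Measure.count ≤ M
  top : ∫⁻ t, eLpNorm (u t) ∞ Measure.count ^ (8/3:ℝ) ≤ M ^ (8/3:ℝ)

lemma EP.mono {u M N} (h : EP u M) (hMN : M ≤ N) : EP u N :=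
  ⟨h.meas, fun t => (h.two t).trans hMN, h.top.trans (ENNReal.rpow_le_rpow hMN (by norm_num))⟩

lemma EP.add {u v M N} (h : EP u M) (k : EP v N) : EP (fun t x => u t x + v t x) (M + N) := by
  refine ⟨fun x => (h.meas x).add (k.meas x), fun t => ?_, ?_⟩
  · refine (eLpNorm_add_le (measurable_of_countable _).aestronglyMeasurable
      (measurable_of_countable _).aestronglyMeasurable (by norm_num)).trans
      (add_le_add (h.two t) (k.two t))
  · have h1 : ∫⁻ t, eLpNorm (fun x => u t x + v t x) ∞ Measure.count ^ (8/3:ℝ) ≤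
        ∫⁻ t, (eLpNorm (u t) ∞ Measure.count + eLpNorm (v t) ∞ Measure.count) ^ (8/3:ℝ) := by
      refine lintegral_mono fun t => ENNReal.rpow_le_rpow ?_ (by norm_num)
      exact eLpNorm_add_le (measurable_of_countable _).aestronglyMeasurable
        (measurable_of_countable _).aestronglyMeasurable (by simp)
    have h2 := ENNReal.lintegral_Lp_add_le (μ := volume) (p := 8/3)
      (measurable_eLpNorm_count h.meas ∞).aemeasurable
      (measurable_eLpNorm_count k.meas ∞).aemeasurable (by norm_num)
    have root : ∀ {A B : ℝ≥0∞}, A ≤ B ^ (8/3:ℝ) → A ^ (1/(8/3:ℝ)) ≤ B := fun {A B} hAB => by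
      calc A ^ (1/(8/3:ℝ)) ≤ (B ^ (8/3:ℝ)) ^ (1/(8/3:ℝ)) := by gcongr
        _ = B := by rw [← ENNReal.rpow_mul]; norm_num
    have h3 := h2.trans (add_le_add (root h.top) (root k.top))
    refine h1.trans ?_
    calc _ = ((∫⁻ t, (eLpNorm (u t) ∞ Measure.count +
          eLpNorm (v t) ∞ Measure.count) ^ (8/3:ℝ)) ^ (1/(8/3:ℝ))) ^ (8/3:ℝ) := by
          rw [← ENNReal.rpow_mul]; norm_num
      _ ≤ _ := ENNReal.rpow_le_rpow h3 (by norm_num)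

lemma EP.const_mul {u M} (h : EP u M) (c : ℂ) : EP (fun t x => c * u t x) (‖c‖ₑ * M) := by
  refine ⟨fun x => (h.meas x).const_mul c, fun t => ?_, ?_⟩
  · have : eLpNorm (fun x => c * u t x) 2 Measure.count ≤ ‖c‖ₑ * eLpNorm (u t) 2 Measure.count :=
      eLpNorm_const_smul_le (c := c) (f := u t)
    exact this.trans (mul_le_mul_right (h.two t) _)
  · calc _ ≤ ∫⁻ t, ‖c‖ₑ ^ (8/3:ℝ) * eLpNorm (u t) ∞ Measure.count ^ (8/3:ℝ) := by
          refine lintegral_mono fun t => ?_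
          rw [← ENNReal.mul_rpow_of_nonneg _ _ (by norm_num)]
          refine ENNReal.rpow_le_rpow ?_ (by norm_num)
          exact eLpNorm_const_smul_le (c := c) (f := u t)
      _ ≤ _ := by
          rw [lintegral_const_mul' _ _ (ENNReal.rpow_ne_top_of_nonneg (by norm_num) enorm_ne_top),
            ENNReal.mul_rpow_of_nonneg _ _ (by norm_num)]
          exact mul_le_mul_right h.top _

lemma EP.mixed {u M} (h : EP u M) {q r : ℝ≥0∞} (hq : 2 ≤ q) (hr : 2 ≤ r)
    (hadm : 1/q ≤ 3/4 * (1/2 - 1/r)) : mixedNorm 2 q r u ≤ M :=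
  mixedNorm_le_of_endpoints hq hr hadm h.two h.top

lemma exists_hKG_EP : ∃ C : ℝ≥0∞, C ≠ ∞ ∧ ∀ σ : ℝ, |σ| = 1 → ∀ Ψ, BM Ψ →
    EP (fun t => hKG Ψ (σ * t)) (C * n2 Ψ) := by
  obtain ⟨C, hC, h⟩ := exists_hKG_bound
  exact ⟨C, hC, fun σ hσ Ψ hΨ => ⟨hKG_measurable hΨ σ, (h σ hσ Ψ hΨ).1, (h σ hσ Ψ hΨ).2⟩⟩

/-- Finitely supported bounded measurable forcing terms. -/
structure Nice (S : Finset (Fin 2 → ℤ)) (G : ℝ → (Fin 2 → ℤ) → ℂ) : Prop where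
  tf : ∀ y, TF fun s => G s y
  supp : ∀ s, ∀ y ∉ S, G s y = 0

lemma TF.conj {g} (h : TF g) : TF fun t => (starRingEnd ℂ) (g t) := by
  obtain ⟨B, hB⟩ := h.bdd
  obtain ⟨R, hR⟩ := h.supp
  have := h.meas
  exact ⟨by fun_prop, ⟨B, fun t => by simpa using hB t⟩, R, fun t ht => by simp [hR t ht]⟩

lemma hKG_adj_swap {Ψ} (hΨ : BM Ψ) (σ : ℝ) {x : ℝ → Fin 2 → ℤ} (hx : Measurable x) {g : ℝ → ℂ}
    (hg : TF g) :
    ∫ t, g t * hKG Ψ (σ * t) (x t) = ∫ ξ in cube 2, Ψ ξ * adj σ x g ξ := by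
  have hgm := hg.meas
  have hΨm := hΨ.meas
  have hi : Integrable (Function.uncurry fun (t : ℝ) (ξ : Fin 2 → ℝ) =>
      g t * (Ψ ξ * osc (σ * t) ξ * ph (x t) ξ)) (volume.prod (volume.restrict (cube 2))) := by
    refine (hg.integrable.mul_prod hΨ.integrable).mono ?_ (.of_forall fun p => ?_)
    · refine Measurable.aestronglyMeasurable ?_
      simp only [Function.uncurry_def]
      fun_prop
    · simp [Function.uncurry, norm_ph, norm_osc]
  simp_rw [hKG, ← integral_const_mul]
  rw [integral_integral_swap hi]
  simp_rw [adj, ← integral_const_mul]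
  refine integral_congr_ae (.of_forall fun ξ => integral_congr_ae (.of_forall fun t => ?_))
  ring

/-- The dual homogeneous estimate. -/
lemma exists_dual_bound : ∃ C : ℝ≥0∞, C ≠ ∞ ∧ ∀ {q r q' r' : ℝ≥0∞}, 2 ≤ q → 2 ≤ r →
    1/q ≤ 3/4 * (1/2 - 1/r) → 1/q + 1/q' = 1 → 1/r + 1/r' = 1 → ∀ σ : ℝ, |σ| = 1 →
    ∀ S G, Nice S G →
      n2 (fun ξ => ∑ y ∈ S, adj σ (fun _ => y) (fun s => G s y) ξ) ≤ C * mixedNorm 2 q' r' G := by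
  obtain ⟨C, hC, hEP⟩ := exists_hKG_EP
  refine ⟨C, hC, fun {q r q' r'} hq hr hadm hqq hrr σ hσ S G hG => ?_⟩
  set Φ : (Fin 2 → ℝ) → ℂ := fun ξ => ∑ y ∈ S, adj σ (fun _ => y) (fun s => G s y) ξ with hΦ
  have hadjy : ∀ y, BM (adj σ (fun _ => y) (fun s => G s y)) := fun y =>
    bm_adj σ measurable_const (hG.tf y)
  have hBM : BM Φ := BM.sum S hadjy
  have hfin := n2_lt_top hBM
  have hcn : n2 (fun ξ => (starRingEnd ℂ) (Φ ξ)) = n2 Φ :=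
    eLpNorm_congr_norm_ae (.of_forall fun ξ => by simp)
  set W := fun t => hKG (fun ξ => (starRingEnd ℂ) (Φ ξ)) (σ * t) with hW
  have hWEP : EP W (C * n2 Φ) := by
    have := hEP σ hσ _ hBM.conj
    rwa [hcn] at this
  have hGm : ∀ y, Measurable fun s => G s y := fun y => (hG.tf y).meas
  have key : n2 Φ ^ 2 ≤ mixedNorm 2 q' r' G * (C * n2 Φ) := by
    rw [n2_sq hBM]
    have e : ∫ ξ in cube 2, Φ ξ * (starRingEnd ℂ) (Φ ξ) = ∑ y ∈ S, ∫ s, G s y * W s y := by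
      simp_rw [hW, fun y => hKG_adj_swap hBM.conj σ (x := fun _ => y) measurable_const (hG.tf y)]
      rw [← integral_finsetSum _ fun y _ => (hBM.conj.mul (hadjy y)).integrable]
      refine integral_congr_ae (.of_forall fun ξ => ?_)
      simp only [← Finset.mul_sum]
      rw [mul_comm]
    rw [e]
    calc _ ≤ ∑ y ∈ S, ∫⁻ s, ‖G s y‖ₑ * ‖W s y‖ₑ := by
          refine (enorm_sum_le _ _).trans (Finset.sum_le_sum fun y _ => ?_)
          refine (enorm_integral_le_lintegral_enorm _).trans (le_of_eq ?_)
          simp_rw [enorm_mul]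
      _ = ∫⁻ s, ∑ y ∈ S, ‖G s y‖ₑ * ‖W s y‖ₑ :=
          (lintegral_finsetSum _ fun y _ => (hGm y).enorm.mul (hWEP.meas y).enorm).symm
      _ ≤ ∫⁻ s, ∑' y, ‖G s y‖ₑ * ‖W s y‖ₑ :=
          lintegral_mono fun s => ENNReal.sum_le_tsum S
      _ ≤ mixedNorm 2 q' r' G * mixedNorm 2 q r W :=
          lintegral_tsum_mul_le hq hqq hrr hGm hWEP.meas
      _ ≤ _ := mul_le_mul_right (hWEP.mixed hq hr hadm) _
  rcases eq_or_ne (n2 Φ) 0 with h0 | h0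
  · rw [h0]; exact zero_le
  refine (ENNReal.mul_le_mul_iff_left h0 hfin.ne).1 ?_
  calc n2 Φ * n2 Φ = n2 Φ ^ 2 := (sq _).symm
    _ ≤ _ := key
    _ = _ := by ring

end

section

/-- The signed indicator of the time interval between `0` and `t`. -/
def ktm (t s : ℝ) : ℂ := if 0 < s ∧ s ≤ t then 1 else if t < s ∧ s ≤ 0 then -1 else 0

lemma norm_ktm_le (t s : ℝ) : ‖ktm t s‖ ≤ 1 := by
  unfold ktm; split_ifs <;> simp

@[fun_prop]
lemma measurable_ktm {α : Type*} [MeasurableSpace α] {f g : α → ℝ} (hf : Measurable f)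
    (hg : Measurable g) : Measurable fun a => ktm (f a) (g a) := by
  unfold ktm
  refine Measurable.ite ?_ measurable_const (Measurable.ite ?_ measurable_const measurable_const)
  · exact (measurableSet_lt measurable_const hg).inter (measurableSet_le hg hf)
  · exact (measurableSet_lt hf hg).inter (measurableSet_le hg measurable_const)

lemma intervalIntegral_eq_ktm (t : ℝ) (f : ℝ → ℂ) :
    ∫ s in (0:ℝ)..t, f s = ∫ s, ktm t s * f s := by
  rcases le_total 0 t with h | h
  · rw [intervalIntegral.integral_of_le h, ← integral_indicator measurableSet_Ioc]
    refine integral_congr_ae (.of_forall fun s => ?_)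
    simp only [Set.indicator_apply, Set.mem_Ioc, ktm]
    split_ifs with h1 h2
    · simp
    · linarith [h2.1, h2.2]
    · simp
  · rw [intervalIntegral.integral_of_ge h, ← integral_indicator measurableSet_Ioc, ← integral_neg]
    refine integral_congr_ae (.of_forall fun s => ?_)
    simp only [Set.indicator_apply, Set.mem_Ioc, ktm]
    split_ifs with h1 h2 h2
    · linarith [h1.1, h2.1, h2.2]
    · simp
    · linarith [h2.1, h2.2]
    · simp

/-- The reciprocal of the dispersion relation. -/
def winv (ξ : Fin 2 → ℝ) : ℂ := ((omegaKG 2 ξ : ℝ) : ℂ)⁻¹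

lemma bm_winv : BM winv := BM.inv_omega

lemma norm_winv_le (ξ) : ‖winv ξ‖ ≤ 1 := by
  have := one_le_omegaKG ξ
  rw [winv, norm_inv, Complex.norm_real, norm_of_nonneg (by linarith)]
  exact inv_le_one_of_one_le₀ this

lemma n2_winv_mul_le (Ψ) : n2 (fun ξ => winv ξ * Ψ ξ) ≤ n2 Ψ :=
  eLpNorm_mono fun ξ => by
    rw [norm_mul]
    exact mul_le_of_le_one_left (norm_nonneg _) (norm_winv_le ξ)

lemma exists_dispersive_winv : ∃ C : ℝ≥0∞, C ≠ ∞ ∧ ∀ (x : Fin 2 → ℤ) (τ : ℝ),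
    ‖hKG winv τ x‖ₑ ≤ C * kd τ := by
  obtain ⟨C, hC, h⟩ := dispersive_bound (a := fun p => (wKG p)⁻¹)
    ((contDiff_wKG.inv fun p => (wKG_pos p).ne').of_le le_top) (by simp [wKG]) (by simp [wKG])
  refine ⟨ENNReal.ofReal C, ENNReal.ofReal_ne_top, fun x τ => ?_⟩
  rw [kd, ← ENNReal.ofReal_mul hC.le, ← ofReal_norm]
  refine ENNReal.ofReal_le_ofReal (le_trans (le_of_eq ?_) (h x τ))
  unfold hKG
  congr 2
  ext ξ
  rw [add_comm, cis_add, winv, omegaKG_eq_wKG]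
  simp [ph, osc, omegaKG_eq_wKG, mul_assoc]

lemma measurable_hKG_comp {Ψ : (Fin 2 → ℝ) → ℂ} {α : Type*} [MeasurableSpace α] {τ : α → ℝ}
    {z : α → Fin 2 → ℤ} (h : BM Ψ) (hτ : Measurable τ) (hz : Measurable z) :
    Measurable fun a => hKG Ψ (τ a) (z a) := by
  have : Measurable fun p : ℝ × (Fin 2 → ℤ) => hKG Ψ p.1 p.2 := by
    refine measurable_from_prod_countable_left (f := fun p : ℝ × (Fin 2 → ℤ) => hKG Ψ p.1 p.2)
      fun x => ?_
    have h1 := hKG_measurable h 1 x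
    simp only [one_mul] at h1
    exact h1
  have h1 : Measurable fun a => (τ a, z a) := hτ.prodMk hz
  have h2 := this.comp h1
  unfold Function.comp at h2
  dsimp only at h2
  exact h2

lemma hKG_shift (Ψ) (τ s : ℝ) (x y : Fin 2 → ℤ) :
    hKG Ψ (τ + s) (x + y) = hKG (fun ξ => Ψ ξ * (osc τ ξ * ph x ξ)) s y := by
  unfold hKG
  refine integral_congr_ae (.of_forall fun ξ => ?_)
  simp only [osc_add, ph_add]; ring

lemma conj_hKG (Ψ) (τ : ℝ) (x : Fin 2 → ℤ) :
    (starRingEnd ℂ) (hKG Ψ τ x) = hKG (fun ξ => (starRingEnd ℂ) (Ψ ξ)) (-τ) (-x) := by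
  unfold hKG
  rw [← integral_conj]
  simp only [map_mul, conj_osc, conj_ph]

lemma conj_adj (σ : ℝ) (x : ℝ → Fin 2 → ℤ) (g : ℝ → ℂ) (ξ) :
    (starRingEnd ℂ) (adj σ x g ξ) =
      adj (-σ) (fun t => -x t) (fun t => (starRingEnd ℂ) (g t)) ξ := by
  unfold adj
  rw [← integral_conj]
  simp only [map_mul, conj_osc, conj_ph, neg_mul]

/-- Half of the Duhamel integral, up to constants. -/
def dKG (σ : ℝ) (S : Finset (Fin 2 → ℤ)) (G : ℝ → (Fin 2 → ℤ) → ℂ) (t : ℝ) (x : Fin 2 → ℤ) : ℂ :=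
  ∑ y ∈ S, ∫ s, (ktm t s * G s y) * hKG winv (σ * (t - s)) (x - y)

lemma TF.ktm_mul {g} (h : TF g) (t : ℝ) : TF fun s => ktm t s * g s :=
  h.mul_bdd (by fun_prop) (norm_ktm_le t)

lemma TF.ktm_mul' {g} (h : TF g) (s : ℝ) : TF fun t => ktm t s * g t :=
  h.mul_bdd (by fun_prop) (fun t => norm_ktm_le t s)

lemma dKG_eq {σ : ℝ} {S G} (hG : Nice S G) (t : ℝ) (x : Fin 2 → ℤ) :
    dKG σ S G t x = hKG (fun ξ => winv ξ * (starRingEnd ℂ) (∑ y ∈ S,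
      adj σ (fun _ => y) (fun s => (starRingEnd ℂ) (ktm t s * G s y)) ξ)) (σ * t) x := by
  have hΨ : BM fun ξ => winv ξ * (osc (σ * t) ξ * ph x ξ) :=
    bm_winv.mul ((BM.osc _).mul (BM.ph _))
  have e : ∀ y s, hKG winv (σ * (t - s)) (x - y) =
      hKG (fun ξ => winv ξ * (osc (σ * t) ξ * ph x ξ)) (-σ * s) (-y) := fun y s => by
    rw [← hKG_shift]
    congr 1; ring
  unfold dKG
  simp_rw [e]
  simp_rw [fun y => hKG_adj_swap hΨ (-σ) (x := fun _ => -y) measurable_const ((hG.tf y).ktm_mul t)]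
  rw [← integral_finsetSum _ fun y _ =>
    (hΨ.mul (bm_adj (-σ) measurable_const ((hG.tf y).ktm_mul t))).integrable]
  unfold hKG
  refine integral_congr_ae (.of_forall fun ξ => ?_)
  simp only [map_sum, conj_adj, Complex.conj_conj, Finset.mul_sum, Finset.sum_mul]
  refine Finset.sum_congr rfl fun y _ => ?_
  ring

lemma dKG_measurable {σ : ℝ} {S G} (hG : Nice S G) (x : Fin 2 → ℤ) :
    Measurable fun t => dKG σ S G t x := by
  unfold dKG
  refine Finset.measurable_sum _ fun y _ => ?_
  have := (hG.tf y).meas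
  have hm : Measurable fun p : ℝ × ℝ =>
      (ktm p.1 p.2 * G p.2 y) * hKG winv (σ * (p.1 - p.2)) (x - y) := by
    refine Measurable.mul (by fun_prop)
      (measurable_hKG_comp bm_winv (by fun_prop) measurable_const)
  exact hm.stronglyMeasurable.integral_prod_right'.measurable

lemma dKG_bdd {σ : ℝ} {S G} (hG : Nice S G) : ∃ B, ∀ t x, ‖dKG σ S G t x‖ ≤ B := by
  obtain ⟨B, hB⟩ := hKG_bdd winv
  refine ⟨∑ y ∈ S, ∫ s, ‖G s y‖ * B, fun t x => ?_⟩
  refine (norm_sum_le _ _).trans (Finset.sum_le_sum fun y _ => ?_)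
  refine norm_integral_le_of_norm_le ((hG.tf y).integrable.norm.mul_const _)
    (.of_forall fun s => ?_)
  rw [norm_mul, norm_mul]
  have h1 := norm_ktm_le t s
  have h2 := hB (σ * (t - s)) (x - y)
  have : ‖ktm t s‖ * ‖G s y‖ ≤ ‖G s y‖ := mul_le_of_le_one_left (norm_nonneg _) h1
  exact mul_le_mul this h2 (norm_nonneg _) (norm_nonneg _)

/-- The adjoint of `dKG` along a space-time curve. -/
def vKG (σ : ℝ) (x : ℝ → Fin 2 → ℤ) (g : ℝ → ℂ) (s : ℝ) (y : Fin 2 → ℤ) : ℂ :=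
  ∫ t, (ktm t s * g t) * hKG winv (σ * (t - s)) (x t - y)

lemma vKG_eq (σ : ℝ) {x : ℝ → Fin 2 → ℤ} (hx : Measurable x) {g} (hg : TF g) (s : ℝ)
    (y : Fin 2 → ℤ) :
    vKG σ x g s y = hKG (fun ξ => winv ξ * adj σ x (fun t => ktm t s * g t) ξ) (-(σ * s)) (-y) := by
  have hΨ : BM fun ξ => winv ξ * (osc (-(σ * s)) ξ * ph (-y) ξ) :=
    bm_winv.mul ((BM.osc _).mul (BM.ph _))
  have e : ∀ t, hKG winv (σ * (t - s)) (x t - y) =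
      hKG (fun ξ => winv ξ * (osc (-(σ * s)) ξ * ph (-y) ξ)) (σ * t) (x t) := fun t => by
    rw [← hKG_shift]
    congr 1 <;> [ring; abel]
  unfold vKG
  simp_rw [e]
  rw [hKG_adj_swap hΨ σ hx (hg.ktm_mul' s)]
  unfold hKG
  refine integral_congr_ae (.of_forall fun ξ => ?_)
  ring

lemma vKG_measurable (σ : ℝ) {x : ℝ → Fin 2 → ℤ} (hx : Measurable x) {g} (hg : TF g)
    (y : Fin 2 → ℤ) : Measurable fun s => vKG σ x g s y := by
  have := hg.meas
  have hm : Measurable fun p : ℝ × ℝ =>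
      (ktm p.2 p.1 * g p.2) * hKG winv (σ * (p.2 - p.1)) (x p.2 - y) := by
    refine Measurable.mul (by fun_prop) (measurable_hKG_comp bm_winv (by fun_prop) ?_)
    exact (measurable_of_countable (fun z : Fin 2 → ℤ => z - y)).comp (hx.comp measurable_snd)
  exact hm.stronglyMeasurable.integral_prod_right'.measurable

lemma abs_one_kd {σ : ℝ} (hσ : |σ| = 1) (τ : ℝ) : kd (σ * τ) = kd τ := by
  rcases (abs_eq (by norm_num)).1 hσ with h | h
  · rw [h, one_mul]
  · rw [h, neg_one_mul, kd_neg]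

lemma N85_mono {f g : ℝ → ℝ≥0∞} (h : ∀ t, f t ≤ g t) : N85 f ≤ N85 g := by
  unfold N85
  gcongr with t
  exact h t

lemma exists_vKG_EP : ∃ C : ℝ≥0∞, C ≠ ∞ ∧ ∀ σ : ℝ, |σ| = 1 → ∀ x : ℝ → Fin 2 → ℤ,
    Measurable x → ∀ g, TF g → EP (vKG σ x g) (C * N85 fun t => ‖g t‖ₑ) := by
  obtain ⟨C, hC, hadj⟩ := exists_adj_bound
  obtain ⟨K, hK, hdisp⟩ := exists_dispersive_winv
  refine ⟨ENNReal.ofReal (2 * π) * C + K * 20, ENNReal.add_ne_top.2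
    ⟨ENNReal.mul_ne_top ENNReal.ofReal_ne_top hC, ENNReal.mul_ne_top hK (by norm_num)⟩,
    fun σ hσ x hx g hg => ⟨vKG_measurable σ hx hg, fun s => ?_, ?_⟩⟩
  · have hbm := bm_winv.mul (bm_adj σ hx (hg.ktm_mul' s))
    have h1 : eLpNorm (vKG σ x g s) 2 Measure.count = eLpNorm (hKG (fun ξ => (starRingEnd ℂ)
        (winv ξ * adj σ x (fun t => ktm t s * g t) ξ)) (σ * s)) 2 Measure.count := by
      refine eLpNorm_congr_norm_ae (.of_forall fun y => ?_)
      rw [vKG_eq σ hx hg, ← RCLike.norm_conj, conj_hKG, neg_neg, neg_neg]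
    rw [h1]
    refine (hKG_l2 hbm.conj _).trans ?_
    have h2 : n2 (fun ξ => (starRingEnd ℂ) (winv ξ * adj σ x (fun t => ktm t s * g t) ξ)) =
        n2 fun ξ => winv ξ * adj σ x (fun t => ktm t s * g t) ξ :=
      eLpNorm_congr_norm_ae (.of_forall fun ξ => RCLike.norm_conj _)
    rw [h2]
    calc _ ≤ ENNReal.ofReal (2 * π) * (C * N85 fun t => ‖ktm t s * g t‖ₑ) := by
          gcongr
          exact (n2_winv_mul_le _).trans (hadj σ hσ x hx _ (hg.ktm_mul' s))
      _ ≤ ENNReal.ofReal (2 * π) * (C * N85 fun t => ‖g t‖ₑ) := by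
          gcongr
          refine N85_mono fun t => ?_
          rw [enorm_le_iff_norm_le, norm_mul]
          exact mul_le_of_le_one_left (norm_nonneg _) (norm_ktm_le t s)
      _ ≤ _ := by
          rw [← mul_assoc]
          exact mul_le_mul_left le_self_add _
  · have hgm := hg.meas
    have h1 : ∀ s, eLpNorm (vKG σ x g s) ∞ Measure.count ≤
        K * ∫⁻ t, ‖g t‖ₑ * kd (s - t) := fun s => by
      rw [eLpNorm_top_count]
      refine iSup_le fun y => (enorm_integral_le_lintegral_enorm _).trans ?_
      rw [← lintegral_const_mul' _ _ hK]
      refine lintegral_mono fun t => ?_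
      rw [enorm_mul]
      calc _ ≤ ‖g t‖ₑ * (K * kd (σ * (t - s))) := by
            gcongr
            · rw [enorm_le_iff_norm_le, norm_mul]
              exact mul_le_of_le_one_left (norm_nonneg _) (norm_ktm_le t s)
            · exact hdisp _ _
        _ = _ := by
            rw [abs_one_kd hσ, ← kd_neg, neg_sub]; ring
    have h2 := hls_potential (g := fun t => ‖g t‖ₑ) (by fun_prop)
    have h3 : ∫⁻ s, (∫⁻ t, ‖g t‖ₑ * kd (s - t)) ^ (8/3:ℝ) ≤
        (20 * N85 fun t => ‖g t‖ₑ) ^ (8/3:ℝ) := by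
      have := ENNReal.rpow_le_rpow h2 (z := 8/3) (by norm_num)
      rw [← ENNReal.rpow_mul] at this
      norm_num at this ⊢
      exact this
    calc _ ≤ ∫⁻ s, K ^ (8/3:ℝ) * (∫⁻ t, ‖g t‖ₑ * kd (s - t)) ^ (8/3:ℝ) := by
          refine lintegral_mono fun s => ?_
          rw [← ENNReal.mul_rpow_of_nonneg _ _ (by norm_num)]
          exact ENNReal.rpow_le_rpow (h1 s) (by norm_num)
      _ ≤ K ^ (8/3:ℝ) * (20 * N85 fun t => ‖g t‖ₑ) ^ (8/3:ℝ) := by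
          rw [lintegral_const_mul' _ _ (ENNReal.rpow_ne_top_of_nonneg (by norm_num) hK)]
          gcongr
      _ ≤ _ := by
          rw [← ENNReal.mul_rpow_of_nonneg _ _ (by norm_num)]
          refine ENNReal.rpow_le_rpow ?_ (by norm_num)
          rw [← mul_assoc]
          exact mul_le_mul_left le_add_self _

lemma dKG_swap (σ : ℝ) {S G} (hG : Nice S G) {x : ℝ → Fin 2 → ℤ} (hx : Measurable x) {g}
    (hg : TF g) :
    ∫ t, g t * dKG σ S G t (x t) = ∑ y ∈ S, ∫ s, G s y * vKG σ x g s y := by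
  obtain ⟨B, hB⟩ := hKG_bdd winv
  have hgm := hg.meas
  have hi : ∀ y, Integrable (Function.uncurry fun t s : ℝ =>
      g t * ((ktm t s * G s y) * hKG winv (σ * (t - s)) (x t - y))) (volume.prod volume) := by
    intro y
    have hGm := (hG.tf y).meas
    refine ((hg.integrable.mul_prod (hG.tf y).integrable).mul_const (B : ℂ)).mono ?_
      (.of_forall fun p => ?_)
    · refine Measurable.aestronglyMeasurable ?_
      simp only [Function.uncurry_def]
      refine Measurable.mul (by fun_prop) (Measurable.mul (by fun_prop)
        (measurable_hKG_comp bm_winv (by fun_prop) ?_))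
      exact (measurable_of_countable (fun z : Fin 2 → ℤ => z - y)).comp (hx.comp measurable_fst)
    · simp only [Function.uncurry, norm_mul, mul_assoc]
      have h1 := norm_ktm_le p.1 p.2
      have h2 := (hB (σ * (p.1 - p.2)) (x p.1 - y)).trans (le_abs_self B)
      have h3 : ‖(B:ℂ)‖ = |B| := by simp
      rw [h3]
      refine mul_le_mul_of_nonneg_left ?_ (norm_nonneg _)
      refine (mul_le_of_le_one_left (by positivity) h1).trans ?_
      exact mul_le_mul_of_nonneg_left h2 (norm_nonneg _)
  unfold dKG
  simp_rw [Finset.mul_sum, ← integral_const_mul]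
  have hi' : ∀ y, Integrable fun t : ℝ => ∫ s : ℝ,
      g t * ((ktm t s * G s y) * hKG winv (σ * (t - s)) (x t - y)) :=
    fun y => (hi y).integral_prod_left
  rw [integral_finsetSum _ fun y _ => hi' y]
  refine Finset.sum_congr rfl fun y _ => ?_
  rw [integral_integral_swap (hi y)]
  refine integral_congr_ae (.of_forall fun s => ?_)
  simp only [vKG, ← integral_const_mul]
  refine integral_congr_ae (.of_forall fun t => ?_)
  simp only
  ring

/-- The inhomogeneous Strichartz estimate at the endpoints, for nice forcing terms. -/
lemma exists_dKG_EP : ∃ C : ℝ≥0∞, C ≠ ∞ ∧ ∀ {q r q' r' : ℝ≥0∞}, 2 ≤ q → 2 ≤ r →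
    1/q ≤ 3/4 * (1/2 - 1/r) → 1/q + 1/q' = 1 → 1/r + 1/r' = 1 → ∀ σ : ℝ, |σ| = 1 →
    ∀ S G, Nice S G → EP (dKG σ S G) (C * mixedNorm 2 q' r' G) := by
  obtain ⟨C, hC, hdual⟩ := exists_dual_bound
  obtain ⟨K, hK, hV⟩ := exists_vKG_EP
  refine ⟨ENNReal.ofReal (2 * π) * C + K, ENNReal.add_ne_top.2
    ⟨ENNReal.mul_ne_top ENNReal.ofReal_ne_top hC, hK⟩,
    fun {q r q' r'} hq hr hadm hqq hrr σ hσ S G hG => ⟨dKG_measurable hG, fun t => ?_, ?_⟩⟩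
  · have hN : Nice S fun s y => (starRingEnd ℂ) (ktm t s * G s y) :=
      ⟨fun y => ((hG.tf y).ktm_mul t).conj, fun s y hy => by simp [hG.supp s y hy]⟩
    set Φ : (Fin 2 → ℝ) → ℂ := fun ξ => ∑ y ∈ S,
      adj σ (fun _ => y) (fun s => (starRingEnd ℂ) (ktm t s * G s y)) ξ with hΦ
    have hΦB : BM Φ := BM.sum S fun y => bm_adj σ measurable_const (hN.tf y)
    have e : dKG σ S G t = hKG (fun ξ => winv ξ * (starRingEnd ℂ) (Φ ξ)) (σ * t) :=
      funext fun x => dKG_eq hG t x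
    rw [e]
    have hcn : n2 (fun ξ => (starRingEnd ℂ) (Φ ξ)) = n2 Φ :=
      eLpNorm_congr_norm_ae (.of_forall fun ξ => RCLike.norm_conj _)
    calc _ ≤ ENNReal.ofReal (2 * π) * n2 (fun ξ => winv ξ * (starRingEnd ℂ) (Φ ξ)) :=
          hKG_l2 (bm_winv.mul hΦB.conj) _
      _ ≤ ENNReal.ofReal (2 * π) * n2 Φ := by
          rw [← hcn]
          gcongr
          exact n2_winv_mul_le _
      _ ≤ ENNReal.ofReal (2 * π) * (C * mixedNorm 2 q' r' G) := by
          gcongr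
          refine (hdual hq hr hadm hqq hrr σ hσ S _ hN).trans ?_
          gcongr
          refine mixedNorm_mono fun s y => ?_
          rw [RCLike.norm_conj, norm_mul]
          exact mul_le_of_le_one_left (norm_nonneg _) (norm_ktm_le t s)
      _ ≤ _ := by
          rw [← mul_assoc]
          exact mul_le_mul_left le_self_add _
  · obtain ⟨B, hB⟩ := dKG_bdd (σ := σ) hG
    refine (lintegral_sup_le_of_linearized (K := K * mixedNorm 2 q' r' G) (dKG_measurable hG) hB
      ?_).trans (ENNReal.rpow_le_rpow (mul_le_mul_left le_add_self _) (by norm_num))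
    intro x hx g hg
    have hVx := hV σ hσ x hx g hg
    rw [dKG_swap σ hG hx hg]
    calc _ ≤ ∑ y ∈ S, ∫⁻ s, ‖G s y‖ₑ * ‖vKG σ x g s y‖ₑ := by
          refine (enorm_sum_le _ _).trans (Finset.sum_le_sum fun y _ => ?_)
          refine (enorm_integral_le_lintegral_enorm _).trans (le_of_eq ?_)
          simp_rw [enorm_mul]
      _ = ∫⁻ s, ∑ y ∈ S, ‖G s y‖ₑ * ‖vKG σ x g s y‖ₑ :=
          (lintegral_finsetSum _ fun y _ => ((hG.tf y).meas).enorm.mul (hVx.meas y).enorm).symm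
      _ ≤ ∫⁻ s, ∑' y, ‖G s y‖ₑ * ‖vKG σ x g s y‖ₑ :=
          lintegral_mono fun s => ENNReal.sum_le_tsum S
      _ ≤ mixedNorm 2 q' r' G * mixedNorm 2 q r (vKG σ x g) :=
          lintegral_tsum_mul_le hq hqq hrr (fun y => (hG.tf y).meas) hVx.meas
      _ ≤ mixedNorm 2 q' r' G * (K * N85 fun t => ‖g t‖ₑ) :=
          mul_le_mul_right (hVx.mixed hq hr hadm) _
      _ = _ := by ring

end

section

/-- The normalization of the inverse Fourier transform. -/
def c0 : ℂ := ((((2 * π) ^ 2)⁻¹ : ℝ) : ℂ)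

lemma multKernel_eq (m : (Fin 2 → ℝ) → ℝ) (x : Fin 2 → ℤ) :
    multKernel 2 m x = c0 * ∫ ξ in cube 2, ((m ξ : ℝ) : ℂ) * ph x ξ := by
  unfold multKernel c0
  congr 1
  refine integral_congr_ae (.of_forall fun ξ => ?_)
  simp only [ph, cis]
  ring

lemma enorm_c0 : ‖c0‖ₑ * (ENNReal.ofReal (2 * π) * ENNReal.ofReal (2 * π)) = 1 := by
  have hp := pi_pos
  rw [c0, ← ofReal_norm, Complex.norm_real, norm_of_nonneg (by positivity),
    ← ENNReal.ofReal_mul (by positivity), ← ENNReal.ofReal_mul (by positivity)]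
  rw [← sq, inv_mul_cancel₀ (by positivity), ENNReal.ofReal_one]

lemma n2_one : n2 (fun _ => 1) = ENNReal.ofReal (2 * π) := by
  have := n2_sq_trig {0} fun _ => 1
  simp only [Finset.sum_singleton, ph_zero, mul_one, enorm_one, one_pow] at this
  exact (ENNReal.pow_right_strictMono two_ne_zero).injective this

lemma bm_ofReal {m : (Fin 2 → ℝ) → ℝ} {B : ℝ} (hm : Measurable m) (hB : ∀ ξ, |m ξ| ≤ B) :
    BM fun ξ => ((m ξ : ℝ) : ℂ) :=
  ⟨by fun_prop, B, fun ξ => by rw [Complex.norm_real]; exact hB ξ⟩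

lemma l2_multKernel {m : (Fin 2 → ℝ) → ℝ} {B : ℝ} (hm : Measurable m) (hB : ∀ ξ, |m ξ| ≤ B) :
    eLpNorm (multKernel 2 m) 2 Measure.count ≤ ENNReal.ofReal B := by
  have e : multKernel 2 m = c0 • fun x => ∫ ξ in cube 2, ((m ξ : ℝ) : ℂ) * ph x ξ :=
    funext fun x => multKernel_eq m x
  have h1 : n2 (fun ξ => ((m ξ : ℝ) : ℂ)) ≤ ENNReal.ofReal B * ENNReal.ofReal (2 * π) := by
    rw [← n2_one]
    refine eLpNorm_le_mul_eLpNorm_of_ae_le_mul (.of_forall fun ξ => ?_) 2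
    rw [Complex.norm_real, norm_one, mul_one]
    exact hB ξ
  rw [e]
  calc _ ≤ ‖c0‖ₑ * (ENNReal.ofReal (2 * π) * (ENNReal.ofReal B * ENNReal.ofReal (2 * π))) :=
        eLpNorm_const_smul_le.trans (mul_le_mul_right
          ((bessel (bm_ofReal hm hB)).trans (mul_le_mul_right h1 _)) _)
    _ = (‖c0‖ₑ * (ENNReal.ofReal (2 * π) * ENNReal.ofReal (2 * π))) * ENNReal.ofReal B := by ring
    _ = _ := by rw [enorm_c0, one_mul]

/-- The Fourier multiplier operator with symbol `m`. -/
def cv (m : (Fin 2 → ℝ) → ℝ) (v : (Fin 2 → ℤ) → ℂ) (x : Fin 2 → ℤ) : ℂ :=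
  ∑' y, multKernel 2 m (x - y) * v y

lemma tsum_cv_le {m : (Fin 2 → ℝ) → ℝ} {B : ℝ} (hm : Measurable m) (hB : ∀ ξ, |m ξ| ≤ B)
    (v : (Fin 2 → ℤ) → ℂ) (x : Fin 2 → ℤ) :
    ∑' y, ‖multKernel 2 m (x - y) * v y‖ₑ ≤ ENNReal.ofReal B * eLpNorm v 2 Measure.count := by
  have h1 : eLpNorm (fun y => multKernel 2 m (x - y)) 2 Measure.count =
      eLpNorm (multKernel 2 m) 2 Measure.count := by
    refine (ENNReal.pow_right_strictMono two_ne_zero).injective ?_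
    show _ ^ 2 = _ ^ 2
    rw [eLpNorm_two_sq, eLpNorm_two_sq, lintegral_count, lintegral_count]
    exact (Equiv.subLeft x).tsum_eq fun z => ‖multKernel 2 m z‖ₑ ^ 2
  simp_rw [enorm_mul]
  refine (tsum_mul_le_eLpNorm (fun y => multKernel 2 m (x - y)) v (r := 2) (r' := 2) ?_).trans ?_
  · rw [one_div]; exact ENNReal.inv_two_add_inv_two
  · rw [h1]; exact mul_le_mul_left (l2_multKernel hm hB) _

lemma cv_summable {m : (Fin 2 → ℝ) → ℝ} {B : ℝ} (hm : Measurable m) (hB : ∀ ξ, |m ξ| ≤ B)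
    {v : (Fin 2 → ℤ) → ℂ} (hv : eLpNorm v 2 Measure.count ≠ ∞) (x : Fin 2 → ℤ) :
    Summable fun y => multKernel 2 m (x - y) * v y := by
  have := ENNReal.summable_toReal (ne_top_of_le_ne_top
    (ENNReal.mul_ne_top ENNReal.ofReal_ne_top hv) (tsum_cv_le hm hB v x))
  simp only [toReal_enorm] at this
  exact this.of_norm

lemma enorm_cv_le {m : (Fin 2 → ℝ) → ℝ} {B : ℝ} (hm : Measurable m) (hB : ∀ ξ, |m ξ| ≤ B)
    (v : (Fin 2 → ℤ) → ℂ) (x : Fin 2 → ℤ) :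
    ‖cv m v x‖ₑ ≤ ENNReal.ofReal B * eLpNorm v 2 Measure.count :=
  (enorm_tsum_le_tsum_enorm).trans (tsum_cv_le hm hB v x)

lemma cv_sub_right {m : (Fin 2 → ℝ) → ℝ} {B : ℝ} (hm : Measurable m) (hB : ∀ ξ, |m ξ| ≤ B)
    {v w : (Fin 2 → ℤ) → ℂ} (hv : eLpNorm v 2 Measure.count ≠ ∞)
    (hw : eLpNorm w 2 Measure.count ≠ ∞) (x : Fin 2 → ℤ) :
    cv m (fun y => v y - w y) x = cv m v x - cv m w x := by
  unfold cv
  rw [← (cv_summable hm hB hv x).tsum_sub (cv_summable hm hB hw x)]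
  simp only [mul_sub]

lemma cv_sub_left {m n : (Fin 2 → ℝ) → ℝ} {B : ℝ} (hm : Measurable m) (hB : ∀ ξ, |m ξ| ≤ B)
    (hn : Measurable n) (hB' : ∀ ξ, |n ξ| ≤ B)
    {v : (Fin 2 → ℤ) → ℂ} (hv : eLpNorm v 2 Measure.count ≠ ∞) (x : Fin 2 → ℤ) :
    cv (fun ξ => m ξ - n ξ) v x = cv m v x - cv n v x := by
  unfold cv
  rw [← (cv_summable hm hB hv x).tsum_sub (cv_summable hn hB' hv x)]
  refine tsum_congr fun y => ?_
  rw [← sub_mul, multKernel_eq, multKernel_eq, multKernel_eq, ← mul_sub,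
    ← integral_sub ((bm_ofReal hm hB).mul (BM.ph _)).integrable
      ((bm_ofReal hn hB').mul (BM.ph _)).integrable]
  simp only [Complex.ofReal_sub, sub_mul]

/-- The symbol of the sine propagator. -/
def msin (τ : ℝ) (ξ : Fin 2 → ℝ) : ℝ := sin (τ * omegaKG 2 ξ) / omegaKG 2 ξ

/-- The symbol of the cosine propagator. -/
def mcos (τ : ℝ) (ξ : Fin 2 → ℝ) : ℝ := cos (τ * omegaKG 2 ξ)

lemma sinProp_eq (τ v) : sinProp 2 τ v = cv (msin τ) v := rfl
lemma cosProp_eq (τ v) : cosProp 2 τ v = cv (mcos τ) v := rfl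

lemma measurable_msin (τ) : Measurable (msin τ) := by unfold msin; fun_prop
lemma measurable_mcos (τ) : Measurable (mcos τ) := by unfold mcos; fun_prop

lemma abs_msin_sub_le (τ τ') (ξ) : |msin τ ξ - msin τ' ξ| ≤ |τ - τ'| := by
  have h := one_le_omegaKG ξ
  rw [msin, msin, ← sub_div, abs_div, abs_of_pos (by linarith : 0 < omegaKG 2 ξ),
    div_le_iff₀ (by linarith)]
  calc _ ≤ |τ * omegaKG 2 ξ - τ' * omegaKG 2 ξ| := abs_sin_sub_sin_le _ _
    _ = _ := by rw [← sub_mul, abs_mul, abs_of_pos (by linarith : 0 < omegaKG 2 ξ)]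

lemma abs_msin_le (τ) (ξ) : |msin τ ξ| ≤ 1 := by
  have h := one_le_omegaKG ξ
  rw [msin, abs_div, abs_of_pos (by linarith : 0 < omegaKG 2 ξ), div_le_one (by linarith)]
  exact (abs_sin_le_one _).trans h

lemma abs_mcos_le (τ) (ξ) : |mcos τ ξ| ≤ 1 := abs_cos_le_one _

lemma enorm_sinProp_le (τ v x) : ‖sinProp 2 τ v x‖ₑ ≤ eLpNorm v 2 Measure.count := by
  simpa [sinProp_eq] using enorm_cv_le (measurable_msin τ) (abs_msin_le τ) v x

lemma sinProp_sub (τ : ℝ) {v w : (Fin 2 → ℤ) → ℂ} (hv : eLpNorm v 2 Measure.count ≠ ∞)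
    (hw : eLpNorm w 2 Measure.count ≠ ∞) (x : Fin 2 → ℤ) :
    sinProp 2 τ (fun y => v y - w y) x = sinProp 2 τ v x - sinProp 2 τ w x :=
  cv_sub_right (measurable_msin τ) (abs_msin_le τ) hv hw x

lemma cosProp_sub (τ : ℝ) {v w : (Fin 2 → ℤ) → ℂ} (hv : eLpNorm v 2 Measure.count ≠ ∞)
    (hw : eLpNorm w 2 Measure.count ≠ ∞) (x : Fin 2 → ℤ) :
    cosProp 2 τ (fun y => v y - w y) x = cosProp 2 τ v x - cosProp 2 τ w x :=
  cv_sub_right (measurable_mcos τ) (abs_mcos_le τ) hv hw x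

lemma enorm_cosProp_le (τ v x) : ‖cosProp 2 τ v x‖ₑ ≤ eLpNorm v 2 Measure.count := by
  simpa [cosProp_eq] using enorm_cv_le (measurable_mcos τ) (abs_mcos_le τ) v x

lemma enorm_sinProp_time_le (τ τ' : ℝ) {v : (Fin 2 → ℤ) → ℂ}
    (hv : eLpNorm v 2 Measure.count ≠ ∞) (x : Fin 2 → ℤ) :
    ‖sinProp 2 τ v x - sinProp 2 τ' v x‖ₑ ≤
      ENNReal.ofReal |τ - τ'| * eLpNorm v 2 Measure.count := by
  have h := enorm_cv_le ((measurable_msin τ).sub (measurable_msin τ'))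
    (fun ξ => abs_msin_sub_le τ τ' ξ) v x
  have e := cv_sub_left (measurable_msin τ) (abs_msin_le τ) (measurable_msin τ')
    (abs_msin_le τ') hv x
  rw [sinProp_eq, sinProp_eq, ← e]
  exact h

lemma mcos_eq (τ ξ) : ((mcos τ ξ : ℝ) : ℂ) = (osc τ ξ + osc (-τ) ξ) / 2 := by
  simp only [mcos, osc, cis]
  push_cast
  rw [Complex.cos]
  congr 2 <;> congr 1 <;> ring

lemma msin_eq (τ ξ) : ((msin τ ξ : ℝ) : ℂ) =
    winv ξ * ((osc τ ξ - osc (-τ) ξ) / (2 * Complex.I)) := by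
  simp only [msin, osc, cis, winv]
  push_cast
  rw [Complex.sin, div_eq_inv_mul]
  congr 1
  rw [eq_div_iff (by simp)]
  have e1 : Complex.I * (↑τ * ↑(omegaKG 2 ξ)) = ↑τ * ↑(omegaKG 2 ξ) * Complex.I := by ring
  have e2 : Complex.I * (-↑τ * ↑(omegaKG 2 ξ)) = -(↑τ * ↑(omegaKG 2 ξ)) * Complex.I := by ring
  rw [e1, e2]
  linear_combination (Complex.exp (-(↑τ * ↑(omegaKG 2 ξ)) * Complex.I) -
    Complex.exp (↑τ * ↑(omegaKG 2 ξ) * Complex.I)) * Complex.I_mul_I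

lemma multKernel_mcos (τ x) :
    multKernel 2 (mcos τ) x = c0 / 2 * (hKG (fun _ => 1) τ x + hKG (fun _ => 1) (-τ) x) := by
  have h : ∀ t, BM fun ξ => 1 * osc t ξ * ph x ξ := fun t =>
    ((BM.const 1).mul (BM.osc t)).mul (BM.ph x)
  rw [multKernel_eq, hKG, hKG, ← integral_add (h _).integrable (h _).integrable, div_mul_eq_mul_div,
    mul_div_assoc, ← integral_div]
  congr 1
  refine integral_congr_ae (.of_forall fun ξ => ?_)
  simp only [mcos_eq]; ring

lemma multKernel_msin (τ x) :
    multKernel 2 (msin τ) x = c0 / (2 * Complex.I) * (hKG winv τ x - hKG winv (-τ) x) := by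
  have h : ∀ t, BM fun ξ => winv ξ * osc t ξ * ph x ξ := fun t =>
    (bm_winv.mul (BM.osc t)).mul (BM.ph x)
  rw [multKernel_eq, hKG, hKG, ← integral_sub (h _).integrable (h _).integrable, div_mul_eq_mul_div,
    mul_div_assoc, ← integral_div]
  congr 1
  refine integral_congr_ae (.of_forall fun ξ => ?_)
  simp only [msin_eq]; ring

end

section

/-- The Fourier series of a finitely supported function. -/
def fhat (S : Finset (Fin 2 → ℤ)) (f : (Fin 2 → ℤ) → ℂ) (ξ : Fin 2 → ℝ) : ℂ :=
  ∑ y ∈ S, f y * ph (-y) ξ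

lemma bm_fhat (S f) : BM (fhat S f) := BM.sum S fun y => (BM.const (f y)).mul (BM.ph (-y))

lemma n2_fhat_le (S f) : n2 (fhat S f) ≤ ENNReal.ofReal (2 * π) * eLpNorm f 2 Measure.count := by
  have e : n2 (fhat S f) = n2 fun ξ => ∑ y ∈ S, (starRingEnd ℂ) (f y) * ph y ξ := by
    refine eLpNorm_congr_norm_ae (.of_forall fun ξ => ?_)
    rw [← RCLike.norm_conj, fhat, map_sum]
    simp only [map_mul, conj_ph, neg_neg]
  rw [e]
  refine (ENNReal.pow_le_pow_left_iff two_ne_zero).1 ?_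
  rw [n2_sq_trig, mul_pow, eLpNorm_two_sq, lintegral_count]
  gcongr
  simp only [RCLike.enorm_conj]
  exact ENNReal.sum_le_tsum S

lemma hKG_fhat {Ψ} (hΨ : BM Ψ) (S f t x) :
    hKG (fun ξ => Ψ ξ * fhat S f ξ) t x = ∑ y ∈ S, f y * hKG Ψ t (x - y) := by
  unfold hKG
  simp_rw [← integral_const_mul]
  rw [← integral_finsetSum _ fun y _ => ((BM.const (f y)).mul
    ((hΨ.mul (BM.osc t)).mul (BM.ph (x - y)))).integrable]
  refine integral_congr_ae (.of_forall fun ξ => ?_)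
  simp only [fhat, Finset.mul_sum, Finset.sum_mul]
  refine Finset.sum_congr rfl fun y _ => ?_
  rw [sub_eq_add_neg x y, ph_add]; ring

lemma cosProp_fin {S : Finset (Fin 2 → ℤ)} {f : (Fin 2 → ℤ) → ℂ} (hf : ∀ y ∉ S, f y = 0) (t x) :
    cosProp 2 t f x = c0 / 2 * (hKG (fun ξ => 1 * fhat S f ξ) (1 * t) x +
      hKG (fun ξ => 1 * fhat S f ξ) (-1 * t) x) := by
  rw [cosProp_eq, cv, tsum_eq_sum (s := S) fun y hy => by rw [hf y hy, mul_zero],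
    hKG_fhat (BM.const 1), hKG_fhat (BM.const 1), ← Finset.sum_add_distrib, Finset.mul_sum]
  refine Finset.sum_congr rfl fun y _ => ?_
  rw [multKernel_mcos, one_mul, neg_one_mul]; ring

lemma sinProp_fin {S : Finset (Fin 2 → ℤ)} {f : (Fin 2 → ℤ) → ℂ} (hf : ∀ y ∉ S, f y = 0) (t x) :
    sinProp 2 t f x = c0 / (2 * Complex.I) * (hKG (fun ξ => winv ξ * fhat S f ξ) (1 * t) x +
      (-1) * hKG (fun ξ => winv ξ * fhat S f ξ) (-1 * t) x) := by
  rw [sinProp_eq, cv, tsum_eq_sum (s := S) fun y hy => by rw [hf y hy, mul_zero],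
    hKG_fhat bm_winv, hKG_fhat bm_winv, neg_one_mul, ← sub_eq_add_neg, ← Finset.sum_sub_distrib,
    Finset.mul_sum]
  refine Finset.sum_congr rfl fun y _ => ?_
  rw [multKernel_msin, one_mul, neg_one_mul]; ring

lemma integrable_dKG {S G} (hG : Nice S G) (σ t : ℝ) (x y) :
    Integrable fun s => (ktm t s * G s y) * hKG winv (σ * (t - s)) (x - y) := by
  obtain ⟨B, hB⟩ := hKG_bdd winv
  refine ((hG.tf y).ktm_mul t).integrable.mul_bdd (c := B) ?_ (.of_forall fun s => hB _ _)
  exact (measurable_hKG_comp bm_winv (by fun_prop) measurable_const).aestronglyMeasurable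

lemma duhamel_nice {S G} (hG : Nice S G) (t x) :
    ∫ s in (0:ℝ)..t, sinProp 2 (t - s) (G s) x =
      c0 / (2 * Complex.I) * (dKG 1 S G t x + (-1) * dKG (-1) S G t x) := by
  rw [intervalIntegral_eq_ktm, dKG, dKG, neg_one_mul, ← sub_eq_add_neg, ← Finset.sum_sub_distrib]
  simp_rw [fun y => (integral_sub (integrable_dKG hG 1 t x y) (integrable_dKG hG (-1) t x y)).symm]
  have hi : ∀ y, Integrable fun s => ktm t s * G s y * hKG winv (1 * (t - s)) (x - y) -
      ktm t s * G s y * hKG winv (-1 * (t - s)) (x - y) := fun y =>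
    (integrable_dKG hG 1 t x y).sub (integrable_dKG hG (-1) t x y)
  rw [← integral_finsetSum _ fun y _ => hi y, ← integral_const_mul]
  refine integral_congr_ae (.of_forall fun s => ?_)
  simp only
  rw [sinProp_eq, cv, tsum_eq_sum (s := S) fun y hy => by rw [hG.supp s y hy, mul_zero],
    Finset.mul_sum, Finset.mul_sum]
  refine Finset.sum_congr rfl fun y _ => ?_
  rw [multKernel_msin, one_mul, neg_one_mul]; ring

lemma EP.congr {u v M} (h : EP u M) (e : ∀ t x, v t x = u t x) : EP v M := by
  have : v = u := funext fun t => funext fun x => e t x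
  rwa [this]

/-- The Strichartz estimate for nice data. -/
lemma exists_duhamel_EP : ∃ C : ℝ≥0∞, C ≠ ∞ ∧ ∀ {q r q' r' : ℝ≥0∞}, 2 ≤ q → 2 ≤ r →
    1/q ≤ 3/4 * (1/2 - 1/r) → 1/q + 1/q' = 1 → 1/r + 1/r' = 1 →
    ∀ (S : Finset (Fin 2 → ℤ)) (f g G), (∀ y ∉ S, f y = 0) → (∀ y ∉ S, g y = 0) → Nice S G →
      EP (fun t => duhamel 2 t f g G)
        (C * (eLpNorm f 2 Measure.count + eLpNorm g 2 Measure.count + mixedNorm 2 q' r' G)) := by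
  obtain ⟨C, hC, hh⟩ := exists_hKG_EP
  obtain ⟨K, hK, hd⟩ := exists_dKG_EP
  set a := ‖c0 / 2‖ₑ with ha
  set b := ‖c0 / (2 * Complex.I)‖ₑ with hb
  set P := ENNReal.ofReal (2 * π) with hP
  set D := a * (C * P + C * P) + b * (C * P + C * P) + b * (K + K) with hD
  have hPt : P ≠ ∞ := ENNReal.ofReal_ne_top
  have hat : a ≠ ∞ := enorm_ne_top
  have hbt : b ≠ ∞ := enorm_ne_top
  refine ⟨D, by finiteness, fun {q r q' r'} hq hr hadm hqq hrr S f g G hf hg hG => ?_⟩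
  have n1 : ‖(-1:ℂ)‖ₑ = 1 := by simp
  set X := eLpNorm f 2 Measure.count with hX
  set Y := eLpNorm g 2 Measure.count with hY
  set Z := mixedNorm 2 q' r' G with hZ
  have hF : BM fun ξ => 1 * fhat S f ξ := (BM.const 1).mul (bm_fhat S f)
  have hGb : BM fun ξ => winv ξ * fhat S g ξ := bm_winv.mul (bm_fhat S g)
  have b1 : n2 (fun ξ => 1 * fhat S f ξ) ≤ P * X := by
    simp only [one_mul]; exact n2_fhat_le S f
  have b2 : n2 (fun ξ => winv ξ * fhat S g ξ) ≤ P * Y :=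
    (n2_winv_mul_le _).trans (n2_fhat_le S g)
  have s1 : |(1:ℝ)| = 1 := by simp
  have s2 : |(-1:ℝ)| = 1 := by simp
  have E1 : EP (fun t => cosProp 2 t f) (a * (C * (P * X) + C * (P * X))) :=
    ((((hh 1 s1 _ hF).mono (by gcongr)).add ((hh (-1) s2 _ hF).mono (by gcongr))).const_mul
      (c0 / 2)).congr fun t x => cosProp_fin hf t x
  have E2 : EP (fun t => sinProp 2 t g) (b * (C * (P * Y) + 1 * (C * (P * Y)))) := by
    have := ((((hh 1 s1 _ hGb).mono (mul_le_mul_right b2 C)).add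
      (((hh (-1) s2 _ hGb).mono (mul_le_mul_right b2 C)).const_mul (-1))).const_mul
      (c0 / (2 * Complex.I))).congr fun t x => sinProp_fin hg t x
    rwa [n1] at this
  have E3 : EP (fun t x => ∫ s in (0:ℝ)..t, sinProp 2 (t - s) (G s) x)
      (b * (K * Z + 1 * (K * Z))) := by
    have := (((hd hq hr hadm hqq hrr 1 s1 S G hG).add
      ((hd hq hr hadm hqq hrr (-1) s2 S G hG).const_mul (-1))).const_mul
      (c0 / (2 * Complex.I))).congr fun t x => duhamel_nice hG t x
    rwa [n1] at this
  refine (((E1.add E2).add E3).congr fun t x => rfl).mono ?_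
  have e : a * (C * (P * X) + C * (P * X)) + b * (C * (P * Y) + 1 * (C * (P * Y))) +
      b * (K * Z + 1 * (K * Z)) =
      (a * (C * P + C * P)) * X + (b * (C * P + C * P)) * Y + (b * (K + K)) * Z := by ring
  have e' : D * (X + Y + Z) = D * X + D * Y + D * Z := by ring
  rw [e, e']
  refine add_le_add (add_le_add (mul_le_mul_left ?_ X) (mul_le_mul_left ?_ Y))
    (mul_le_mul_left ?_ Z)
  · rw [hD, add_assoc]; exact le_self_add
  · rw [hD, add_assoc, add_left_comm]; exact le_self_add
  · exact le_add_self

end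

section

open Filter Topology

/-- Sets of reals meeting every measurable set of positive measure. -/
def Thick (S : Set ℝ) : Prop := ∀ A, MeasurableSet A → (∀ s ∈ A, s ∉ S) → volume A = 0

lemma Thick.ae {S} (h : Thick S) {P : ℝ → Prop} (hP : NullMeasurableSet {s | P s})
    (hS : ∀ s ∈ S, P s) : ∀ᵐ s, P s := by
  obtain ⟨A, hA, hAm, hAe⟩ := hP.compl.exists_measurable_subset_ae_eq
  have h0 := h A hAm fun s hs hsS => hA hs (hS s hsS)
  have : volume ({s | P s}ᶜ) = 0 := by rw [← measure_congr hAe, h0]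
  exact this

lemma Thick.inter {S} (h : Thick S) {P : ℝ → Prop} (hP : ∀ᵐ s, P s) :
    Thick {s | s ∈ S ∧ P s} := by
  intro A hA hAS
  set Z := toMeasurable volume {s | ¬ P s} with hZ
  have hZ0 : volume Z = 0 := by rw [hZ, measure_toMeasurable]; exact hP
  have h1 : volume (A \ Z) = 0 := by
    refine h _ (hA.diff (measurableSet_toMeasurable _ _)) fun s hs hsS => hAS s hs.1 ⟨hsS, ?_⟩
    by_contra hc
    exact hs.2 (subset_toMeasurable _ _ hc)
  refine measure_mono_null (t := (A \ Z) ∪ Z) (fun s hs => ?_) (measure_union_null h1 hZ0)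
  by_cases hz : s ∈ Z
  · exact Or.inr hz
  · exact Or.inl ⟨hs, hz⟩

/-- A possibly nonmeasurable function with finite lower integral has a measurable majorant of
almost the same integral on a thick set. -/
lemma exists_majorant {N : ℝ → ℝ≥0∞} {p : ℝ} (hp : 1 ≤ p)
    (hN : ∫⁻ s, N s ^ p ≠ ∞) {δ : ℝ≥0∞} (hδ : δ ≠ 0) :
    ∃ m : ℝ → ℝ, Measurable m ∧ ∃ S, Thick S ∧ (∀ s ∈ S, 0 < m s) ∧
      (∀ s ∈ S, N s ≤ ENNReal.ofReal (m s)) ∧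
      (∫⁻ s, ENNReal.ofReal (m s) ^ p) ^ (1/p) ≤ (∫⁻ s, N s ^ p) ^ (1/p) + δ := by
  have hp0 : 0 < p := by linarith
  have hpi : 0 < 1 / p := by positivity
  obtain ⟨φ, hφm, hφle, hφ⟩ := exists_measurable_le_lintegral_eq volume fun s => N s ^ p
  have hδp : δ ^ p ≠ 0 := by simp [hδ, hp0.le]
  obtain ⟨η, hη0, hηm, hη⟩ := exists_pos_lintegral_lt_of_sigmaFinite (volume : Measure ℝ) hδp
  have hφt : ∫⁻ s, φ s ≠ ∞ := by rwa [← hφ]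
  have hfin : ∀ᵐ s, φ s < ∞ := ae_lt_top hφm hφt
  set S0 : Set ℝ := {s | N s ^ p ≤ φ s + η s} with hS0
  have hT0 : Thick S0 := by
    intro A hA hAS
    have hle : ∫⁻ s, (φ s + A.indicator (fun s => (η s : ℝ≥0∞)) s) ≤ ∫⁻ s, φ s := by
      rw [← hφ]
      refine lintegral_mono fun s => ?_
      by_cases hs : s ∈ A
      · simp only [Set.indicator_of_mem hs]
        exact (not_le.1 (hAS s hs)).le
      · simp only [Set.indicator_of_notMem hs, add_zero]
        exact hφle s
    rw [lintegral_add_left hφm, lintegral_indicator hA] at hle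
    have h0 : ∫⁻ s in A, (η s : ℝ≥0∞) = 0 := by
      by_contra hc
      exact absurd hle (not_le.2 (ENNReal.lt_add_right hφt hc))
    rw [lintegral_eq_zero_iff (by fun_prop)] at h0
    have : ∀ᵐ s ∂volume.restrict A, False := by
      filter_upwards [h0] with s hs
      exact absurd hs (by simpa using (hη0 s).ne')
    simpa [ae_iff] using this
  have hT := hT0.inter hfin
  refine ⟨fun s => ((φ s + η s) ^ (1/p)).toReal, by fun_prop, _, hT, fun s hs => ?_,
    fun s hs => ?_, ?_⟩
  · have hlt : φ s + η s ≠ ∞ := ENNReal.add_ne_top.2 ⟨hs.2.ne, ENNReal.coe_ne_top⟩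
    refine ENNReal.toReal_pos ?_ (ENNReal.rpow_ne_top_of_nonneg hpi.le hlt)
    have : φ s + η s ≠ 0 := by
      have := hη0 s
      simp [this.ne']
    exact (ENNReal.rpow_pos (pos_iff_ne_zero.2 this) hlt).ne'
  · have hlt : φ s + η s ≠ ∞ := ENNReal.add_ne_top.2 ⟨hs.2.ne, ENNReal.coe_ne_top⟩
    rw [ENNReal.ofReal_toReal (ENNReal.rpow_ne_top_of_nonneg hpi.le hlt)]
    calc N s = (N s ^ p) ^ (1/p) := by
          rw [← ENNReal.rpow_mul, mul_one_div_cancel hp0.ne', ENNReal.rpow_one]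
      _ ≤ _ := ENNReal.rpow_le_rpow hs.1 hpi.le
  · have h1 : ∫⁻ s, ENNReal.ofReal (((φ s + η s) ^ (1/p)).toReal) ^ p ≤ ∫⁻ s, (φ s + η s) := by
      refine lintegral_mono fun s => ?_
      calc _ ≤ ((φ s + η s) ^ (1/p)) ^ p :=
            ENNReal.rpow_le_rpow ENNReal.ofReal_toReal_le hp0.le
        _ = _ := by rw [← ENNReal.rpow_mul, one_div_mul_cancel hp0.ne', ENNReal.rpow_one]
    calc _ ≤ ((∫⁻ s, N s ^ p) + δ ^ p) ^ (1/p) := by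
          refine ENNReal.rpow_le_rpow (h1.trans ?_) hpi.le
          rw [lintegral_add_left hφm, ← hφ]
          exact add_le_add_right hη.le _
      _ ≤ (∫⁻ s, N s ^ p) ^ (1/p) + (δ ^ p) ^ (1/p) :=
          ENNReal.rpow_add_le_add_rpow _ _ hpi.le (by rw [div_le_one hp0]; exact hp)
      _ = _ := by
          rw [← ENNReal.rpow_mul δ, mul_one_div_cancel hp0.ne', ENNReal.rpow_one]

/-- Simple approximation of the identity map with values in a thick set, along which countably
many given functions converge almost everywhere. -/
lemma exists_simple_selection {ι : Type} [Countable ι] {S : Set ℝ} (hS : Thick S)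
    (ψ : ι → ℝ → ℂ) (hψ : ∀ i, AEStronglyMeasurable (ψ i) volume) :
    ∃ τ : ℕ → SimpleFunc ℝ ℝ, (∀ n s, τ n s ∈ S) ∧
      ∀ᵐ s, ∀ i, Tendsto (fun n => ψ i (τ n s)) atTop (𝓝 (ψ i s)) := by
  have hae : ∀ᵐ s, ∀ i, ψ i s = (hψ i).mk (ψ i) s := ae_all_iff.2 fun i => (hψ i).ae_eq_mk
  have hφm : ∀ i, Measurable ((hψ i).mk (ψ i)) := fun i => (hψ i).stronglyMeasurable_mk.measurable
  set φ : ι → ℝ → ℂ := fun i => (hψ i).mk (ψ i) with hφ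
  have hS1 := hS.inter hae
  set S1 : Set ℝ := {s | s ∈ S ∧ ∀ i, ψ i s = φ i s} with hS1d
  let := TopologicalSpace.pseudoMetrizableSpacePseudoMetric (ι → ℂ)
  set Θ : ℝ → ι → ℂ := fun s i => φ i s with hΘ
  have hΘm : Measurable Θ := measurable_pi_iff.2 hφm
  have hne : S1.Nonempty := by
    by_contra hc
    rw [Set.not_nonempty_iff_eq_empty] at hc
    have := hS1 Set.univ MeasurableSet.univ (fun s _ => by simp [hc])
    simp at this
  obtain ⟨s0, hs0⟩ := hne
  have hsel : ∀ y : ι → ℂ, ∃ s, s ∈ S1 ∧ (y ∈ Θ '' S1 → Θ s = y) := fun y => by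
    by_cases hy : y ∈ Θ '' S1
    · obtain ⟨s, hs, rfl⟩ := hy
      exact ⟨s, hs, fun _ => rfl⟩
    · exact ⟨s0, hs0, fun h => absurd h hy⟩
  choose sel hsel1 hsel2 using hsel
  have hy0 : Θ s0 ∈ Θ '' S1 := ⟨s0, hs0, rfl⟩
  set A := fun n => SimpleFunc.approxOn Θ hΘm (Θ '' S1) (Θ s0) hy0 n with hA
  have hcl : ∀ᵐ s, Θ s ∈ closure (Θ '' S1) := by
    refine hS1.ae ?_ fun s hs => subset_closure ⟨s, hs, rfl⟩
    exact (hΘm isClosed_closure.measurableSet).nullMeasurableSet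
  refine ⟨fun n => (A n).map sel, fun n s => (hsel1 _).1, ?_⟩
  filter_upwards [hcl, hae] with s hs hsa i
  have h1 : Tendsto (fun n => A n s) atTop (𝓝 (Θ s)) := SimpleFunc.tendsto_approxOn hΘm hy0 hs
  have h2 := (continuous_apply i).tendsto (Θ s) |>.comp h1
  rw [hsa i]
  refine h2.congr fun n => ?_
  have h3 : A n s ∈ Θ '' S1 := SimpleFunc.approxOn_mem hΘm hy0 n s
  have h4 := hsel2 _ h3
  simp only [Function.comp, SimpleFunc.map_apply]
  rw [(hsel1 (A n s)).2 i, ← congrFun h4 i]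

end

section

open Filter Topology

/-- For `1 ≤ r ≤ 2` the `ℓ^r` norm controls the `ℓ²` norm. -/
lemma eLpNorm_two_le_of_le_two (v : (Fin 2 → ℤ) → ℂ) {r : ℝ≥0∞} (h1 : 1 ≤ r) (h2 : r ≤ 2) :
    eLpNorm v 2 Measure.count ≤ eLpNorm v r Measure.count := by
  set A := eLpNorm v r Measure.count with hA
  rcases eq_or_ne A ∞ with h | h
  · rw [h]; exact le_top
  have hr0 : r ≠ 0 := (zero_lt_one.trans_le h1).ne'
  have hrt : r ≠ ∞ := ne_top_of_le_ne_top (by norm_num) h2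
  have hp : 0 < r.toReal := ENNReal.toReal_pos hr0 hrt
  have hp2 : r.toReal ≤ 2 := by simpa using ENNReal.toReal_mono (by norm_num) h2
  refine (ENNReal.pow_le_pow_left_iff two_ne_zero).1 ?_
  rw [eLpNorm_two_sq, lintegral_count]
  have hAe : ∑' x, ‖v x‖ₑ ^ r.toReal = A ^ r.toReal := by
    rw [hA, eLpNorm_eq_lintegral_rpow_enorm_toReal hr0 hrt, lintegral_count, ← ENNReal.rpow_mul,
      one_div_mul_cancel hp.ne', ENNReal.rpow_one]
  have hx : ∀ x, ‖v x‖ₑ ^ 2 ≤ A ^ (2 - r.toReal) * ‖v x‖ₑ ^ r.toReal := fun x => by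
    have e : ‖v x‖ₑ ^ 2 = ‖v x‖ₑ ^ (2 - r.toReal) * ‖v x‖ₑ ^ r.toReal := by
      rw [← ENNReal.rpow_add_of_nonneg _ _ (by linarith) hp.le, ← ENNReal.rpow_two]
      congr 1; ring
    rw [e]
    exact mul_le_mul_left (ENNReal.rpow_le_rpow (enorm_le_eLpNorm_count v x hr0)
      (by linarith)) _
  calc _ ≤ ∑' x, A ^ (2 - r.toReal) * ‖v x‖ₑ ^ r.toReal := ENNReal.tsum_le_tsum hx
    _ = A ^ (2 - r.toReal) * A ^ r.toReal := by rw [ENNReal.tsum_mul_left, hAe]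
    _ = A ^ 2 := by
      rw [← ENNReal.rpow_add_of_nonneg _ _ (by linarith) hp.le, ← ENNReal.rpow_two]
      congr 1; ring

/-- The restriction of `v` to a finite set of sites, extended by zero. -/
def restr (T : Finset (Fin 2 → ℤ)) (v : (Fin 2 → ℤ) → ℂ) (y : Fin 2 → ℤ) : ℂ :=
  if y ∈ T then v y else 0

lemma eLpNorm_restr_le (T v) (r : ℝ≥0∞) :
    eLpNorm (restr T v) r Measure.count ≤ eLpNorm v r Measure.count :=
  eLpNorm_mono fun y => by unfold restr; split_ifs <;> simp

lemma eventually_restr_sub_le {v : (Fin 2 → ℤ) → ℂ} (hv : eLpNorm v 2 Measure.count ≠ ∞)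
    {ε : ℝ≥0∞} (hε : ε ≠ 0) :
    ∀ᶠ T in atTop, eLpNorm (fun y => restr T v y - v y) 2 Measure.count ≤ ε := by
  have hs : ∑' x, ‖v x‖ₑ ^ 2 ≠ ∞ := by
    rw [← lintegral_count, ← eLpNorm_two_sq]
    exact ENNReal.pow_ne_top hv
  have hε2 : 0 < ε ^ 2 := pos_iff_ne_zero.2 (pow_ne_zero 2 hε)
  filter_upwards [(ENNReal.tendsto_tsum_compl_atTop_zero hs).eventually (ge_mem_nhds hε2)]
    with T hT
  refine (ENNReal.pow_le_pow_left_iff two_ne_zero).1 ?_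
  rw [eLpNorm_two_sq, lintegral_count]
  refine le_trans (le_of_eq ?_) hT
  refine Eq.trans ?_ (tsum_subtype {x | x ∉ T} fun x => ‖v x‖ₑ ^ 2).symm
  refine tsum_congr fun x => ?_
  by_cases hx : x ∈ T <;> simp [restr, hx]

lemma norm_sinProp_le_of {v : (Fin 2 → ℤ) → ℂ} {M : ℝ} (hM : 0 ≤ M)
    (hv : eLpNorm v 2 Measure.count ≤ ENNReal.ofReal M) (τ x) : ‖sinProp 2 τ v x‖ ≤ M := by
  have := (enorm_sinProp_le τ v x).trans hv
  rwa [← ofReal_norm, ENNReal.ofReal_le_ofReal_iff hM] at this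

lemma norm_sinProp_time_le_of {v : (Fin 2 → ℤ) → ℂ} {M : ℝ} (hM : 0 ≤ M)
    (hv : eLpNorm v 2 Measure.count ≤ ENNReal.ofReal M) (τ τ' x) :
    ‖sinProp 2 τ v x - sinProp 2 τ' v x‖ ≤ |τ - τ'| * M := by
  have h := enorm_sinProp_time_le τ τ' (ne_top_of_le_ne_top ENNReal.ofReal_ne_top hv) x
  have h2 := h.trans (mul_le_mul_right hv _)
  rwa [← ofReal_norm, ← ENNReal.ofReal_mul (abs_nonneg _),
    ENNReal.ofReal_le_ofReal_iff (by positivity)] at h2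

lemma ktm_congr {t t' s s' : ℝ} (h0 : |t' - t| + |s' - s| < |s|)
    (h1 : |t' - t| + |s' - s| < |s - t|) : ktm t' s' = ktm t s := by
  have a1 := abs_le.1 (le_refl |t' - t|)
  have a2 := abs_le.1 (le_refl |s' - s|)
  have hP : (0 < s' ∧ s' ≤ t') ↔ (0 < s ∧ s ≤ t) := by
    constructor <;> rintro ⟨u1, u2⟩ <;> constructor <;>
      rcases abs_cases s with ⟨c, _⟩ | ⟨c, _⟩ <;>
      rcases abs_cases (s - t) with ⟨c', _⟩ | ⟨c', _⟩ <;> linarith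
  have hQ : (t' < s' ∧ s' ≤ 0) ↔ (t < s ∧ s ≤ 0) := by
    constructor <;> rintro ⟨u1, u2⟩ <;> constructor <;>
      rcases abs_cases s with ⟨c, _⟩ | ⟨c, _⟩ <;>
      rcases abs_cases (s - t) with ⟨c', _⟩ | ⟨c', _⟩ <;> linarith
  simp only [ktm, hP, hQ]

/-- The integrand in Duhamel's formula. -/
def duh (F : ℝ → (Fin 2 → ℤ) → ℂ) (x : Fin 2 → ℤ) (t s : ℝ) : ℂ :=
  ktm t s * sinProp 2 (t - s) (F s) x

lemma norm_ktm_mul_le (t s : ℝ) (z : ℂ) : ‖ktm t s * z‖ ≤ ‖z‖ := by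
  rw [norm_mul]
  exact mul_le_of_le_one_left (norm_nonneg _) (norm_ktm_le t s)

/-- Time regularity of the Duhamel integrand. -/
lemma norm_duh_sub_le {F : ℝ → (Fin 2 → ℤ) → ℂ} {M : ℝ} (hM : 0 ≤ M) {s : ℝ}
    (hs : eLpNorm (F s) 2 Measure.count ≤ ENNReal.ofReal M) (x) {t t' : ℝ}
    (h0 : |t' - t| < |s|) (h1 : |t' - t| < |s - t|) :
    ‖duh F x t s - duh F x t' s‖ ≤ |t - t'| * M := by
  rw [duh, duh, ktm_congr (t := t) (t' := t') (s := s) (s' := s) (by simpa) (by simpa),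
    ← mul_sub]
  refine (norm_ktm_mul_le _ _ _).trans ?_
  have := norm_sinProp_time_le_of hM hs (t - s) (t' - s) x
  rwa [sub_sub_sub_cancel_right] at this

lemma measurable_duh_nice {T G} (hG : Nice T G) (x t) : Measurable fun s => duh G x t s := by
  have e : (fun s => duh G x t s) = fun s => ∑ y ∈ T, c0 / (2 * Complex.I) *
      ((ktm t s * G s y) * hKG winv (1 * (t - s)) (x - y) -
        (ktm t s * G s y) * hKG winv (-1 * (t - s)) (x - y)) := by
    funext s
    rw [duh, sinProp_eq, cv, tsum_eq_sum (s := T) fun y hy => by rw [hG.supp s y hy, mul_zero],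
      Finset.mul_sum]
    refine Finset.sum_congr rfl fun y _ => ?_
    rw [multKernel_msin, one_mul, neg_one_mul]; ring
  rw [e]
  refine Finset.measurable_sum _ fun y _ => ?_
  have := (hG.tf y).meas
  have h1 := measurable_hKG_comp bm_winv (τ := fun s : ℝ => 1 * (t - s)) (by fun_prop)
    (measurable_const (a := x - y))
  have h2 := measurable_hKG_comp bm_winv (τ := fun s : ℝ => -1 * (t - s)) (by fun_prop)
    (measurable_const (a := x - y))
  exact measurable_const.mul ((by fun_prop : Measurable fun s => ktm t s * G s y).mul h1 |>.sub
    ((by fun_prop : Measurable fun s => ktm t s * G s y).mul h2))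

end

section

open Filter Topology

/-- Convergence at a fixed time of the Duhamel integrands of approximating forcing terms. -/
lemma tendsto_duh_approx {F : ℝ → (Fin 2 → ℤ) → ℂ} {x : Fin 2 → ℤ} {t s : ℝ} {m : ℝ → ℝ}
    {τ : ℕ → ℝ} {g : ℕ → (Fin 2 → ℤ) → ℂ} {D : Set ℝ} (hs0 : s ≠ 0) (hst : s ≠ t) (hm : 0 < m s)
    (hτ : Tendsto τ atTop (𝓝 s)) (hmτ : Tendsto (fun n => m (τ n)) atTop (𝓝 (m s)))
    (hF : ∀ n, eLpNorm (F (τ n)) 2 Measure.count ≤ ENNReal.ofReal (m (τ n)))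
    (hmp : ∀ n, 0 < m (τ n)) (hgfin : ∀ n, eLpNorm (g n) 2 Measure.count ≠ ∞)
    (hg : ∀ᶠ n : ℕ in atTop, eLpNorm (fun y => g n y - F (τ n) y) 2 Measure.count ≤
      ENNReal.ofReal (1 / ((n:ℝ) + 1)))
    (hD : t ∈ closure D)
    (hψ : ∀ t' ∈ D, Tendsto (fun n => duh F x t' (τ n)) atTop (𝓝 (duh F x t' s)))
    (hreg : ∀ t' ∈ D, |t' - t| < |s| → |t' - t| < |s - t| →
      ‖duh F x t s - duh F x t' s‖ ≤ |t - t'| * m s) :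
    Tendsto (fun n => ktm t s * sinProp 2 (t - s) (g n) x) atTop (𝓝 (duh F x t s)) := by
  rw [Metric.tendsto_nhds]
  intro ε hε
  have hs0' : 0 < |s| := abs_pos.2 hs0
  have hst' : 0 < |s - t| := abs_pos.2 (sub_ne_zero.2 hst)
  obtain ⟨t', ht', hdist⟩ := Metric.mem_closure_iff.1 hD
    (min (min (|s| / 2) (|s - t| / 2)) (ε / (8 * m s))) (by positivity)
  rw [Real.dist_eq, lt_min_iff, lt_min_iff] at hdist
  obtain ⟨⟨d1, d2⟩, d3⟩ := hdist
  have d3' : |t - t'| * m s < ε / 8 := by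
    rw [lt_div_iff₀ (by positivity)] at d3 ⊢; linarith
  have hcomm : |t' - t| = |t - t'| := abs_sub_comm _ _
  have hR := hreg t' ht' (by linarith) (by linarith)
  have hτ0 : Tendsto (fun n => |τ n - s|) atTop (𝓝 0) := by
    have := (hτ.sub_const s).abs
    simpa using this
  have e1 : ∀ᶠ n : ℕ in atTop, |τ n - s| < min (min (|s| / 2) (|s - t| / 2)) (ε / (16 * m s)) :=
    hτ0.eventually_lt_const (by positivity)
  have e2 : ∀ᶠ n : ℕ in atTop, m (τ n) < 2 * m s := hmτ.eventually_lt_const (by linarith)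
  have e3 : ∀ᶠ n : ℕ in atTop, 1 / ((n:ℝ) + 1) < ε / 8 :=
    tendsto_one_div_add_atTop_nhds_zero_nat.eventually_lt_const (by positivity)
  have e4 := (Metric.tendsto_nhds.1 (hψ t' ht')) (ε / 8) (by positivity)
  filter_upwards [e1, e2, e3, e4, hg] with n h1 h2 h3 h4 h5
  rw [lt_min_iff, lt_min_iff] at h1
  obtain ⟨⟨c1, c2⟩, c3⟩ := h1
  have c3' : |τ n - s| * m s < ε / 16 := by
    rw [lt_div_iff₀ (by positivity)] at c3 ⊢; linarith
  have hk : ktm t' (τ n) = ktm t s := ktm_congr (by linarith) (by linarith)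
  have hFn : eLpNorm (F (τ n)) 2 Measure.count ≠ ∞ := ne_top_of_le_ne_top ENNReal.ofReal_ne_top (hF n)
  have hA : ‖sinProp 2 (t - s) (g n) x - sinProp 2 (t - s) (F (τ n)) x‖ ≤ 1 / ((n:ℝ) + 1) := by
    rw [← sinProp_sub _ (hgfin n) hFn]
    exact norm_sinProp_le_of (by positivity) h5 _ _
  have hB := norm_sinProp_time_le_of (hmp n).le (hF n) (t - s) (t' - τ n) x
  have hB' : |t - s - (t' - τ n)| * m (τ n) ≤ (|t - t'| + |τ n - s|) * (2 * m s) := by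
    have : |t - s - (t' - τ n)| ≤ |t - t'| + |τ n - s| := by
      have e : t - s - (t' - τ n) = (t - t') + (τ n - s) := by ring
      rw [e]; exact abs_add_le _ _
    exact mul_le_mul this h2.le (hmp n).le (by positivity)
  have hC : ‖ktm t s * sinProp 2 (t - s) (g n) x - duh F x t' (τ n)‖ ≤
      1 / ((n:ℝ) + 1) + (|t - t'| + |τ n - s|) * (2 * m s) := by
    rw [duh, hk, ← mul_sub]
    refine (norm_ktm_mul_le _ _ _).trans ?_
    refine (norm_sub_le_norm_sub_add_norm_sub _ (sinProp 2 (t - s) (F (τ n)) x) _).trans ?_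
    linarith
  rw [dist_eq_norm] at h4 ⊢
  have hR' : ‖duh F x t' s - duh F x t s‖ ≤ |t - t'| * m s := by rwa [norm_sub_rev]
  have t1 := norm_sub_le_norm_sub_add_norm_sub (ktm t s * sinProp 2 (t - s) (g n) x)
    (duh F x t' (τ n)) (duh F x t s)
  have t2 := norm_sub_le_norm_sub_add_norm_sub (duh F x t' (τ n)) (duh F x t' s) (duh F x t s)
  have e : (|t - t'| + |τ n - s|) * (2 * m s) = 2 * (|t - t'| * m s) + 2 * (|τ n - s| * m s) := by
    ring
  linarith

/-- The forcing term `F` sampled along a simple function `τ` and restricted to `T`. -/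
def sampled (F : ℝ → (Fin 2 → ℤ) → ℂ) (m : ℝ → ℝ) (τ : SimpleFunc ℝ ℝ) (R : ℝ)
    (T : Finset (Fin 2 → ℤ)) (s : ℝ) (y : Fin 2 → ℤ) : ℂ :=
  if m (τ s) ≤ 2 * m s ∧ |s| ≤ R then restr T (F (τ s)) y else 0

lemma nice_sampled (F) {m : ℝ → ℝ} (hm : Measurable m) (τ R T) :
    Nice T (sampled F m τ R T) where
  tf y := by
    obtain ⟨B, hB⟩ := (τ.map fun σ => restr T (F σ) y).exists_forall_norm_le
    refine ⟨?_, ⟨B, fun s => ?_⟩, ⟨R, fun s hs => ?_⟩⟩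
    · unfold sampled
      refine Measurable.ite ?_ (τ.map fun σ => restr T (F σ) y).measurable measurable_const
      have hτ := τ.measurable
      exact (measurableSet_le (hm.comp hτ) (hm.const_mul 2)).inter
        (measurableSet_le measurable_id.abs measurable_const)
    · unfold sampled
      split_ifs
      · exact hB s
      · simpa using (norm_nonneg _).trans (hB s)
    · unfold sampled
      rw [if_neg fun h => absurd h.2 (not_le.2 hs)]
  supp s y hy := by simp [sampled, restr, hy]

lemma eLpNorm_sampled_le {F} {m : ℝ → ℝ} {τ : SimpleFunc ℝ ℝ} {R T} {r : ℝ≥0∞}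
    (hF : ∀ s, eLpNorm (F (τ s)) r Measure.count ≤ ENNReal.ofReal (m (τ s))) (s) :
    eLpNorm (sampled F m τ R T s) r Measure.count ≤ 2 * ENNReal.ofReal (m s) := by
  by_cases h : m (τ s) ≤ 2 * m s ∧ |s| ≤ R
  · have e : sampled F m τ R T s = restr T (F (τ s)) := funext fun y => by simp [sampled, h]
    rw [e]
    refine (eLpNorm_restr_le _ _ _).trans ((hF s).trans ?_)
    refine (ENNReal.ofReal_le_ofReal h.1).trans ?_
    rw [ENNReal.ofReal_mul (by norm_num)]
    simp
  · have e : sampled F m τ R T s = 0 := funext fun y => by simp only [sampled, if_neg h, Pi.zero_apply]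
    rw [e, eLpNorm_zero]
    exact zero_le

lemma setLIntegral_ne_top_of_rpow {m : ℝ → ℝ} {p : ℝ} (hp : 1 ≤ p)
    (h : ∫⁻ s, ENNReal.ofReal (m s) ^ p ≠ ∞) {A : Set ℝ} (hA : volume A ≠ ∞) :
    ∫⁻ s in A, ENNReal.ofReal (m s) ≠ ∞ := by
  have h1 : ∀ a : ℝ≥0∞, a ≤ 1 + a ^ p := fun a => by
    rcases le_total a 1 with h | h
    · exact h.trans le_self_add
    · exact (ENNReal.le_rpow_self_of_one_le h hp).trans le_add_self
  refine ne_top_of_le_ne_top (b := ∫⁻ s in A, (1 + ENNReal.ofReal (m s) ^ p)) ?_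
    (lintegral_mono fun s => h1 _)
  rw [lintegral_add_left measurable_const]
  refine ENNReal.add_ne_top.2 ⟨by simpa using hA, ?_⟩
  exact ne_top_of_le_ne_top h (setLIntegral_le_lintegral _ _)

end

section

open Filter Topology

lemma ktm_eq_zero {t s : ℝ} (h : |t| < |s|) : ktm t s = 0 := by
  unfold ktm
  rcases abs_cases s with ⟨c, _⟩ | ⟨c, _⟩ <;> rcases abs_cases t with ⟨c', _⟩ | ⟨c', _⟩ <;>
    (split_ifs with h1 h2 <;> first | rfl | (exfalso; linarith [h1.1, h1.2]) |
      (exfalso; linarith [h2.1, h2.2]))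

lemma lintegral_ktm_mul_ne_top {m : ℝ → ℝ} {p : ℝ} (hp : 1 ≤ p)
    (h : ∫⁻ s, ENNReal.ofReal (m s) ^ p ≠ ∞) (t : ℝ) :
    ∫⁻ s, ‖ktm t s‖ₑ * (2 * ENNReal.ofReal (m s)) ≠ ∞ := by
  have h1 := setLIntegral_ne_top_of_rpow hp h (A := Set.Icc (-|t|) |t|) (by simp)
  refine ne_top_of_le_ne_top (ENNReal.mul_ne_top (a := 2) (by norm_num) h1) ?_
  rw [← lintegral_const_mul' _ _ ENNReal.ofNat_ne_top, ← lintegral_indicator measurableSet_Icc]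
  refine lintegral_mono fun s => ?_
  by_cases hs : s ∈ Set.Icc (-|t|) |t|
  · rw [Set.indicator_of_mem hs]
    refine mul_le_of_le_one_left' ?_
    rw [← ofReal_norm]
    exact ENNReal.ofReal_le_one.2 (norm_ktm_le t s)
  · rw [ktm_eq_zero]
    · simp
    · by_contra hc
      exact hs (abs_le.1 (not_lt.1 hc))

/-- Reduction of the Duhamel term of a general, possibly nonmeasurable, forcing term to that of
finitely supported bounded measurable forcing terms. -/
lemma exists_forcing_approx {F : ℝ → (Fin 2 → ℤ) → ℂ} {p : ℝ} {r : ℝ≥0∞} (hp : 1 ≤ p)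
    (hr1 : 1 ≤ r) (hr2 : r ≤ 2) (hF : ∫⁻ s, eLpNorm (F s) r Measure.count ^ p ≠ ∞)
    {δ : ℝ≥0∞} (hδ : δ ≠ 0) (hδt : δ ≠ ∞) :
    ∃ (T : ℕ → Finset (Fin 2 → ℤ)) (G : ℕ → ℝ → (Fin 2 → ℤ) → ℂ), (∀ n, Nice (T n) (G n)) ∧
      (∀ n, (∫⁻ s, eLpNorm (G n s) r Measure.count ^ p) ^ (1/p) ≤
        2 * ((∫⁻ s, eLpNorm (F s) r Measure.count ^ p) ^ (1/p) + δ)) ∧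
      ∀ t x, ‖∫ s in (0:ℝ)..t, sinProp 2 (t - s) (F s) x‖ₑ ≤
        liminf (fun n => ‖∫ s in (0:ℝ)..t, sinProp 2 (t - s) (G n s) x‖ₑ) atTop := by
  have hp0 : 0 < p := by linarith
  have hpi : 0 < 1 / p := by positivity
  obtain ⟨m, hm, S, hS, hpos, hle, hInt⟩ := exists_majorant hp hF hδ
  have hle2 : ∀ s ∈ S, eLpNorm (F s) 2 Measure.count ≤ ENNReal.ofReal (m s) := fun s hs =>
    (eLpNorm_two_le_of_le_two _ hr1 hr2).trans (hle s hs)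
  have hmfin : ∫⁻ s, ENNReal.ofReal (m s) ^ p ≠ ∞ := by
    intro hc
    rw [hc, ENNReal.top_rpow_of_pos hpi] at hInt
    exact absurd (top_le_iff.1 hInt)
      (ENNReal.add_ne_top.2 ⟨ENNReal.rpow_ne_top_of_nonneg hpi.le hF, hδt⟩)
  choose D hDs hDc hDcl using fun x => (TopologicalSpace.IsSeparable.of_separableSpace
    {t | Integrable (duh F x t)}).exists_countable_dense_subset
  have : ∀ x, Countable (D x) := fun x => (hDc x).to_subtype
  obtain ⟨τ, hτS, hτ⟩ := exists_simple_selection (ι := Bool ⊕ Σ x, D x) hS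
    (Sum.elim (fun b s => if b then (m s : ℂ) else (s : ℂ)) fun i s => duh F i.1 i.2 s) (by
      rintro (b | ⟨x, t⟩)
      · refine Measurable.aestronglyMeasurable ?_
        cases b
        · simp only [Sum.elim_inl]; simpa using Complex.measurable_ofReal
        · simp only [Sum.elim_inl, if_true]; fun_prop
      · exact (hDs x t.2).aestronglyMeasurable)
  have hFτ : ∀ n s, eLpNorm (F (τ n s)) 2 Measure.count ≤ ENNReal.ofReal (m (τ n s)) :=
    fun n s => hle2 _ (hτS n s)
  have hT : ∀ n : ℕ, ∃ T : Finset (Fin 2 → ℤ), ∀ s,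
      eLpNorm (fun y => restr T (F (τ n s)) y - F (τ n s) y) 2 Measure.count ≤
        ENNReal.ofReal (1 / ((n:ℝ) + 1)) := fun n => by
    have h1 : ∀ σ ∈ (τ n).range, ∀ᶠ T in atTop,
        eLpNorm (fun y => restr T (F σ) y - F σ y) 2 Measure.count ≤
          ENNReal.ofReal (1 / ((n:ℝ) + 1)) := fun σ hσ => by
      obtain ⟨s, rfl⟩ := SimpleFunc.mem_range.1 hσ
      refine eventually_restr_sub_le (ne_top_of_le_ne_top ENNReal.ofReal_ne_top (hFτ n s)) ?_
      exact (ENNReal.ofReal_pos.2 (by positivity)).ne'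
    obtain ⟨T, hT⟩ := ((Finset.eventually_all _).2 h1).exists
    exact ⟨T, fun s => hT _ (SimpleFunc.mem_range_self _ s)⟩
  choose T hT using hT
  have hnice : ∀ n, Nice (T n) (sampled F m (τ n) n (T n)) := fun n => nice_sampled F hm _ _ _
  have hG2 : ∀ n s, eLpNorm (sampled F m (τ n) n (T n) s) 2 Measure.count ≤
      2 * ENNReal.ofReal (m s) := fun n s => eLpNorm_sampled_le (fun s => hFτ n s) s
  refine ⟨T, fun n => sampled F m (τ n) n (T n), hnice, fun n => ?_, fun t x => ?_⟩
  · calc _ ≤ (∫⁻ s, (2 * ENNReal.ofReal (m s)) ^ p) ^ (1/p) :=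
          ENNReal.rpow_le_rpow (lintegral_mono fun s => ENNReal.rpow_le_rpow
            (eLpNorm_sampled_le (fun s => hle _ (hτS n s)) s) hp0.le) hpi.le
      _ = 2 * (∫⁻ s, ENNReal.ofReal (m s) ^ p) ^ (1/p) := by
          simp_rw [ENNReal.mul_rpow_of_nonneg _ _ hp0.le]
          rw [lintegral_const_mul' _ _ (ENNReal.rpow_ne_top_of_nonneg hp0.le ENNReal.ofNat_ne_top),
            ENNReal.mul_rpow_of_nonneg _ _ hpi.le, ← ENNReal.rpow_mul,
            mul_one_div_cancel hp0.ne', ENNReal.rpow_one]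
      _ ≤ _ := mul_le_mul_right hInt _
  simp only [intervalIntegral_eq_ktm]
  change ‖∫ s, duh F x t s‖ₑ ≤ liminf (fun n => ‖∫ s, duh (sampled F m (τ n) n (T n)) x t s‖ₑ) atTop
  by_cases hgood : Integrable (duh F x t)
  swap
  · rw [integral_undef hgood, enorm_zero]
    exact zero_le
  refine le_of_eq (Tendsto.liminf_eq ?_).symm
  refine (continuous_enorm.tendsto _).comp ?_
  refine tendsto_integral_of_dominated_convergence
    (fun s => (‖ktm t s‖ₑ * (2 * ENNReal.ofReal (m s))).toReal)
    (fun n => (measurable_duh_nice (hnice n) x t).aestronglyMeasurable)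
    (integrable_toReal_of_lintegral_ne_top (by fun_prop) (lintegral_ktm_mul_ne_top hp hmfin t))
    (fun n => .of_forall fun s => ?_) ?_
  · rw [← toReal_enorm]
    refine ENNReal.toReal_mono (ENNReal.mul_ne_top enorm_ne_top
      (ENNReal.mul_ne_top ENNReal.ofNat_ne_top ENNReal.ofReal_ne_top)) ?_
    rw [duh, enorm_mul]
    exact mul_le_mul_right ((enorm_sinProp_le _ _ _).trans (hG2 n s)) _
  have hmpos : ∀ᵐ s, 0 < m s :=
    hS.ae (measurableSet_lt measurable_const hm).nullMeasurableSet hpos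
  have hne : ∀ a : ℝ, ∀ᵐ s : ℝ, s ≠ a := fun a => by simp [ae_iff]
  have hreg : ∀ᵐ s, ∀ t' : D x, |(t':ℝ) - t| < |s| → |(t':ℝ) - t| < |s - t| →
      ‖duh F x t s - duh F x t' s‖ ≤ |t - t'| * m s := by
    refine ae_all_iff.2 fun t' => hS.ae ?_ fun s hs h0 h1 =>
      norm_duh_sub_le (hpos s hs).le (hle2 s hs) x h0 h1
    have h1 := hgood.aestronglyMeasurable
    have h2 : AEStronglyMeasurable (duh F x t') := (hDs x t'.2).aestronglyMeasurable
    have e : {s : ℝ | |(t':ℝ) - t| < |s| → |(t':ℝ) - t| < |s - t| →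
        ‖duh F x t s - duh F x t' s‖ ≤ |t - t'| * m s} =
        {s | |(t':ℝ) - t| < |s|}ᶜ ∪ ({s | |(t':ℝ) - t| < |s - t|}ᶜ ∪
          {s | ‖duh F x t s - duh F x t' s‖ ≤ |t - t'| * m s}) := by
      ext s
      simp only [Set.mem_ofPred_eq, Set.mem_union, Set.mem_compl_iff]
      tauto
    rw [e]
    refine (measurableSet_lt measurable_const (by fun_prop)).compl.nullMeasurableSet.union
      ((measurableSet_lt measurable_const (by fun_prop)).compl.nullMeasurableSet.union ?_)
    exact nullMeasurableSet_le (h1.sub h2).norm.aemeasurable (by fun_prop)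
  filter_upwards [hτ, hmpos, hne 0, hne t, hreg] with s h1 h2 h3 h4 h5
  have hτs : Tendsto (fun n => τ n s) atTop (𝓝 s) := by
    have := h1 (Sum.inl false)
    simp only [Sum.elim_inl] at this
    simpa [Function.comp_def] using (Complex.continuous_re.tendsto _).comp this
  have hms : Tendsto (fun n => m (τ n s)) atTop (𝓝 (m s)) := by
    have := h1 (Sum.inl true)
    simp only [Sum.elim_inl] at this
    simpa [Function.comp_def] using (Complex.continuous_re.tendsto _).comp this
  refine tendsto_duh_approx h3 h4 h2 hτs hms (fun n => hFτ n s) (fun n => hpos _ (hτS n s))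
    (fun n => ne_top_of_le_ne_top (ENNReal.mul_ne_top ENNReal.ofNat_ne_top ENNReal.ofReal_ne_top)
      (hG2 n s)) ?_ (hDcl x hgood) (fun t' ht' => h1 (Sum.inr ⟨x, t', ht'⟩))
    (fun t' ht' => h5 ⟨t', ht'⟩)
  have e1 : ∀ᶠ n : ℕ in atTop, |s| ≤ n := tendsto_natCast_atTop_atTop.eventually_ge_atTop _
  have e2 : ∀ᶠ n : ℕ in atTop, m (τ n s) < 2 * m s := hms.eventually_lt_const (by linarith)
  filter_upwards [e1, e2] with n c1 c2
  have e : sampled F m (τ n) n (T n) s = restr (T n) (F (τ n s)) :=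
    funext fun y => by simp [sampled, c1, c2.le]
  rw [e]
  exact hT n s

end

section

open Filter Topology

lemma liminf_add_liminf_le (a b : ℕ → ℝ≥0∞) :
    liminf a atTop + liminf b atTop ≤ liminf (fun n => a n + b n) atTop := by
  have h := lintegral_liminf_le (μ := (Measure.count : Measure Bool)) (u := atTop)
    (f := fun n i => if i then a n else b n) fun n => measurable_of_countable _
  simp only [lintegral_count, tsum_bool, if_true, Bool.false_eq_true, if_false] at h
  rw [add_comm]
  refine h.trans (le_of_eq ?_)
  congr 1
  funext n
  exact add_comm _ _

lemma liminf_rpow (a : ℕ → ℝ≥0∞) {k : ℝ} (hk : 0 < k) :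
    (liminf a atTop) ^ k = liminf (fun n => a n ^ k) atTop :=
  (ENNReal.orderIsoRpow k hk).liminf_apply

/-- Fatou's lemma for the endpoint Strichartz norms. -/
lemma endpoint_bounds_liminf {w : ℕ → ℝ → (Fin 2 → ℤ) → ℂ} {M : ℝ≥0∞} (hw : ∀ n, EP (w n) M)
    {u : ℝ → (Fin 2 → ℤ) → ℂ} (hu : ∀ t x, ‖u t x‖ₑ ≤ liminf (fun n => ‖w n t x‖ₑ) atTop) :
    (∀ t, eLpNorm (u t) 2 Measure.count ≤ M) ∧
      ∫⁻ t, eLpNorm (u t) ∞ Measure.count ^ (8/3:ℝ) ≤ M ^ (8/3:ℝ) := by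
  constructor
  · intro t
    refine (ENNReal.pow_le_pow_left_iff two_ne_zero).1 ?_
    rw [eLpNorm_two_sq]
    calc _ ≤ ∫⁻ x, liminf (fun n => ‖w n t x‖ₑ ^ 2) atTop ∂Measure.count := by
          refine lintegral_mono fun x => ?_
          have e := liminf_rpow (fun n => ‖w n t x‖ₑ) two_pos
          simp only [ENNReal.rpow_two] at e
          exact (pow_le_pow_left' (hu t x) 2).trans_eq e
      _ ≤ liminf (fun n => ∫⁻ x, ‖w n t x‖ₑ ^ 2 ∂Measure.count) atTop :=
          lintegral_liminf_le fun n => measurable_of_countable _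
      _ ≤ liminf (fun _ : ℕ => M ^ 2) atTop := by
          refine liminf_le_liminf (.of_forall fun n => ?_)
          rw [← eLpNorm_two_sq]
          exact pow_le_pow_left' ((hw n).two t) 2
      _ = _ := liminf_const _
  · calc _ ≤ ∫⁻ t, liminf (fun n => eLpNorm (w n t) ∞ Measure.count ^ (8/3:ℝ)) atTop := by
          refine lintegral_mono fun t => ?_
          dsimp only
          rw [← liminf_rpow _ (by norm_num)]
          refine ENNReal.rpow_le_rpow ?_ (by norm_num)
          rw [eLpNorm_top_count]
          refine iSup_le fun x => (hu t x).trans (liminf_le_liminf (.of_forall fun n => ?_))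
          exact enorm_le_eLpNorm_count _ x ENNReal.top_ne_zero
      _ ≤ liminf (fun n => ∫⁻ t, eLpNorm (w n t) ∞ Measure.count ^ (8/3:ℝ)) atTop :=
          lintegral_liminf_le fun n => (measurable_eLpNorm_count (hw n).meas ∞).pow_const _
      _ ≤ liminf (fun _ : ℕ => M ^ (8/3:ℝ)) atTop :=
          liminf_le_liminf (.of_forall fun n => (hw n).top)
      _ = _ := liminf_const _

lemma EP.norm {u M} (h : EP u M) : EP (fun t x => ((‖u t x‖ : ℝ) : ℂ)) M := by
  have e : ∀ t (r : ℝ≥0∞), eLpNorm (fun x => ((‖u t x‖ : ℝ) : ℂ)) r Measure.count =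
      eLpNorm (u t) r Measure.count := fun t r => eLpNorm_congr_norm_ae (.of_forall fun x => by simp)
  refine ⟨fun x => ?_, fun t => ?_, ?_⟩
  · have := h.meas x
    fun_prop
  · rw [e]; exact h.two t
  · simp_rw [e]; exact h.top

lemma Memℓp.eLpNorm_two_ne_top {f : (Fin 2 → ℤ) → ℂ} (h : Memℓp f 2) :
    eLpNorm f 2 Measure.count ≠ ∞ := by
  have hs := h.summable (by simp)
  simp only [ENNReal.toReal_ofNat] at hs
  have h2 : eLpNorm f 2 Measure.count ^ 2 ≠ ∞ := by
    rw [eLpNorm_two_sq, lintegral_count]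
    have e : ∀ x, ‖f x‖ₑ ^ 2 = ENNReal.ofReal (‖f x‖ ^ (2:ℝ)) := fun x => by
      rw [rpow_two, ENNReal.ofReal_pow (norm_nonneg _), ofReal_norm]
    simp_rw [e]
    exact hs.tsum_ofReal_ne_top
  intro hc
  simp [hc] at h2

lemma conjExponent_bounds {q q' : ℝ≥0∞} (hq : 2 ≤ q) (h : 1/q + 1/q' = 1) : 1 ≤ q' ∧ q' ≤ 2 := by
  constructor
  · have : 1/q' ≤ 1 := le_add_self.trans_eq h
    simpa using this
  · have h1 : 1/q ≤ 1/2 := ENNReal.div_le_div_left hq 1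
    have h2 : (1:ℝ≥0∞)/2 ≤ 1/q' := by
      by_contra hc
      have h3 : 1/q + 1/q' < 1/2 + 1/2 :=
        ENNReal.add_lt_add_of_le_of_lt (ne_top_of_le_ne_top (by norm_num) h1) h1 (not_le.1 hc)
      rw [h, ENNReal.add_halves] at h3
      exact lt_irrefl _ h3
    simpa using h2

lemma duhamel_zero_data (t : ℝ) (F : ℝ → (Fin 2 → ℤ) → ℂ) (x) :
    duhamel 2 t 0 0 F x = ∫ s in (0:ℝ)..t, sinProp 2 (t - s) (F s) x := by
  simp [duhamel, cosProp, sinProp]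

lemma duhamel_zero_forcing (t : ℝ) (f g : (Fin 2 → ℤ) → ℂ) (x) :
    duhamel 2 t f g (fun _ _ => 0) x = cosProp 2 t f x + sinProp 2 t g x := by
  simp [duhamel, sinProp]

lemma tendsto_of_enorm_sub_le {z : ℕ → ℂ} {w : ℂ}
    (h : ∀ n : ℕ, ‖z n - w‖ₑ ≤ ENNReal.ofReal (1 / ((n:ℝ) + 1))) : Tendsto z atTop (𝓝 w) := by
  rw [tendsto_iff_norm_sub_tendsto_zero]
  refine squeeze_zero (fun _ => norm_nonneg _) (fun n => ?_) tendsto_one_div_add_atTop_nhds_zero_nat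
  have := h n
  rwa [← ofReal_norm, ENNReal.ofReal_le_ofReal_iff (by positivity)] at this

lemma nice_zero (S) : Nice S fun _ _ => 0 where
  tf _ := ⟨measurable_const, ⟨0, by simp⟩, ⟨0, fun _ _ => rfl⟩⟩
  supp _ _ _ := rfl

/-- The inhomogeneous Strichartz estimate in dimension two, with a constant in `ℝ≥0∞`. -/
lemma exists_strichartz : ∃ C : ℝ≥0∞, C ≠ ∞ ∧ ∀ {q r qb rb qb' rb' : ℝ≥0∞}, 2 ≤ q → 2 ≤ r →
    2 ≤ qb → 2 ≤ rb → 1/q ≤ 3/4 * (1/2 - 1/r) → 1/qb ≤ 3/4 * (1/2 - 1/rb) →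
    1/qb + 1/qb' = 1 → 1/rb + 1/rb' = 1 →
    ∀ (f g : (Fin 2 → ℤ) → ℂ) (F : ℝ → (Fin 2 → ℤ) → ℂ), eLpNorm f 2 Measure.count ≠ ∞ →
      eLpNorm g 2 Measure.count ≠ ∞ → mixedNorm 2 qb' rb' F ≠ ∞ →
      mixedNorm 2 q r (fun t => duhamel 2 t f g F) ≤
        C * (eLpNorm f 2 Measure.count + eLpNorm g 2 Measure.count + mixedNorm 2 qb' rb' F) := by
  obtain ⟨C, hC, hmain⟩ := exists_duhamel_EP
  refine ⟨4 * C, ENNReal.mul_ne_top (by norm_num) hC, ?_⟩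
  intro q r qb rb qb' rb' hq hr hqb hrb hadm hadmb hqb' hrb' f g F hf hg hF
  obtain ⟨a1, a2⟩ := conjExponent_bounds hqb hqb'
  obtain ⟨b1, b2⟩ := conjExponent_bounds hrb hrb'
  have hqt : qb' ≠ ∞ := ne_top_of_le_ne_top (by norm_num) a2
  have hp : 1 ≤ qb'.toReal := by simpa using ENNReal.toReal_mono hqt a1
  have hmix : ∀ H : ℝ → (Fin 2 → ℤ) → ℂ, mixedNorm 2 qb' rb' H =
      (∫⁻ s, eLpNorm (H s) rb' Measure.count ^ qb'.toReal) ^ (1 / qb'.toReal) := fun H => by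
    rw [mixedNorm, lqNorm, if_neg hqt]
  set A := eLpNorm f 2 Measure.count with hA
  set B := eLpNorm g 2 Measure.count with hB
  set L := mixedNorm 2 qb' rb' F with hL
  have hF' : ∫⁻ s, eLpNorm (F s) rb' Measure.count ^ qb'.toReal ≠ ∞ := by
    intro hc
    rw [hL, hmix, hc, ENNReal.top_rpow_of_pos (by positivity)] at hF
    exact hF rfl
  have key : ∀ δ : ℝ≥0∞, δ ≠ 0 → δ ≠ ∞ →
      mixedNorm 2 q r (fun t => duhamel 2 t f g F) ≤ 4 * C * (A + B + (L + δ)) := by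
    intro δ hδ hδt
    obtain ⟨T, G, hG, hGL, hlim⟩ := exists_forcing_approx hp b1 b2 hF' hδ hδt
    have hU : ∀ n : ℕ, ∃ U : Finset (Fin 2 → ℤ),
        eLpNorm (fun y => restr U f y - f y) 2 Measure.count ≤ ENNReal.ofReal (1 / ((n:ℝ) + 1)) ∧
        eLpNorm (fun y => restr U g y - g y) 2 Measure.count ≤
          ENNReal.ofReal (1 / ((n:ℝ) + 1)) := fun n => by
      have h0 : ENNReal.ofReal (1 / ((n:ℝ) + 1)) ≠ 0 := (ENNReal.ofReal_pos.2 (by positivity)).ne'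
      exact ((eventually_restr_sub_le hf h0).and (eventually_restr_sub_le hg h0)).exists
    choose U hUf hUg using hU
    have hrf : ∀ (S : Finset (Fin 2 → ℤ)) (v : (Fin 2 → ℤ) → ℂ), ∀ y ∉ S, restr S v y = 0 :=
      fun S v y hy => by simp [restr, hy]
    have hGL' : ∀ n, mixedNorm 2 qb' rb' (G n) ≤ 2 * (L + δ) := fun n => by
      rw [hL, hmix, hmix]; exact hGL n
    have hG0 : ∀ n, mixedNorm 2 qb' rb' (fun _ _ => 0) ≤ 2 * (L + δ) := fun n =>
      (mixedNorm_mono fun t x => by simp).trans (hGL' n)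
    have h1 : ∀ n, EP (fun t => duhamel 2 t (restr (U n) f) (restr (U n) g) fun _ _ => 0)
        (C * (A + B + 2 * (L + δ))) := fun n =>
      (hmain hqb hrb hadmb hqb' hrb' (U n) _ _ _ (hrf _ _) (hrf _ _)
        (nice_zero _)).mono
        (mul_le_mul_right (add_le_add (add_le_add (eLpNorm_restr_le _ _ _)
          (eLpNorm_restr_le _ _ _)) (hG0 n)) _)
    have h2 : ∀ n, EP (fun t => duhamel 2 t 0 0 (G n)) (C * (A + B + 2 * (L + δ))) := fun n =>
      (hmain hqb hrb hadmb hqb' hrb' (T n) 0 0 _ (fun _ _ => rfl) (fun _ _ => rfl) (hG n)).mono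
        (mul_le_mul_right (add_le_add (add_le_add (by simp) (by simp)) (hGL' n)) _)
    have h3 := endpoint_bounds_liminf (u := fun t => duhamel 2 t f g F)
      (fun n => (h1 n).norm.add (h2 n).norm) fun t x => ?_
    · refine (mixedNorm_le_of_endpoints hq hr hadm h3.1 h3.2).trans ?_
      calc _ ≤ C * (2 * (A + B) + 2 * (L + δ)) + C * (2 * (A + B) + 2 * (L + δ)) := by
            gcongr <;> exact le_mul_of_one_le_left' one_le_two
        _ = _ := by ring
    have hcos : Tendsto (fun n => cosProp 2 t (restr (U n) f) x) atTop (𝓝 (cosProp 2 t f x)) :=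
      tendsto_of_enorm_sub_le fun n => by
        rw [← cosProp_sub _ (ne_top_of_le_ne_top hf (eLpNorm_restr_le _ _ _)) hf]
        exact (enorm_cosProp_le _ _ _).trans (hUf n)
    have hsin : Tendsto (fun n => sinProp 2 t (restr (U n) g) x) atTop (𝓝 (sinProp 2 t g x)) :=
      tendsto_of_enorm_sub_le fun n => by
        rw [← sinProp_sub _ (ne_top_of_le_ne_top hg (eLpNorm_restr_le _ _ _)) hg]
        exact (enorm_sinProp_le _ _ _).trans (hUg n)
    have hsum := ((continuous_enorm.tendsto _).comp (hcos.add hsin)).liminf_eq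
    have e : ∀ n, ‖((‖duhamel 2 t (restr (U n) f) (restr (U n) g) (fun _ _ => 0) x‖ : ℝ) : ℂ) +
        ((‖duhamel 2 t 0 0 (G n) x‖ : ℝ) : ℂ)‖ₑ =
        ‖cosProp 2 t (restr (U n) f) x + sinProp 2 t (restr (U n) g) x‖ₑ +
          ‖∫ s in (0:ℝ)..t, sinProp 2 (t - s) (G n s) x‖ₑ := fun n => by
      rw [duhamel_zero_data, duhamel_zero_forcing, ← Complex.ofReal_add, ← ofReal_norm,
        Complex.norm_real, norm_of_nonneg (by positivity),
        ENNReal.ofReal_add (norm_nonneg _) (norm_nonneg _), ofReal_norm, ofReal_norm]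
    simp_rw [e]
    refine le_trans ?_ (liminf_add_liminf_le _ _)
    refine (enorm_add_le _ _).trans (add_le_add (le_of_eq hsum.symm) (hlim t x))
  refine ENNReal.le_of_forall_pos_le_add fun ε hε _ => ?_
  rcases eq_or_ne C 0 with h0 | h0
  · exact (key 1 one_ne_zero (by norm_num)).trans (by simp [h0])
  have h4 : 4 * C ≠ 0 := mul_ne_zero (by norm_num) h0
  have h4t : 4 * C ≠ ∞ := ENNReal.mul_ne_top (by norm_num) hC
  refine (key (ε / (4 * C)) (ENNReal.div_ne_zero.2 ⟨by simpa using hε.ne', h4t⟩)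
    (ENNReal.div_ne_top ENNReal.coe_ne_top h4)).trans (le_of_eq ?_)
  rw [← add_assoc, mul_add, ENNReal.mul_div_cancel h4 h4t]

end

/-- Strichartz estimates for the discrete Klein--Gordon equation in dimension `d = 2`:
for `q, r, q̄, r̄ ≥ 2` with `1/q ≤ (3/4)(1/2 − 1/r)` and `1/q̄ ≤ (3/4)(1/2 − 1/r̄)`,
the solution given by Duhamel's formula satisfies
`‖u‖_{L^q_t ℓ^r_x} ≤ C(‖f‖_{ℓ²} + ‖g‖_{ℓ²} + ‖F‖_{L^{q̄'}_t ℓ^{r̄'}_x})`. -/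
theorem strichartz_d2 (q r qb rb qb' rb' : ℝ≥0∞)
    (hq : 2 ≤ q) (hr : 2 ≤ r) (hqb : 2 ≤ qb) (hrb : 2 ≤ rb)
    (hadm : 1/q ≤ 3/4 * (1/2 - 1/r))
    (hadmb : 1/qb ≤ 3/4 * (1/2 - 1/rb))
    (hqb' : 1/qb + 1/qb' = 1) (hrb' : 1/rb + 1/rb' = 1) :
    ∃ C : ℝ, 0 < C ∧
      ∀ (f g : (Fin 2 → ℤ) → ℂ) (F : ℝ → (Fin 2 → ℤ) → ℂ),
        Memℓp f 2 → Memℓp g 2 → mixedNorm 2 qb' rb' F ≠ ∞ →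
        mixedNorm 2 q r (fun t => duhamel 2 t f g F) ≤
          ENNReal.ofReal C *
            (eLpNorm f 2 Measure.count + eLpNorm g 2 Measure.count
              + mixedNorm 2 qb' rb' F) := by
  obtain ⟨C, hC, h⟩ := exists_strichartz
  refine ⟨C.toReal + 1, by positivity, fun f g F hf hg hF => ?_⟩
  refine (h hq hr hqb hrb hadm hadmb hqb' hrb' f g F hf.eLpNorm_two_ne_top hg.eLpNorm_two_ne_top
    hF).trans (mul_le_mul_left ?_ _)
  rw [ENNReal.ofReal_add ENNReal.toReal_nonneg zero_le_one, ENNReal.ofReal_toReal hC]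
  exact le_self_add
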